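/- For every integer n ≥ 1, in the space R_n = {(f₁,…,fₙ) ∈ (Diff⁺^∞[0,1])ⁿ : fᵢ∘fⱼ = fⱼ∘fᵢ for all 1 ≤ i,j ≤ n} of C^∞ orientation-preserving actions of ℤⁿ on [0,1], endowed with the topology induced by the C^∞ topology, the path-connected component of (id,…,id) is dense in R_n; in particular R_n is connected. -/

import Mathlib

set_option autoImplicit false

open Set

/-- `f : ℝ → ℝ` represents (a smooth extension of) an orientation-preserving `C^∞`
diffeomorphism of the interval `[0,1]`. -/
def SmoothDiffeoI (f : ℝ → ℝ) : Prop :=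
  ContDiff ℝ (⊤ : ℕ∞) f ∧ f 0 = 0 ∧ f 1 = 1 ∧ (∀ x ∈ Icc (0 : ℝ) 1, 0 < deriv f x) ∧
    MapsTo f (Icc (0 : ℝ) 1) (Icc (0 : ℝ) 1)

/-- The space `R_n` of `n`-tuples of pairwise commuting orientation-preserving `C^∞`
diffeomorphisms of `[0,1]`, i.e. of representations of `ℤⁿ` in `Diff⁺^∞[0,1]`. -/
def RepSpace (n : ℕ) : Type :=
  {F : Fin n → ℝ → ℝ //
    (∀ i, SmoothDiffeoI (F i)) ∧
      ∀ i j, ∀ x ∈ Icc (0 : ℝ) 1, F i (F j x) = F j (F i x)}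

/-- The `C^∞` topology on `R_n`: the topology induced by all the maps recording the
iterated derivatives (of every order, of every coordinate) on `[0,1]`, each target carrying
the topology of uniform convergence. -/
noncomputable instance (n : ℕ) : TopologicalSpace (RepSpace n) :=
  TopologicalSpace.induced
    (fun F : RepSpace n => fun (i : Fin n) (k : ℕ) =>
      ContinuousMap.mk (fun x : Icc (0 : ℝ) 1 => iteratedDeriv k (F.1 i) x)
        (((F.2.1 i).1.continuous_iteratedDeriv k (by exact_mod_cast le_top)).comp
          continuous_subtype_val))
    inferInstance

/-- The trivial representation `(id, …, id)`. -/
def idRep (n : ℕ) : RepSpace n :=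
  ⟨fun _ => id,
    fun _ => ⟨contDiff_id, rfl, rfl, fun x _ => by simp, mapsTo_id _⟩,
    fun _ _ _ _ => rfl⟩

section
open Set
open scoped ContDiff

/-- Weighted derivative bounds up to order `R` on `J`. -/
def Bd (J : Set ℝ) (R : ℕ) (L C : ℝ) (u : ℝ → ℝ) : Prop :=
  ∀ j ≤ R, ∀ x ∈ J, |iteratedDeriv j u x| ≤ C * L ^ j

lemma sm_deriv {u : ℝ → ℝ} (hu : ContDiff ℝ ∞ u) : ContDiff ℝ ∞ (deriv u) :=
  (contDiff_infty_iff_deriv.1 hu).2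

lemma sm_diff {u : ℝ → ℝ} (hu : ContDiff ℝ ∞ u) : Differentiable ℝ u :=
  hu.differentiable (by simp)

lemma sm_iter {u : ℝ → ℝ} (hu : ContDiff ℝ ∞ u) (j : ℕ) : ContDiff ℝ ∞ (iteratedDeriv j u) := by
  induction j generalizing u with
  | zero => simpa using hu
  | succ k ih => rw [iteratedDeriv_succ']; exact ih (sm_deriv hu)

lemma sm_at {u : ℝ → ℝ} (hu : ContDiff ℝ ∞ u) (j : ℕ) (x : ℝ) : ContDiffAt ℝ j u x :=
  (hu.of_le (by exact_mod_cast le_top)).contDiffAt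

namespace Bd
variable {J : Set ℝ} {R : ℕ} {L C D : ℝ} {u v : ℝ → ℝ}

lemma mono (h : Bd J R L C u) {R' : ℕ} {L' C' : ℝ} (hR : R' ≤ R) (hC0 : 0 ≤ C') (hL0 : 0 ≤ L)
    (hL : L ≤ L') (hC : C ≤ C') : Bd J R' L' C' u := by
  intro j hj x hx
  refine (h j (hj.trans hR) x hx).trans ?_
  have h1 : L ^ j ≤ L' ^ j := pow_le_pow_left₀ hL0 hL j
  have h2 : 0 ≤ L ^ j := by positivity
  nlinarith [mul_le_mul_of_nonneg_right hC h2, mul_le_mul_of_nonneg_left h1 hC0]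

lemma monoR (h : Bd J R L C u) {R' : ℕ} (hR : R' ≤ R) : Bd J R' L C u :=
  fun j hj x hx => h j (hj.trans hR) x hx

lemma monoC (h : Bd J R L C u) (hL0 : 0 ≤ L) {C' : ℝ} (hC : C ≤ C') : Bd J R L C' u := by
  intro j hj x hx
  exact (h j hj x hx).trans (mul_le_mul_of_nonneg_right hC (by positivity))

lemma nonneg (h : Bd J R L C u) (hJ : J.Nonempty) : 0 ≤ C := by
  obtain ⟨x, hx⟩ := hJ
  have := h 0 (Nat.zero_le _) x hx
  simp at this
  exact (abs_nonneg _).trans this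

lemma zero_le (h : Bd J R L C u) {x : ℝ} (hx : x ∈ J) : |u x| ≤ C := by
  simpa using h 0 (Nat.zero_le _) x hx

lemma mul (hu : ContDiff ℝ ∞ u) (hv : ContDiff ℝ ∞ v) (hL : 0 ≤ L)
    (h : Bd J R L C u) (k : Bd J R L D v) :
    Bd J R L (2 ^ R * C * D) (fun x => u x * v x) := by
  intro j hj x hx
  have hC : 0 ≤ C := h.nonneg ⟨x, hx⟩
  have hD : 0 ≤ D := k.nonneg ⟨x, hx⟩
  rw [iteratedDeriv_fun_mul (sm_at hu j x) (sm_at hv j x)]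
  calc _ ≤ ∑ i ∈ Finset.range (j + 1), (j.choose i : ℝ) * (C * D * L ^ j) := by
        refine (Finset.abs_sum_le_sum_abs _ _).trans (Finset.sum_le_sum ?_)
        intro i hi
        have hi' : i ≤ j := by simpa [Nat.lt_succ_iff] using hi
        have h1 := h i (hi'.trans hj) x hx
        have h2 := k (j - i) ((Nat.sub_le _ _).trans hj) x hx
        rw [abs_mul, abs_mul, mul_assoc, Nat.abs_cast]
        refine mul_le_mul_of_nonneg_left ?_ (by positivity)
        calc _ ≤ (C * L ^ i) * (D * L ^ (j - i)) :=
              mul_le_mul h1 h2 (abs_nonneg _) (by positivity)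
          _ = C * D * (L ^ i * L ^ (j - i)) := by ring
          _ = _ := by rw [← pow_add, Nat.add_sub_cancel' hi']
    _ = 2 ^ j * (C * D * L ^ j) := by
        rw [← Finset.sum_mul]
        congr 1
        exact_mod_cast Nat.sum_range_choose j
    _ ≤ _ := by
        have : (2:ℝ) ^ j ≤ 2 ^ R := pow_le_pow_right₀ (by norm_num) hj
        have h3 : 0 ≤ C * D * L ^ j := by positivity
        nlinarith [mul_le_mul_of_nonneg_right this h3]

lemma add (hu : ContDiff ℝ ∞ u) (hv : ContDiff ℝ ∞ v)
    (h : Bd J R L C u) (k : Bd J R L D v) : Bd J R L (C + D) (fun x => u x + v x) := by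
  intro j hj x hx
  rw [iteratedDeriv_fun_add (sm_at hu j x) (sm_at hv j x)]
  refine (abs_add_le _ _).trans ?_
  rw [add_mul]
  exact add_le_add (h j hj x hx) (k j hj x hx)

lemma neg (h : Bd J R L C u) : Bd J R L C (fun x => - u x) := by
  intro j hj x hx
  rw [iteratedDeriv_fun_neg, abs_neg]
  exact h j hj x hx

lemma sub (hu : ContDiff ℝ ∞ u) (hv : ContDiff ℝ ∞ v)
    (h : Bd J R L C u) (k : Bd J R L D v) : Bd J R L (C + D) (fun x => u x - v x) := by
  simpa [sub_eq_add_neg] using h.add hu hv.neg k.neg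

lemma smul (c : ℝ) (h : Bd J R L C u) : Bd J R L (|c| * C) (fun x => c * u x) := by
  intro j hj x hx
  rw [iteratedDeriv_const_mul_field, abs_mul, mul_assoc]
  exact mul_le_mul_of_nonneg_left (h j hj x hx) (abs_nonneg _)

lemma const (c : ℝ) (hL : 0 ≤ L) (hc : |c| ≤ C) : Bd J R L C (fun _ => c) := by
  intro j hj x hx
  have : 0 ≤ C := (abs_nonneg _).trans hc
  rcases j with _ | j
  · simpa using hc
  · rw [iteratedDeriv_const]; simp; positivity

lemma dv (h : Bd J (R + 1) L C u) : Bd J R L (C * L) (deriv u) := by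
  intro j hj x hx
  have := h (j + 1) (by omega) x hx
  rw [iteratedDeriv_succ'] at this
  rw [mul_assoc, ← pow_succ']
  exact this

lemma of_deriv (h0 : ∀ x ∈ J, |u x| ≤ C) (h : Bd J R L (C * L) (deriv u)) :
    Bd J (R + 1) L C u := by
  intro j hj x hx
  rcases j with _ | j
  · simpa using h0 x hx
  · have := h j (by omega) x hx
    rw [iteratedDeriv_succ', pow_succ', ← mul_assoc]
    exact this

end Bd

lemma Bd.comp_aux {J : Set ℝ} (R : ℕ) {C : ℝ} (hC : 0 ≤ C) : ∃ E : ℝ, 1 ≤ E ∧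
    ∀ (a w : ℝ → ℝ) (L A : ℝ), ContDiff ℝ ∞ a → ContDiff ℝ ∞ w → 1 ≤ L → MapsTo w J J →
      Bd J R L A a → Bd J (R - 1) L C (deriv w) → Bd J R L (E * A) (fun x => a (w x)) := by
  induction R with
  | zero =>
    refine ⟨1, le_rfl, ?_⟩
    intro a w L A ha hw hL hm hA hB j hj x hx
    obtain rfl : j = 0 := by omega
    simpa using hA.zero_le (hm hx)
  | succ R ih =>
    obtain ⟨E, hE, ih⟩ := ih
    refine ⟨1 + 2 ^ R * E * C, by nlinarith [show 0 ≤ 2 ^ R * E * C by positivity], ?_⟩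
    intro a w L A ha hw hL hm hA hB
    have hL0 : 0 ≤ L := by linarith
    apply Bd.of_deriv
    · intro x hx
      have hA0 := hA.nonneg ⟨x, hx⟩
      have := hA.zero_le (hm hx)
      nlinarith [show 0 ≤ 2 ^ R * E * C * A by positivity]
    · have hd : deriv (fun x => a (w x)) = fun x => deriv a (w x) * deriv w x := by
        funext x
        exact ((sm_diff ha _).hasDerivAt.comp x (sm_diff hw x).hasDerivAt).deriv
      rw [hd]
      have h1 := ih (deriv a) w L (A * L) (sm_deriv ha) hw hL hm hA.dv
        (hB.monoR (by omega))
      have h2 := h1.mul ((sm_deriv ha).comp hw) (sm_deriv hw) hL0 (hB.monoR (by omega))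
      intro j hj x hx
      have hA0 := hA.nonneg ⟨x, hx⟩
      refine (h2 j hj x hx).trans ?_
      refine mul_le_mul_of_nonneg_right ?_ (by positivity)
      nlinarith [show 0 ≤ A * L by positivity]

lemma Bd.inv_aux {J : Set ℝ} (R : ℕ) {C c : ℝ} (hC : 0 ≤ C) (hc : 0 < c) : ∃ E : ℝ, 0 ≤ E ∧
    ∀ (z : ℝ → ℝ) (L : ℝ), ContDiff ℝ ∞ z → 1 ≤ L → (∀ x, z x ≠ 0) → (∀ x ∈ J, c ≤ |z x|) →
      Bd J R L C z → Bd J R L E (fun x => (z x)⁻¹) := by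
  induction R with
  | zero =>
    refine ⟨c⁻¹, by positivity, ?_⟩
    intro z L hz hL h0 h1 hB j hj x hx
    obtain rfl : j = 0 := by omega
    simp only [iteratedDeriv_zero, pow_zero, mul_one, abs_inv]
    exact inv_anti₀ hc (h1 x hx)
  | succ R ih =>
    obtain ⟨E, hE, ih⟩ := ih
    refine ⟨c⁻¹ + 2 ^ R * C * (2 ^ R * E * E), by positivity, ?_⟩
    intro z L hz hL h0 h1 hB
    have hL0 : 0 ≤ L := by linarith
    apply Bd.of_deriv
    · intro x hx
      rw [abs_inv]
      have := inv_anti₀ hc (h1 x hx)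
      have : 0 ≤ 2 ^ R * C * (2 ^ R * E * E) := by positivity
      linarith
    · have hd : deriv (fun x => (z x)⁻¹) = fun x => -(deriv z x * ((z x)⁻¹ * (z x)⁻¹)) := by
        funext x
        rw [((sm_diff hz x).hasDerivAt.fun_inv (h0 x)).deriv]
        have := h0 x
        field_simp
      rw [hd]
      have hi : ContDiff ℝ ∞ (fun x => (z x)⁻¹) := hz.inv h0
      have h2 := ih z L hz hL h0 h1 (hB.monoR (by omega))
      have h3 := hB.dv.mul (sm_deriv hz) (hi.mul hi) hL0 (h2.mul hi hi hL0 h2)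
      refine h3.neg.monoC hL0 ?_
      have : 0 ≤ c⁻¹ * L := by positivity
      nlinarith

/-- difference lemma -/
lemma Bd.delta_aux {J : Set ℝ} (hJ : Convex ℝ J) (b : ℕ) {C : ℝ} (hC : 0 ≤ C) : ∃ E : ℝ, 1 ≤ E ∧
    ∀ (φ h : ℝ → ℝ) (L M τ : ℝ), ContDiff ℝ ∞ φ → ContDiff ℝ ∞ h → 1 ≤ L → MapsTo h J J →
      Bd J b L M (deriv φ) → Bd J (b - 1) L C (deriv h) → Bd J b L τ (fun x => h x - x) →
      Bd J b L (E * (M * τ)) (fun x => φ (h x) - φ x) := by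
  induction b with
  | zero =>
    refine ⟨1, le_rfl, ?_⟩
    intro φ h L M τ hφ hh hL hm hM hB hu j hj x hx
    obtain rfl : j = 0 := by omega
    have hM0 := hM.nonneg ⟨x, hx⟩
    have h1 := hJ.norm_image_sub_le_of_norm_deriv_le (f := φ) (C := M)
      (fun y _ => sm_diff hφ y) (fun y hy => hM.zero_le hy) hx (hm hx)
    have h2 := hu.zero_le hx
    simp only [Real.norm_eq_abs] at h1
    simp only [iteratedDeriv_zero, pow_zero, mul_one, one_mul]
    exact h1.trans (mul_le_mul_of_nonneg_left h2 hM0)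
  | succ b ih =>
    obtain ⟨E, hE, ih⟩ := ih
    refine ⟨1 + 2 ^ b * E * C + 2 ^ b, by nlinarith [show 0 ≤ 2 ^ b * E * C + 2 ^ b by positivity], ?_⟩
    intro φ h L M τ hφ hh hL hm hM hB hu
    have hL0 : 0 ≤ L := by linarith
    have hmul : ∀ x ∈ J, 0 ≤ M * τ := fun x hx =>
      mul_nonneg (hM.nonneg ⟨x, hx⟩) (hu.nonneg ⟨x, hx⟩)
    apply Bd.of_deriv
    · intro x hx
      have h1 := hJ.norm_image_sub_le_of_norm_deriv_le (f := φ) (C := M)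
        (fun y _ => sm_diff hφ y) (fun y hy => hM.zero_le hy) hx (hm hx)
      simp only [Real.norm_eq_abs] at h1
      have h2 := mul_le_mul_of_nonneg_left (hu.zero_le hx) (hM.nonneg ⟨x, hx⟩)
      have h4 : 0 ≤ (2 ^ b * E * C + 2 ^ b) * (M * τ) := by
        have := hmul x hx
        positivity
      nlinarith
    · have hd : deriv (fun x => φ (h x) - φ x) =
          fun x => (deriv φ (h x) - deriv φ x) * deriv h x + deriv φ x * deriv (fun x => h x - x) x := by
        funext x
        have e1 := ((sm_diff hφ (h x)).hasDerivAt.comp x (sm_diff hh x).hasDerivAt).sub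
          (sm_diff hφ x).hasDerivAt
        have e2 := (sm_diff hh x).hasDerivAt.sub (hasDerivAt_id x)
        have e3 : deriv (fun x => h x - x) x = deriv h x - 1 := e2.deriv
        have e4 : deriv (fun x => φ (h x) - φ x) x = deriv φ (h x) * deriv h x - deriv φ x := e1.deriv
        rw [e3, e4]; ring
      rw [hd]
      have hφ' := sm_deriv hφ
      have hus : ContDiff ℝ ∞ (fun x => h x - x) := hh.sub contDiff_id
      have h1 := ih (deriv φ) h L (M * L) τ hφ' hh hL hm hM.dv (hB.monoR (by omega))
        (hu.monoR (by omega))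
      have hs : ContDiff ℝ ∞ (fun x => deriv φ (h x) - deriv φ x) := (hφ'.comp hh).sub hφ'
      have h2 := h1.mul hs (sm_deriv hh) hL0 (hB.monoR (by omega))
      have h3 := (hM.monoR (Nat.le_succ b)).mul hφ' (sm_deriv hus) hL0 hu.dv
      have h4 := h2.add (hs.mul (sm_deriv hh)) (hφ'.mul (sm_deriv hus)) h3
      intro j hj x hx
      refine (h4 j hj x hx).trans ?_
      refine mul_le_mul_of_nonneg_right ?_ (by positivity)
      have := hmul x hx
      nlinarith [show 0 ≤ (M * τ) * L by positivity]

end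

section
open Set
open scoped ContDiff

lemma deriv_iter {u : ℝ → ℝ} (i : ℕ) : deriv (iteratedDeriv i u) = iteratedDeriv (i + 1) u := by
  rw [iteratedDeriv_succ]

lemma exists_small_deriv (i : ℕ) : ∃ C : ℝ, 0 ≤ C ∧ ∀ (u : ℝ → ℝ) (s t M : ℝ), ContDiff ℝ ∞ u →
    s < t → (∀ x ∈ Icc s t, |u x| ≤ M) → ∃ ξ ∈ Icc s t, |iteratedDeriv i u ξ| ≤ C * M / (t - s) ^ i := by
  induction i with
  | zero =>
    refine ⟨1, zero_le_one, fun u s t M hu hst h => ⟨s, left_mem_Icc.2 hst.le, ?_⟩⟩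
    simpa using h s (left_mem_Icc.2 hst.le)
  | succ i ih =>
    obtain ⟨C, hC, ih⟩ := ih
    refine ⟨2 * 3 ^ (i + 1) * C, by positivity, fun u s t M hu hst h => ?_⟩
    set δ := (t - s) / 3 with hδ
    have hδ0 : 0 < δ := by rw [hδ]; linarith
    obtain ⟨a, ha, ha'⟩ := ih u s (s + δ) M hu (by linarith)
      (fun x hx => h x ⟨hx.1, by linarith [hx.2]⟩)
    obtain ⟨b, hb, hb'⟩ := ih u (t - δ) t M hu (by linarith)
      (fun x hx => h x ⟨by linarith [hx.1], hx.2⟩)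
    have e1 : s + δ - s = δ := by ring
    have e2 : t - (t - δ) = δ := by ring
    rw [e1] at ha'
    rw [e2] at hb'
    have hab : δ ≤ b - a := by linarith [ha.2, hb.1]
    obtain ⟨ξ, hξ, hξ'⟩ := exists_deriv_eq_slope (iteratedDeriv i u) (show a < b by linarith)
      (sm_iter hu i).continuous.continuousOn (sm_diff (sm_iter hu i)).differentiableOn
    refine ⟨ξ, ⟨by linarith [ha.1, hξ.1], by linarith [hb.2, hξ.2]⟩, ?_⟩
    rw [deriv_iter] at hξ'
    rw [hξ', abs_div, abs_of_pos (by linarith : 0 < b - a)]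
    have hnum : |iteratedDeriv i u b - iteratedDeriv i u a| ≤ 2 * (C * M / δ ^ i) := by
      refine (abs_sub _ _).trans ?_
      linarith
    have hpos : 0 ≤ 2 * (C * M / δ ^ i) := (abs_nonneg _).trans hnum
    calc _ ≤ 2 * (C * M / δ ^ i) / δ := div_le_div₀ hpos hnum hδ0 hab
      _ = _ := by
        rw [hδ]
        have : t - s ≠ 0 := by linarith
        rw [div_pow, pow_succ, pow_succ]
        field_simp

lemma landau (p q : ℝ) (hpq : p < q) (K : ℕ) : ∃ C : ℝ, 0 ≤ C ∧ ∀ (u : ℝ → ℝ) (M0 MK : ℝ),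
    ContDiff ℝ ∞ u → (∀ x ∈ Icc p q, |u x| ≤ M0) → (∀ x ∈ Icc p q, |iteratedDeriv K u x| ≤ MK) →
    ∀ η : ℝ, 0 < η → η ≤ 1 → ∀ i ≤ K, ∀ x ∈ Icc p q,
      |iteratedDeriv i u x| ≤ C * (M0 / η ^ i + η ^ (K - i) * MK) := by
  obtain ⟨ℓ, hℓ0, hℓ1, hℓ⟩ : ∃ ℓ : ℝ, 0 < ℓ ∧ ℓ ≤ 1 ∧ ℓ ≤ q - p :=
    ⟨min 1 (q - p), lt_min one_pos (by linarith), min_le_left _ _, min_le_right _ _⟩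
  suffices H : ∀ d ≤ K, ∃ C : ℝ, 0 ≤ C ∧ ∀ (u : ℝ → ℝ) (M0 MK : ℝ),
    ContDiff ℝ ∞ u → (∀ x ∈ Icc p q, |u x| ≤ M0) → (∀ x ∈ Icc p q, |iteratedDeriv K u x| ≤ MK) →
    ∀ η : ℝ, 0 < η → η ≤ 1 → ∀ x ∈ Icc p q,
      |iteratedDeriv (K - d) u x| ≤ C * (M0 / η ^ (K - d) + η ^ d * MK) by
    choose! C hC0 hC using H
    refine ⟨∑ d ∈ Finset.range (K + 1), C d, Finset.sum_nonneg fun d hd =>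
      hC0 d (by simpa [Nat.lt_succ_iff] using hd), ?_⟩
    intro u M0 MK hu h0 hK η hη hη1 i hi x hx
    have h1 := hC (K - i) (Nat.sub_le _ _) u M0 MK hu h0 hK η hη hη1 x hx
    rw [Nat.sub_sub_self hi] at h1
    refine h1.trans (mul_le_mul_of_nonneg_right ?_ ?_)
    · exact Finset.single_le_sum (f := C) (fun d hd => hC0 d (by simpa [Nat.lt_succ_iff] using hd))
        (Finset.mem_range.2 (by omega))
    · have a1 := (abs_nonneg _).trans (h0 x hx)
      have a2 := (abs_nonneg _).trans (hK x hx)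
      positivity
  intro d
  induction d with
  | zero =>
    intro _
    refine ⟨1, zero_le_one, ?_⟩
    intro u M0 MK hu h0 hK η hη hη1 x hx
    have a1 := (abs_nonneg _).trans (h0 x hx)
    have := hK x hx
    simp only [Nat.sub_zero, pow_zero, one_mul]
    have : 0 ≤ M0 / η ^ K := by positivity
    linarith [hK x hx]
  | succ d ih =>
    intro hd
    obtain ⟨C, hC, ih⟩ := ih (by omega)
    obtain ⟨B, hB, hB'⟩ := exists_small_deriv (K - (d + 1))
    set i := K - (d + 1) with hi
    have hi1 : K - d = i + 1 := by omega
    refine ⟨B / ℓ ^ i + C, by positivity, ?_⟩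
    intro u M0 MK hu h0 hK η hη hη1 x hx
    have a1 := (abs_nonneg _).trans (h0 x hx)
    have a2 := (abs_nonneg _).trans (hK x hx)
    have hηℓ : 0 < η * ℓ := by positivity
    have hηℓ' : η * ℓ ≤ q - p := by nlinarith
    obtain ⟨s, hs0, hs1, hs2, hs3⟩ : ∃ s, p ≤ s ∧ s + η * ℓ ≤ q ∧ s ≤ x ∧ x ≤ s + η * ℓ := by
      rcases le_total x (q - η * ℓ) with h | h
      · exact ⟨x, hx.1, by linarith, le_rfl, by linarith⟩
      · exact ⟨q - η * ℓ, by linarith, by linarith, h, by linarith [hx.2]⟩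
    obtain ⟨ξ, hξ, hξ'⟩ := hB' u s (s + η * ℓ) M0 hu (by linarith)
      (fun y hy => h0 y ⟨by linarith [hy.1], by linarith [hy.2]⟩)
    have hb : ∀ y ∈ Icc s (s + η * ℓ), ‖deriv (iteratedDeriv i u) y‖ ≤
        C * (M0 / η ^ (i + 1) + η ^ d * MK) := by
      intro y hy
      rw [deriv_iter, ← hi1]
      exact ih u M0 MK hu h0 hK η hη hη1 y ⟨by linarith [hy.1], by linarith [hy.2]⟩
    have h1 := (convex_Icc s (s + η * ℓ)).norm_image_sub_le_of_norm_deriv_le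
      (fun y _ => sm_diff (sm_iter hu i) y) hb hξ ⟨hs2, hs3⟩
    rw [Real.norm_eq_abs, Real.norm_eq_abs] at h1
    have h2 : |x - ξ| ≤ η := by
      rw [abs_le]
      constructor <;> nlinarith [hξ.1, hξ.2]
    have hX : 0 ≤ C * (M0 / η ^ (i + 1) + η ^ d * MK) := by positivity
    have h3 : C * (M0 / η ^ (i + 1) + η ^ d * MK) * |x - ξ| ≤
        C * (M0 / η ^ i + η ^ (d + 1) * MK) := by
      refine (mul_le_mul_of_nonneg_left h2 hX).trans (le_of_eq ?_)
      rw [pow_succ, pow_succ]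
      field_simp
    have h4 : B * M0 / (s + η * ℓ - s) ^ i = B / ℓ ^ i * (M0 / η ^ i) := by
      rw [show s + η * ℓ - s = η * ℓ by ring, mul_pow]
      field_simp
    rw [h4] at hξ'
    have h5 : |iteratedDeriv i u x| ≤ |iteratedDeriv i u ξ| +
        |iteratedDeriv i u x - iteratedDeriv i u ξ| := by
      have := abs_add_le (iteratedDeriv i u ξ) (iteratedDeriv i u x - iteratedDeriv i u ξ)
      simpa using this
    have h6 : 0 ≤ B / ℓ ^ i * (η ^ (d + 1) * MK) := by positivity
    linarith [add_mul (B / ℓ ^ i) C (M0 / η ^ i + η ^ (d + 1) * MK),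
      mul_add (B / ℓ ^ i) (M0 / η ^ i) (η ^ (d + 1) * MK)]

end

section
open Set
open scoped ContDiff

lemma eqOn_deriv {p q : ℝ} (hpq : p < q) {u v : ℝ → ℝ} (hu : ContDiff ℝ ∞ u) (hv : ContDiff ℝ ∞ v)
    (h : EqOn u v (Icc p q)) : EqOn (deriv u) (deriv v) (Icc p q) := by
  intro x hx
  have hU := (uniqueDiffOn_Icc hpq) x hx
  rw [← (sm_diff hu x).derivWithin hU, ← (sm_diff hv x).derivWithin hU]
  exact derivWithin_congr h (h hx)

lemma eqOn_iter {p q : ℝ} (hpq : p < q) {u v : ℝ → ℝ} (hu : ContDiff ℝ ∞ u) (hv : ContDiff ℝ ∞ v)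
    (h : EqOn u v (Icc p q)) (k : ℕ) :
    EqOn (iteratedDeriv k u) (iteratedDeriv k v) (Icc p q) := by
  induction k generalizing u v with
  | zero => simpa using h
  | succ k ih =>
    rw [iteratedDeriv_succ', iteratedDeriv_succ']
    exact ih (sm_deriv hu) (sm_deriv hv) (eqOn_deriv hpq hu hv h)

lemma Bd.congr {p q : ℝ} (hpq : p < q) {u v : ℝ → ℝ} (hu : ContDiff ℝ ∞ u) (hv : ContDiff ℝ ∞ v)
    {R : ℕ} {L C : ℝ} (h : EqOn u v (Icc p q)) (hb : Bd (Icc p q) R L C u) :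
    Bd (Icc p q) R L C v := by
  intro j hj x hx
  rw [← eqOn_iter hpq hu hv h j hx]
  exact hb j hj x hx

/-- smooth action of an additive commutative group on `[p,q]` by global lifts -/
structure Act {Γ : Type*} [AddCommGroup Γ] (p q : ℝ) (V : Γ → ℝ → ℝ) : Prop where
  hpq : p < q
  smooth : ∀ a, ContDiff ℝ ∞ (V a)
  pos : ∀ a x, 0 < deriv (V a) x
  left : ∀ a, V a p = p
  right : ∀ a, V a q = q
  add : ∀ a b, ∀ x ∈ Icc p q, V (a + b) x = V a (V b x)

namespace Act
variable {Γ : Type*} [AddCommGroup Γ] {p q : ℝ} {V : Γ → ℝ → ℝ}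

lemma mono (h : Act p q V) (a : Γ) : StrictMono (V a) := strictMono_of_deriv_pos (h.pos a)

lemma diff (h : Act p q V) (a : Γ) : Differentiable ℝ (V a) := sm_diff (h.smooth a)

lemma maps (h : Act p q V) (a : Γ) : MapsTo (V a) (Icc p q) (Icc p q) := fun x hx =>
  ⟨by rw [← h.left a]; exact (h.mono a).monotone hx.1,
   by rw [← h.right a]; exact (h.mono a).monotone hx.2⟩

lemma pmem (h : Act p q V) : p ∈ Icc p q := left_mem_Icc.2 h.hpq.le

lemma zero (h : Act p q V) {x : ℝ} (hx : x ∈ Icc p q) : V 0 x = x := by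
  have := h.add 0 0 x hx
  rw [add_zero] at this
  exact ((h.mono 0).injective this).symm

lemma neg_cancel (h : Act p q V) (a : Γ) {x : ℝ} (hx : x ∈ Icc p q) : V (-a) (V a x) = x := by
  rw [← h.add _ _ x hx, neg_add_cancel, h.zero hx]

lemma neg_cancel' (h : Act p q V) (a : Γ) {x : ℝ} (hx : x ∈ Icc p q) : V a (V (-a) x) = x := by
  rw [← h.add _ _ x hx, add_neg_cancel, h.zero hx]

lemma comm (h : Act p q V) (a b : Γ) {x : ℝ} (hx : x ∈ Icc p q) : V a (V b x) = V b (V a x) := by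
  rw [← h.add _ _ x hx, ← h.add _ _ x hx, add_comm]

lemma deriv_add (h : Act p q V) (a b : Γ) {x : ℝ} (hx : x ∈ Icc p q) :
    deriv (V (a + b)) x = deriv (V a) (V b x) * deriv (V b) x := by
  have := eqOn_deriv h.hpq (h.smooth (a + b)) ((h.smooth a).comp (h.smooth b))
    (fun x hx => h.add a b x hx) hx
  rw [this]
  exact ((h.diff a _).hasDerivAt.comp x (h.diff b x).hasDerivAt).deriv

lemma deriv_zero (h : Act p q V) {x : ℝ} (hx : x ∈ Icc p q) : deriv (V 0) x = 1 := by
  have := eqOn_deriv h.hpq (h.smooth 0) contDiff_id (fun x hx => h.zero hx) hx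
  rw [this]; simp

/-- logarithm of the derivative -/
lemma log_add (h : Act p q V) (a b : Γ) {x : ℝ} (hx : x ∈ Icc p q) :
    Real.log (deriv (V (a + b)) x) = Real.log (deriv (V a) (V b x)) + Real.log (deriv (V b) x) := by
  rw [h.deriv_add a b hx, Real.log_mul (h.pos _ _).ne' (h.pos _ _).ne']

lemma log_smooth (h : Act p q V) (a : Γ) : ContDiff ℝ ∞ (fun x => Real.log (deriv (V a) x)) :=
  (sm_deriv (h.smooth a)).log (fun x => (h.pos a x).ne')

lemma log_nsmul (h : Act p q V) (a : Γ) (n : ℕ) {x : ℝ} (hx : x ∈ Icc p q) :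
    Real.log (deriv (V (n • a)) x) =
      ∑ i ∈ Finset.range n, Real.log (deriv (V a) (V (i • a) x)) := by
  induction n with
  | zero => simp [h.deriv_zero hx]
  | succ n ih =>
    rw [Finset.sum_range_succ, ← ih, succ_nsmul', h.log_add _ _ hx, add_comm]

lemma hom {Δ : Type*} [AddCommGroup Δ] (h : Act p q V) (φ : Δ →+ Γ) :
    Act p q (fun a => V (φ a)) where
  hpq := h.hpq
  smooth a := h.smooth _
  pos a := h.pos _
  left a := h.left _
  right a := h.right _
  add a b x hx := by rw [map_add]; exact h.add _ _ x hx

end Act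

/-- a continuous function on a compact interval is bounded -/
lemma bdd_Icc (p q : ℝ) {u : ℝ → ℝ} (hu : Continuous u) : ∃ C : ℝ, 0 ≤ C ∧ ∀ x ∈ Icc p q, |u x| ≤ C := by
  obtain ⟨C, hC⟩ := (isCompact_Icc (a := p) (b := q)).exists_bound_of_continuousOn hu.continuousOn
  exact ⟨max C 0, le_max_right _ _, fun x hx => (hC x hx).trans (le_max_left _ _)⟩

lemma exists_Bd (p q : ℝ) {u : ℝ → ℝ} (hu : ContDiff ℝ ∞ u) (R : ℕ) :
    ∃ C : ℝ, 0 ≤ C ∧ ∀ L : ℝ, 1 ≤ L → Bd (Icc p q) R L C u := by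
  have : ∀ j, ∃ C : ℝ, 0 ≤ C ∧ ∀ x ∈ Icc p q, |iteratedDeriv j u x| ≤ C :=
    fun j => bdd_Icc p q (sm_iter hu j).continuous
  choose C hC0 hC using this
  refine ⟨∑ j ∈ Finset.range (R + 1), C j, Finset.sum_nonneg fun j _ => hC0 j, ?_⟩
  intro L hL j hj x hx
  have h1 : C j ≤ ∑ j ∈ Finset.range (R + 1), C j :=
    Finset.single_le_sum (f := C) (fun d _ => hC0 d) (Finset.mem_range.2 (by omega))
  have h2 : (1 : ℝ) ≤ L ^ j := one_le_pow₀ hL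
  have h3 := hC j x hx
  have h4 := hC0 j
  nlinarith

lemma lip_Icc (p q : ℝ) {u : ℝ → ℝ} (hu : ContDiff ℝ ∞ u) :
    ∃ M : ℝ, 0 ≤ M ∧ ∀ x ∈ Icc p q, ∀ y ∈ Icc p q, |u x - u y| ≤ M * |x - y| := by
  obtain ⟨M, hM, h⟩ := bdd_Icc p q (sm_deriv hu).continuous
  refine ⟨M, hM, fun x hx y hy => ?_⟩
  exact (convex_Icc p q).norm_image_sub_le_of_norm_deriv_le (fun z _ => sm_diff hu z) h hy hx

/-- the time of an element -/
def tm (α : ℝ) (a : ℤ × ℤ) : ℝ := a.1 + a.2 * α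

lemma tm_add (α : ℝ) (a b : ℤ × ℤ) : tm α (a + b) = tm α a + tm α b := by
  simp [tm]; ring
lemma tm_neg (α : ℝ) (a : ℤ × ℤ) : tm α (-a) = - tm α a := by
  simp [tm]; ring
lemma tm_nsmul (α : ℝ) (n : ℕ) (a : ℤ × ℤ) : tm α (n • a) = n * tm α a := by
  simp [tm]; ring
lemma tm_zsmul (α : ℝ) (n : ℤ) (a : ℤ × ℤ) : tm α (n • a) = n * tm α a := by
  simp [tm]; ring

/-- the sandwich property -/
def PropS (p q : ℝ) (V : ℤ × ℤ → ℝ → ℝ) (α : ℝ) : Prop :=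
  ∀ (a : ℤ × ℤ) (T : ℕ), |tm α a| ≤ T → ∀ x ∈ Icc p q,
    V a x ∈ uIcc (V (-(T : ℤ), 0) x) (V ((T : ℤ), 0) x)

section K
variable {p q α : ℝ} {V : ℤ × ℤ → ℝ → ℝ}

lemma mem_uIcc_mul {a b c : ℝ} (h : c ∈ uIcc a b) : (c - a) * (c - b) ≤ 0 := by
  rcases mem_uIcc.1 h with h | h <;> nlinarith

lemma mul_mem_uIcc {a b c : ℝ} (h : (c - a) * (c - b) ≤ 0) : c ∈ uIcc a b := by
  rw [mem_uIcc]
  by_contra! hc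
  rcases lt_trichotomy c a with h1 | h1 | h1
  · rcases lt_or_ge c b with h2 | h2
    · nlinarith
    · exact absurd (hc.2 h2) (by linarith)
  · subst h1
    rcases le_total c b with h2 | h2
    · exact absurd (hc.1 le_rfl) (by linarith)
    · exact absurd (hc.2 h2) (by linarith)
  · have := hc.1 h1.le
    nlinarith

lemma logderiv_fixed (hV : Act p q V) (hS : PropS p q V α) (T : ℕ) :
    ∃ C : ℝ, 0 ≤ C ∧ ∀ a, |tm α a| ≤ T → ∀ e ∈ Icc p q, V (1, 0) e = e →
      |Real.log (deriv (V a) e)| ≤ C := by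
  obtain ⟨C1, hC1, h1⟩ := bdd_Icc p q (hV.log_smooth ((T : ℤ), 0)).continuous
  obtain ⟨C2, hC2, h2⟩ := bdd_Icc p q (hV.log_smooth (-(T : ℤ), 0)).continuous
  refine ⟨C1 + C2, by positivity, fun a ha e he hfe => ?_⟩
  have hT : V ((T : ℤ), 0) e = e := by
    have : ∀ n : ℕ, V ((n : ℤ), 0) e = e := by
      intro n
      induction n with
      | zero => exact hV.zero he
      | succ n ih =>
        have := hV.add ((n : ℤ), 0) (1, 0) e he
        rw [hfe, ih] at this
        simpa using this
    exact this T
  have hT' : V (-(T : ℤ), 0) e = e := by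
    have := hV.neg_cancel ((T : ℤ), 0) he
    rw [hT] at this
    simpa using this
  have hVe : V a e = e := by
    have := hS a T ha e he
    rw [hT, hT'] at this
    simpa using this
  -- slopes
  have key : (deriv (V a) e - deriv (V (-(T : ℤ), 0)) e) * (deriv (V a) e - deriv (V ((T : ℤ), 0)) e) ≤ 0 := by
    have hne : (nhdsWithin e (Icc p q \ {e})).NeBot := by
      have := (uniqueDiffOn_Icc hV.hpq) e he
      exact accPt_principal_iff_nhdsWithin.1 this.accPt
    have hs : ∀ b, V b e = e → Filter.Tendsto (fun x => (V b x - e) / (x - e)) (nhdsWithin e (Icc p q \ {e}))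
        (nhds (deriv (V b) e)) := by
      intro b hb
      have := (hV.diff b e).hasDerivAt.tendsto_slope
      have h3 := this.mono_left (nhdsWithin_mono e (show Icc p q \ {e} ⊆ {e}ᶜ from fun x hx => hx.2))
      refine h3.congr (fun x => ?_)
      rw [slope_def_field, hb]
    refine le_of_tendsto (((hs a hVe).sub (hs _ hT')).mul ((hs a hVe).sub (hs _ hT))) ?_
    filter_upwards [self_mem_nhdsWithin] with x hx
    have h4 := mem_uIcc_mul (hS a T ha x hx.1)
    have h5 : x - e ≠ 0 := sub_ne_zero.2 hx.2
    have : ((V a x - e) / (x - e) - (V (-(T : ℤ), 0) x - e) / (x - e)) *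
      ((V a x - e) / (x - e) - (V ((T : ℤ), 0) x - e) / (x - e)) =
      ((V a x - V (-(T : ℤ), 0) x) * (V a x - V ((T : ℤ), 0) x)) / (x - e) ^ 2 := by
      field_simp
      ring
    rw [this]
    exact div_nonpos_of_nonpos_of_nonneg h4 (by positivity)
  have key2 := mul_mem_uIcc key
  have l1 := h1 e he
  have l2 := h2 e he
  have p0 := hV.pos a e
  have p1 := hV.pos ((T : ℤ), 0) e
  have p2 := hV.pos (-(T : ℤ), 0) e
  rw [abs_le] at l1 l2 ⊢
  rcases mem_uIcc.1 key2 with ⟨k1, k2⟩ | ⟨k1, k2⟩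
  · have := Real.log_le_log p2 k1
    have := Real.log_le_log p0 k2
    constructor <;> linarith
  · have := Real.log_le_log p1 k1
    have := Real.log_le_log p0 k2
    constructor <;> linarith

lemma sum_tele (y : ℤ → ℝ) (B : ℝ) (hB : ∀ i j, |y i - y j| ≤ B) (n T : ℕ) :
    |∑ i ∈ Finset.range n, (y (i + T) - y (i - T))| ≤ 2 * T * B := by
  induction T with
  | zero => simp
  | succ T ih =>
    have e1 : ∑ i ∈ Finset.range n, (y (i + (T + 1 : ℕ)) - y (i - (T + 1 : ℕ))) =
      ∑ i ∈ Finset.range n, (y (i + T) - y (i - T)) +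
      (∑ i ∈ Finset.range n, (y ((i + 1 : ℕ) + T) - y ((i : ℕ) + T)) +
      ∑ i ∈ Finset.range n, (y ((i + 1 : ℕ) - (T + 1 : ℕ)) - y ((i : ℕ) - (T + 1 : ℕ)))) := by
      rw [← Finset.sum_add_distrib, ← Finset.sum_add_distrib]
      refine Finset.sum_congr rfl fun i _ => ?_
      have a1 : ((i : ℤ) + (T + 1 : ℕ)) = ((i + 1 : ℕ) : ℤ) + T := by push_cast; ring
      have a2 : (((i + 1 : ℕ) : ℤ) - (T + 1 : ℕ)) = (i : ℤ) - T := by push_cast; ring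
      rw [a1, a2]; ring
    rw [e1, Finset.sum_range_sub (fun i : ℕ => y ((i : ℤ) + T)) n,
      Finset.sum_range_sub (fun i : ℕ => y ((i : ℤ) - (T + 1 : ℕ))) n]
    refine (abs_add_le _ _).trans ?_
    have := abs_add_le (y ((n : ℕ) + T) - y ((0 : ℕ) + T)) (y ((n : ℕ) - (T + 1 : ℕ)) - y ((0 : ℕ) - (T + 1 : ℕ)))
    have h1 := hB ((n : ℕ) + T) ((0 : ℕ) + T)
    have h2 := hB ((n : ℕ) - (T + 1 : ℕ)) ((0 : ℕ) - (T + 1 : ℕ))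
    push_cast at *
    linarith

/-- uniform control of derivatives for bounded time -/
lemma propK (hV : Act p q V) (hS : PropS p q V α) (T : ℕ) :
    ∃ C : ℝ, 0 ≤ C ∧ ∀ a, |tm α a| ≤ T → ∀ x ∈ Icc p q, |Real.log (deriv (V a) x)| ≤ C := by
  obtain ⟨C, hC, hfix⟩ := logderiv_fixed hV hS T
  obtain ⟨M, hM, hlip⟩ := lip_Icc p q (hV.log_smooth (1, 0))
  refine ⟨C + M * (2 * T * (q - p)), by have := hV.hpq.le; have : 0 ≤ q - p := by linarith
                                        positivity, fun a ha x hx => ?_⟩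
  set y : ℤ → ℝ := fun i => V (i, 0) x with hy
  have hyJ : ∀ i, y i ∈ Icc p q := fun i => hV.maps _ hx
  have hyB : ∀ i j, |y i - y j| ≤ q - p := fun i j => by
    have := hyJ i; have := hyJ j
    rw [abs_le]; constructor <;> linarith [(hyJ i).1, (hyJ i).2, (hyJ j).1, (hyJ j).2]
  have hyadd : ∀ i j : ℤ, V (i, 0) (y j) = y (i + j) := fun i j => by
    rw [hy]
    simp only
    rw [← hV.add _ _ x hx]; simp
  have hns : ∀ n : ℕ, n • ((1 : ℤ), (0 : ℤ)) = ((n : ℤ), 0) := fun n => by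
    ext <;> simp
  -- finite bound
  have hfin : ∀ n : ℕ, |Real.log (deriv (V a) x)| ≤ |Real.log (deriv (V a) (y n))| + M * (2 * T * (q - p)) := by
    intro n
    have e1 := hV.log_add a ((n : ℤ), 0) hx
    have e2 := hV.log_add ((n : ℤ), 0) a hx
    rw [add_comm, e2] at e1
    have e3 := hV.log_nsmul (1, 0) n hx
    have e4 := hV.log_nsmul (1, 0) n (hV.maps a hx)
    simp only [hns] at e3 e4
    have e5 : |Real.log (deriv (V ((n : ℤ), 0)) x) - Real.log (deriv (V ((n : ℤ), 0)) (V a x))| ≤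
        M * (2 * T * (q - p)) := by
      rw [e3, e4, ← Finset.sum_sub_distrib]
      refine (Finset.abs_sum_le_sum_abs _ _).trans ?_
      have e6 : ∀ i ∈ Finset.range n, |Real.log (deriv (V (1, 0)) (V ((i : ℤ), 0) x)) -
          Real.log (deriv (V (1, 0)) (V ((i : ℤ), 0) (V a x)))| ≤ M * |y (i + T) - y (i - T)| := by
        intro i _
        refine (hlip _ (hV.maps _ hx) _ (hV.maps _ (hV.maps _ hx))).trans ?_
        refine mul_le_mul_of_nonneg_left ?_ hM
        rw [hV.comm _ a hx]
        have s1 := hS a T ha (y i) (hyJ i)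
        have s2 := hS 0 T (by simp [tm]) (y i) (hyJ i)
        rw [hV.zero (hyJ i)] at s2
        rw [hyadd, hyadd] at s1 s2
        have := abs_sub_le_of_uIcc_subset_uIcc (uIcc_subset_uIcc s1 s2)
        rw [show -(T : ℤ) + i = i - T by ring, show (T : ℤ) + i = i + T by ring] at this
        exact this
      refine (Finset.sum_le_sum e6).trans ?_
      rw [← Finset.mul_sum]
      refine mul_le_mul_of_nonneg_left ?_ hM
      refine le_trans (le_of_eq ?_) (sum_tele y (q - p) hyB n T)
      -- constant sign
      have hmono : ∀ i j : ℤ, i ≤ j → (x ≤ y 1 → y i ≤ y j) ∧ (y 1 ≤ x → y j ≤ y i) := by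
        intro i j hij
        obtain ⟨k, rfl⟩ := Int.le.dest hij
        have step : ∀ i : ℤ, (x ≤ y 1 → y i ≤ y (i + 1)) ∧ (y 1 ≤ x → y (i + 1) ≤ y i) := by
          intro i
          have := hyadd i 1
          rw [← this]
          exact ⟨fun h => (hV.mono _).monotone h, fun h => (hV.mono _).monotone h⟩
        induction k with
        | zero => simp
        | succ k ih =>
          have s := step (i + k)
          have ih := ih (by omega)
          push_cast
          rw [← add_assoc]
          exact ⟨fun h => (ih.1 h).trans (s.1 h), fun h => (s.2 h).trans (ih.2 h)⟩
      rcases le_total x (y 1) with h | h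
      · have hp : ∀ i : ℕ, 0 ≤ y (i + T) - y (i - T) := fun i =>
          sub_nonneg.2 ((hmono (i - T) (i + T) (by omega)).1 h)
        rw [abs_of_nonneg (Finset.sum_nonneg fun i _ => hp i)]
        exact Finset.sum_congr rfl fun i _ => abs_of_nonneg (hp i)
      · have hp : ∀ i : ℕ, y (i + T) - y (i - T) ≤ 0 := fun i =>
          sub_nonpos.2 ((hmono (i - T) (i + T) (by omega)).2 h)
        rw [abs_of_nonpos (Finset.sum_nonpos fun i _ => hp i), ← Finset.sum_neg_distrib]
        exact Finset.sum_congr rfl fun i _ => abs_of_nonpos (hp i)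
    have e7 : Real.log (deriv (V a) x) = Real.log (deriv (V a) (y n)) +
      (Real.log (deriv (V ((n : ℤ), 0)) x) - Real.log (deriv (V ((n : ℤ), 0)) (V a x))) := by
      simp only [hy]
      linarith
    rw [e7]
    exact (abs_add_le _ _).trans (by linarith)
  -- limit point
  obtain ⟨e, he, hye, hfe⟩ : ∃ e ∈ Icc p q, Filter.Tendsto (fun n : ℕ => y n) Filter.atTop (nhds e) ∧ V (1, 0) e = e := by
    have hlim : ∃ e, Filter.Tendsto (fun n : ℕ => y n) Filter.atTop (nhds e) := by
      rcases le_total x (y 1) with h | h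
      · refine ⟨_, tendsto_atTop_ciSup (monotone_nat_of_le_succ fun n => ?_) ⟨q, ?_⟩⟩
        · have := hyadd n 1
          push_cast
          rw [← this]
          exact (hV.mono _).monotone h
        · rintro _ ⟨n, rfl⟩; exact (hyJ n).2
      · refine ⟨_, tendsto_atTop_ciInf (antitone_nat_of_succ_le fun n => ?_) ⟨p, ?_⟩⟩
        · have := hyadd n 1
          push_cast
          rw [← this]
          exact (hV.mono _).monotone h
        · rintro _ ⟨n, rfl⟩; exact (hyJ n).1
    obtain ⟨e, hye⟩ := hlim
    refine ⟨e, isClosed_Icc.mem_of_tendsto hye (Filter.Eventually.of_forall fun n => hyJ n), hye, ?_⟩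
    have h1 : Filter.Tendsto (fun n : ℕ => V (1, 0) (y n)) Filter.atTop (nhds (V (1, 0) e)) :=
      ((hV.diff (1, 0)).continuous.tendsto e).comp hye
    have h2 : Filter.Tendsto (fun n : ℕ => y (n + 1 : ℕ)) Filter.atTop (nhds e) :=
      hye.comp (Filter.tendsto_add_atTop_nat 1)
    refine tendsto_nhds_unique h1 (h2.congr fun n => ?_)
    rw [hyadd]; push_cast; rw [add_comm]
  have hl : Filter.Tendsto (fun n : ℕ => |Real.log (deriv (V a) (y n))| + M * (2 * T * (q - p))) Filter.atTop
      (nhds (|Real.log (deriv (V a) e)| + M * (2 * T * (q - p)))) :=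
    ((((hV.log_smooth a).continuous.tendsto e).comp hye).abs).add_const _
  have := ge_of_tendsto hl (Filter.Eventually.of_forall hfin)
  linarith [hfix a ha e he hfe]

/-- C0 displacement rate -/
lemma rate0 (hV : Act p q V) (hS : PropS p q V α) :
    ∃ C : ℝ, 0 ≤ C ∧ ∀ a, |tm α a| ≤ 1 → ∀ x ∈ Icc p q, |V a x - x| ≤ C * |tm α a| := by
  obtain ⟨C, hC, hK⟩ := propK hV hS 1
  have hpq := hV.hpq
  refine ⟨2 * Real.exp C * (q - p), by have : 0 ≤ q - p := by linarith
                                       positivity, fun a ha x hx => ?_⟩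
  by_cases h0 : tm α a = 0
  · have := hS a 0 (by simp [h0]) x hx
    simp only [Nat.cast_zero, neg_zero] at this
    rw [show ((0 : ℤ), (0 : ℤ)) = 0 from rfl, hV.zero hx] at this
    simp at this
    simp [this, h0]
  set θ := |tm α a| with hθ
  have hθ0 : 0 < θ := abs_pos.2 h0
  set N := ⌊1 / θ⌋₊ with hN
  have hN1 : (N : ℝ) ≤ 1 / θ := Nat.floor_le (by positivity)
  have hN2 : 1 / θ < N + 1 := Nat.lt_floor_add_one _
  have hN0 : 1 ≤ N := Nat.le_floor (by rw [Nat.cast_one, le_div_iff₀ hθ0]; linarith)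
  have hN0' : (1 : ℝ) ≤ N := by exact_mod_cast hN0
  have hNθ : N * θ ≤ 1 := by rwa [le_div_iff₀ hθ0] at hN1
  have hstep : ∀ j : ℕ, j ≤ N → ∀ y ∈ Icc p q, ∀ z ∈ Icc p q, y ≤ z →
      Real.exp (-C) * (z - y) ≤ V (j • a) z - V (j • a) y := by
    intro j hj y hy z hz hyz
    have hb : ∀ w ∈ Icc p q, Real.exp (-C) ≤ deriv (V (j • a)) w := by
      intro w hw
      have : |tm α (j • a)| ≤ (1 : ℕ) := by
        rw [tm_nsmul, abs_mul, Nat.abs_cast]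
        have : (j : ℝ) ≤ N := by exact_mod_cast hj
        push_cast
        nlinarith
      have := (abs_le.1 (hK _ this w hw)).1
      rwa [← Real.le_log_iff_exp_le (hV.pos _ _)]
    exact (convex_Icc p q).mul_sub_le_image_sub_of_le_deriv (hV.diff _).continuous.continuousOn
      (hV.diff _).differentiableOn (fun w hw => hb w (interior_subset hw)) y hy z hz hyz
  have hVa := hV.maps a hx
  have hsum : ∀ j : ℕ, j ≤ N → (x ≤ V a x → j * (Real.exp (-C) * (V a x - x)) ≤ V (j • a) x - x) ∧
      (V a x ≤ x → j * (Real.exp (-C) * (x - V a x)) ≤ x - V (j • a) x) := by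
    intro j
    induction j with
    | zero => intro _; simp [hV.zero hx]
    | succ j ih =>
      intro hj
      have ih := ih (by omega)
      have e : V ((j + 1) • a) x = V (j • a) (V a x) := by rw [succ_nsmul, hV.add _ _ x hx]
      rw [e]
      push_cast
      refine ⟨fun h => ?_, fun h => ?_⟩
      · have := hstep j (by omega) x hx _ hVa h
        have := ih.1 h
        linarith
      · have := hstep j (by omega) _ hVa x hx h
        have := ih.2 h
        linarith
  have hs := hsum N le_rfl
  have hVN := hV.maps (N • a) hx
  have hmain : N * (Real.exp (-C) * |V a x - x|) ≤ q - p := by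
    rcases le_total x (V a x) with h | h
    · rw [abs_of_nonneg (by linarith)]
      linarith [hs.1 h, hVN.2, hx.1]
    · rw [abs_of_nonpos (by linarith), neg_sub]
      linarith [hs.2 h, hVN.1, hx.2]
  have h1 : 1 ≤ 2 * N * θ := by
    rw [div_lt_iff₀ hθ0] at hN2
    nlinarith
  have hE : Real.exp C * Real.exp (-C) = 1 := by rw [← Real.exp_add]; simp
  have hEp := Real.exp_pos C
  calc |V a x - x| ≤ (2 * N * θ) * |V a x - x| := le_mul_of_one_le_left (abs_nonneg _) h1
    _ = 2 * Real.exp C * (N * (Real.exp (-C) * |V a x - x|)) * θ := by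
      linear_combination (-2 * N * θ * |V a x - x|) * hE
    _ ≤ 2 * Real.exp C * (q - p) * θ := by gcongr

end K

end

section
open Set
open scoped ContDiff

/-- inverse square root of the derivative -/
noncomputable def zf (V : ℤ × ℤ → ℝ → ℝ) (a : ℤ × ℤ) (x : ℝ) : ℝ :=
  Real.exp (-(1 / 2) * Real.log (deriv (V a) x))

/-- Schwarzian type cocycle -/
noncomputable def Qf (V : ℤ × ℤ → ℝ → ℝ) (a : ℤ × ℤ) (x : ℝ) : ℝ :=
  deriv (deriv (zf V a)) x * (zf V a x)⁻¹

section
variable {p q α : ℝ} {V : ℤ × ℤ → ℝ → ℝ}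

lemma zf_pos (a : ℤ × ℤ) (x : ℝ) : 0 < zf V a x := Real.exp_pos _

lemma zf_smooth (hV : Act p q V) (a : ℤ × ℤ) : ContDiff ℝ ∞ (zf V a) :=
  (contDiff_const.mul (hV.log_smooth a)).exp

lemma zfi_smooth (hV : Act p q V) (a : ℤ × ℤ) : ContDiff ℝ ∞ (fun x => (zf V a x)⁻¹) :=
  (zf_smooth hV a).inv (fun x => (zf_pos a x).ne')

lemma Qf_smooth (hV : Act p q V) (a : ℤ × ℤ) : ContDiff ℝ ∞ (Qf V a) :=
  (sm_deriv (sm_deriv (zf_smooth hV a))).mul (zfi_smooth hV a)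

lemma deriv_eq_zf (hV : Act p q V) (a : ℤ × ℤ) (x : ℝ) :
    deriv (V a) x = (zf V a x)⁻¹ * (zf V a x)⁻¹ := by
  rw [zf, ← Real.exp_neg, ← Real.exp_add]
  conv_lhs => rw [← Real.exp_log (hV.pos a x)]
  congr 1; ring

lemma zf_add (hV : Act p q V) (a b : ℤ × ℤ) {x : ℝ} (hx : x ∈ Icc p q) :
    zf V (a + b) x = zf V a (V b x) * zf V b x := by
  rw [zf, zf, zf, ← Real.exp_add, hV.log_add a b hx]
  congr 1; ring

lemma Qf_add (hV : Act p q V) (s b : ℤ × ℤ) {x : ℝ} (hx : x ∈ Icc p q) :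
    Qf V (s + b) x = Qf V s (V b x) *
      (((zf V b x)⁻¹ * (zf V b x)⁻¹) * ((zf V b x)⁻¹ * (zf V b x)⁻¹)) + Qf V b x := by
  have hA := zf_smooth hV s
  have hz := zf_smooth hV b
  have hw := hV.smooth b
  have hg : ContDiff ℝ ∞ (fun x => zf V s (V b x) * zf V b x) := (hA.comp hw).mul hz
  have h1 := eqOn_deriv hV.hpq (zf_smooth hV (s + b)) hg (fun x hx => zf_add hV s b hx)
  have h2 := eqOn_deriv hV.hpq (sm_deriv (zf_smooth hV (s + b))) (sm_deriv hg) h1 hx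
  have hwd : ∀ x, HasDerivAt (V b) ((zf V b x)⁻¹ * (zf V b x)⁻¹) x := fun x => by
    rw [← deriv_eq_zf hV]; exact (hV.diff b x).hasDerivAt
  have d1 : deriv (fun x => zf V s (V b x) * zf V b x) =
      fun x => deriv (zf V s) (V b x) * (zf V b x)⁻¹ + zf V s (V b x) * deriv (zf V b) x := by
    funext x
    have e := (((sm_diff hA _).hasDerivAt.comp x (hwd x)).mul (sm_diff hz x).hasDerivAt).deriv
    have hne := (zf_pos (V := V) b x).ne'
    refine Eq.trans e ?_
    simp only [Function.comp]
    field_simp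
  have d2 : deriv (fun x => deriv (zf V s) (V b x) * (zf V b x)⁻¹ + zf V s (V b x) * deriv (zf V b) x) x =
      deriv (deriv (zf V s)) (V b x) * ((zf V b x)⁻¹ * (zf V b x)⁻¹ * (zf V b x)⁻¹) +
        zf V s (V b x) * deriv (deriv (zf V b)) x := by
    have hne := (zf_pos (V := V) b x).ne'
    have e := ((((sm_diff (sm_deriv hA) _).hasDerivAt.comp x (hwd x)).mul
      ((sm_diff hz x).hasDerivAt.inv hne)).add
      (((sm_diff hA _).hasDerivAt.comp x (hwd x)).mul (sm_diff (sm_deriv hz) x).hasDerivAt)).deriv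
    refine Eq.trans e ?_
    simp only [Function.comp, Pi.inv_apply]
    field_simp
    ring
  rw [Qf, h2, d1, d2, zf_add hV s b hx, Qf, Qf]
  have hne := (zf_pos (V := V) b x).ne'
  have hne' := (zf_pos (V := V) s (V b x)).ne'
  field_simp

lemma zf_bounds (hV : Act p q V) (hS : PropS p q V α) : ∃ c C : ℝ, 0 < c ∧ 0 ≤ C ∧
    ∀ a, |tm α a| ≤ 1 → ∀ x ∈ Icc p q, c ≤ |zf V a x| ∧ |zf V a x| ≤ C := by
  obtain ⟨C, hC, hK⟩ := propK hV hS 1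
  refine ⟨Real.exp (-C), Real.exp C, Real.exp_pos _, (Real.exp_pos _).le, fun a ha x hx => ?_⟩
  have := abs_le.1 (hK a (by simpa using ha) x hx)
  rw [abs_of_pos (zf_pos a x), zf]
  constructor <;> apply Real.exp_le_exp.2 <;> linarith

lemma deriv_Bd_of_zf (hV : Act p q V) (hS : PropS p q V α) (R : ℕ) {C : ℝ} (hC : 0 ≤ C) :
    ∃ D : ℝ, 0 ≤ D ∧ ∀ (L : ℝ) (b : ℤ × ℤ), 1 ≤ L → |tm α b| ≤ 1 → Bd (Icc p q) R L C (zf V b) →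
      Bd (Icc p q) R L D (fun x => (zf V b x)⁻¹ * (zf V b x)⁻¹) := by
  obtain ⟨c, C', hc, hC', hz⟩ := zf_bounds hV hS
  obtain ⟨E, hE, hinv⟩ := Bd.inv_aux (J := Icc p q) R hC hc
  refine ⟨2 ^ R * E * E, by positivity, fun L b hL hb hB => ?_⟩
  have h1 := hinv (zf V b) L (zf_smooth hV b) hL (fun x => (zf_pos b x).ne')
    (fun x hx => (hz b hb x hx).1) hB
  exact h1.mul (zfi_smooth hV b) (zfi_smooth hV b) (by linarith) h1

lemma Q_summand (hV : Act p q V) (hS : PropS p q V α) (s : ℤ × ℤ) (R : ℕ) {C : ℝ} (hC : 0 ≤ C) :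
    ∃ D : ℝ, 0 ≤ D ∧ ∀ (L : ℝ) (b : ℤ × ℤ), 1 ≤ L → |tm α b| ≤ 1 → Bd (Icc p q) R L C (zf V b) →
      Bd (Icc p q) R L D (fun x => Qf V s (V b x) *
      (((zf V b x)⁻¹ * (zf V b x)⁻¹) * ((zf V b x)⁻¹ * (zf V b x)⁻¹))) := by
  obtain ⟨E, hE, hd⟩ := deriv_Bd_of_zf hV hS R hC
  obtain ⟨A, hA, hQ⟩ := exists_Bd p q (Qf_smooth hV s) R
  obtain ⟨F, hF, hcomp⟩ := Bd.comp_aux (J := Icc p q) R hE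
  refine ⟨2 ^ R * (F * A) * (2 ^ R * E * E), by positivity, fun L b hL hb hB => ?_⟩
  have hL0 : 0 ≤ L := by linarith
  have h1 := hd L b hL hb hB
  have e : deriv (V b) = fun x => (zf V b x)⁻¹ * (zf V b x)⁻¹ := by
    funext x; exact deriv_eq_zf hV b x
  have h2 := hcomp (Qf V s) (V b) L A (Qf_smooth hV s) (hV.smooth b) hL (hV.maps b) (hQ L hL)
    (by rw [e]; exact h1.monoR (Nat.sub_le _ _))
  have hi := zfi_smooth hV b
  exact h2.mul ((Qf_smooth hV s).comp (hV.smooth b)) ((hi.mul hi).mul (hi.mul hi)) hL0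
    (h1.mul (hi.mul hi) (hi.mul hi) hL0 h1)

/-- normalized elements -/
noncomputable def kk (α : ℝ) (l : ℕ) : ℤ × ℤ := (-⌊(l : ℝ) * α⌋, l)

lemma tm_kk (α : ℝ) (l : ℕ) : tm α (kk α l) = Int.fract ((l : ℝ) * α) := by
  simp only [tm, kk, Int.fract]; push_cast; ring

lemma tm_kk_le (α : ℝ) (l : ℕ) : |tm α (kk α l)| ≤ 1 := by
  rw [tm_kk, abs_of_nonneg (Int.fract_nonneg _)]
  exact (Int.fract_lt_one _).le

lemma kk_succ (α : ℝ) (l : ℕ) : kk α (l + 1) = (-⌊α⌋, 1) + kk α l ∨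
    kk α (l + 1) = (-⌊α⌋ - 1, 1) + kk α l := by
  have h : ⌊((l + 1 : ℕ) : ℝ) * α⌋ = ⌊(l : ℝ) * α⌋ + ⌊α⌋ ∨ ⌊((l + 1 : ℕ) : ℝ) * α⌋ = ⌊(l : ℝ) * α⌋ + ⌊α⌋ + 1 := by
    have h1 := Int.le_floor_add ((l : ℝ) * α) α
    have h2 := Int.le_floor_add_floor ((l : ℝ) * α) α
    have h3 : ((l + 1 : ℕ) : ℝ) * α = (l : ℝ) * α + α := by push_cast; ring
    rw [h3]
    omega
  rcases h with h | h
  · left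
    ext
    · simp only [kk, h, Prod.fst_add]; ring
    · simp [kk]; ring
  · right
    ext
    · simp only [kk, h, Prod.fst_add]; ring
    · simp [kk]; ring

lemma est1_z (hV : Act p q V) (hS : PropS p q V α) (R : ℕ) :
    ∃ C : ℝ, 0 ≤ C ∧ ∀ (L : ℝ) (l : ℕ), 1 ≤ L → (l : ℝ) ≤ L ^ 2 →
      Bd (Icc p q) R L C (zf V (kk α l)) := by
  obtain ⟨c, C0, hc, hC0, hz⟩ := zf_bounds hV hS
  induction R with
  | zero =>
    refine ⟨C0, hC0, fun L l hL hl j hj x hx => ?_⟩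
    obtain rfl : j = 0 := by omega
    simpa using (hz _ (tm_kk_le α l) x hx).2
  | succ R ih =>
    obtain ⟨C, hC, ih⟩ := ih
    obtain ⟨D1, hD1, h1⟩ := Q_summand hV hS (-⌊α⌋, 1) R hC
    obtain ⟨D2, hD2, h2⟩ := Q_summand hV hS (-⌊α⌋ - 1, 1) R hC
    obtain ⟨D0, hD0, h0⟩ := exists_Bd p q (Qf_smooth hV (kk α 0)) R
    have hQ : ∀ (L : ℝ) (l : ℕ), 1 ≤ L → (l : ℝ) ≤ L ^ 2 →
        Bd (Icc p q) R L (D0 + l * (D1 + D2)) (Qf V (kk α l)) := by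
      intro L l hL
      have hL0 : 0 ≤ L := by linarith
      induction l with
      | zero => intro _; simpa using h0 L hL
      | succ l ih2 =>
        intro hl
        push_cast at hl
        have hl' : (l : ℝ) ≤ L ^ 2 := by linarith
        have i1 := ih2 hl'
        have i2 := ih L l hL hl'
        have hi := zfi_smooth hV (kk α l)
        have main : ∀ s : ℤ × ℤ, ∀ D, D ≤ D1 + D2 → Bd (Icc p q) R L D (fun x => Qf V s (V (kk α l) x) *
            (((zf V (kk α l) x)⁻¹ * (zf V (kk α l) x)⁻¹) * ((zf V (kk α l) x)⁻¹ * (zf V (kk α l) x)⁻¹))) →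
            Bd (Icc p q) R L (D0 + (l + 1 : ℕ) * (D1 + D2)) (Qf V (s + kk α l)) := by
          intro s D hD hb
          have hs : ContDiff ℝ ∞ (fun x => Qf V s (V (kk α l) x) *
            (((zf V (kk α l) x)⁻¹ * (zf V (kk α l) x)⁻¹) * ((zf V (kk α l) x)⁻¹ * (zf V (kk α l) x)⁻¹))) :=
            ((Qf_smooth hV s).comp (hV.smooth _)).mul ((hi.mul hi).mul (hi.mul hi))
          have := hb.add hs (Qf_smooth hV (kk α l)) i1
          refine (Bd.congr hV.hpq (hs.add (Qf_smooth hV _)) (Qf_smooth hV _)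
            (fun x hx => (Qf_add hV s (kk α l) hx).symm) this).monoC hL0 ?_
          push_cast
          linarith
        rcases kk_succ α l with e | e
        · rw [e]
          exact main _ D1 (by linarith) (h1 L _ hL (tm_kk_le α l) i2)
        · rw [e]
          exact main _ D2 (by linarith) (h2 L _ hL (tm_kk_le α l) i2)
    obtain ⟨B, hB, hlan⟩ := landau p q hV.hpq 2
    set G := 2 ^ R * (D0 + D1 + D2) * C with hG
    have hG0 : 0 ≤ G := by positivity
    refine ⟨C0 + G + B * (C0 + G), by positivity, fun L l hL hl => ?_⟩
    have hL0 : 0 ≤ L := by linarith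
    have i2 := ih L l hL hl
    have hz2 : Bd (Icc p q) R L (G * L ^ 2) (deriv (deriv (zf V (kk α l)))) := by
      have e : deriv (deriv (zf V (kk α l))) = fun x => Qf V (kk α l) x * zf V (kk α l) x := by
        funext x
        have := (zf_pos (V := V) (kk α l) x).ne'
        rw [Qf]; field_simp
      rw [e]
      refine ((hQ L l hL hl).mul (Qf_smooth hV _) (zf_smooth hV _) hL0 i2).monoC hL0 ?_
      have : D0 + l * (D1 + D2) ≤ (D0 + D1 + D2) * L ^ 2 := by
        have : (1 : ℝ) ≤ L ^ 2 := one_le_pow₀ hL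
        nlinarith
      rw [hG]
      calc 2 ^ R * (D0 + l * (D1 + D2)) * C ≤ 2 ^ R * ((D0 + D1 + D2) * L ^ 2) * C := by gcongr
        _ = _ := by ring
    have hz1 : ∀ x ∈ Icc p q, |deriv (zf V (kk α l)) x| ≤ B * (C0 + G) * L := by
      intro x hx
      have := hlan (zf V (kk α l)) C0 (G * L ^ 2) (zf_smooth hV _)
        (fun x hx => (hz _ (tm_kk_le α l) x hx).2)
        (fun x hx => by
          rw [iteratedDeriv_succ, iteratedDeriv_one]
          exact hz2.zero_le hx) (1 / L) (by positivity) (by rw [div_le_one] <;> linarith) 1 (by norm_num) x hx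
      rw [iteratedDeriv_one] at this
      refine this.trans (le_of_eq ?_)
      have : L ≠ 0 := by positivity
      simp
      field_simp
    intro j hj x hx
    have hLj : 0 ≤ L ^ j := by positivity
    rcases j with _ | _ | j
    · have := (hz _ (tm_kk_le α l) x hx).2
      simp only [iteratedDeriv_zero, pow_zero, mul_one]
      have : 0 ≤ G + B * (C0 + G) := by positivity
      linarith
    · have := hz1 x hx
      simp only [zero_add, iteratedDeriv_one, pow_one]
      have : 0 ≤ (C0 + G) * L := by positivity
      linarith
    · have := hz2 j (by omega) x hx
      rw [iteratedDeriv_succ', iteratedDeriv_succ']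
      refine this.trans ?_
      have h5 : G * L ^ 2 * L ^ j = G * L ^ (j + 1 + 1) := by ring
      rw [h5]
      refine mul_le_mul_of_nonneg_right ?_ hLj
      have : 0 ≤ B * (C0 + G) := by positivity
      linarith

/-- passing from normalized elements to bounded times -/
lemma ext_time (hV : Act p q V) (R T : ℕ) (lam : ℕ → ℝ) (hlam : ∀ l, 1 ≤ lam l) {C : ℝ} (hC : 0 ≤ C)
    (h : ∀ l : ℕ, Bd (Icc p q) R (lam l) C (deriv (V (kk α l)))) :
    ∃ D : ℝ, 0 ≤ D ∧ ∀ (m : ℤ) (l : ℕ), |tm α (m, l)| ≤ T →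
      Bd (Icc p q) R (lam l) D (deriv (V (m, l))) := by
  obtain ⟨F, hF, hcomp⟩ := Bd.comp_aux (J := Icc p q) R hC
  have := fun c : ℤ => exists_Bd p q (sm_deriv (hV.smooth (c, 0))) R
  choose A hA hAB using this
  refine ⟨∑ c ∈ Finset.Icc (-(T + 1 : ℤ)) (T + 1), 2 ^ R * (F * A c) * C,
    Finset.sum_nonneg fun c _ => by have := hA c; positivity, fun m l hml => ?_⟩
  set c := m + ⌊(l : ℝ) * α⌋ with hc
  have e : ((m, (l : ℤ)) : ℤ × ℤ) = (c, 0) + kk α l := by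
    ext
    · simp [kk, hc]
    · simp [kk]
  have hcT : c ∈ Finset.Icc (-(T + 1 : ℤ)) (T + 1) := by
    have h1 : (c : ℝ) = tm α (m, l) - Int.fract ((l : ℝ) * α) := by
      rw [hc]; simp only [tm, Int.fract]; push_cast; ring
    have h2 := Int.fract_nonneg ((l : ℝ) * α)
    have h3 := (Int.fract_lt_one ((l : ℝ) * α)).le
    have h4 := abs_le.1 hml
    rw [Finset.mem_Icc]
    constructor
    · have : (-(T + 1 : ℝ)) ≤ c := by linarith
      exact_mod_cast this
    · have : (c : ℝ) ≤ T + 1 := by linarith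
      exact_mod_cast this
  have hL0 : 0 ≤ lam l := by linarith [hlam l]
  have hcm := hcomp (deriv (V (c, 0))) (V (kk α l)) (lam l) (A c) (sm_deriv (hV.smooth _)) (hV.smooth _)
    (hlam l) (hV.maps _) (hAB c _ (hlam l)) ((h l).monoR (Nat.sub_le _ _))
  have hsm := (sm_deriv (hV.smooth (c, 0))).comp (hV.smooth (kk α l))
  have := hcm.mul hsm (sm_deriv (hV.smooth _)) hL0 (h l)
  rw [e]
  refine (Bd.congr hV.hpq (hsm.mul (sm_deriv (hV.smooth _))) (sm_deriv (hV.smooth _))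
    (fun x hx => (hV.deriv_add _ _ hx).symm) this).monoC hL0 ?_
  exact Finset.single_le_sum (f := fun c => 2 ^ R * (F * A c) * C)
    (fun c _ => by have := hA c; positivity) hcT

lemma est1_nat (hV : Act p q V) (hS : PropS p q V α) (R T : ℕ) :
    ∃ C : ℝ, 0 ≤ C ∧ ∀ (m : ℤ) (l : ℕ), |tm α (m, l)| ≤ T →
      Bd (Icc p q) R (Real.sqrt (1 + l)) C (deriv (V (m, l))) := by
  obtain ⟨C, hC, h⟩ := est1_z hV hS R
  obtain ⟨D, hD, h'⟩ := deriv_Bd_of_zf hV hS R hC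
  have h1 : ∀ l : ℕ, 1 ≤ Real.sqrt (1 + l) := fun l => by
    rw [Real.one_le_sqrt]; simp
  refine ext_time hV R T (fun l => Real.sqrt (1 + l)) h1 hD (fun l => ?_)
  have e : deriv (V (kk α l)) = fun x => (zf V (kk α l) x)⁻¹ * (zf V (kk α l) x)⁻¹ := by
    funext x; exact deriv_eq_zf hV _ x
  rw [e]
  refine h' _ _ (h1 l) (tm_kk_le α l) (h _ _ (h1 l) ?_)
  rw [Real.sq_sqrt (by positivity)]; linarith

/-- reversing the second generator -/
def flipHom : ℤ × ℤ →+ ℤ × ℤ where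
  toFun a := (a.1, -a.2)
  map_zero' := by simp
  map_add' a b := by ext <;> simp; ring

lemma tm_flip (α : ℝ) (a : ℤ × ℤ) : tm α (flipHom a) = tm (-α) a := by
  simp [tm, flipHom]

lemma propS_flip (hS : PropS p q V α) : PropS p q (fun a => V (flipHom a)) (-α) := by
  intro a T ha x hx
  rw [← tm_flip] at ha
  simpa [flipHom] using hS (flipHom a) T ha x hx

/-- extend a statement from nonnegative to arbitrary second coordinate -/
lemma ext_sign (R : ℕ) (T : ℕ) (lam : ℕ → ℝ) (hlam : ∀ l, 1 ≤ lam l)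
    (h1 : ∃ C : ℝ, 0 ≤ C ∧ ∀ (m : ℤ) (l : ℕ), |tm α (m, l)| ≤ T →
      Bd (Icc p q) R (lam l) C (deriv (V (m, l))))
    (h2 : ∃ C : ℝ, 0 ≤ C ∧ ∀ (m : ℤ) (l : ℕ), |tm (-α) (m, l)| ≤ T →
      Bd (Icc p q) R (lam l) C (deriv (V (flipHom (m, l))))) :
    ∃ C : ℝ, 0 ≤ C ∧ ∀ a : ℤ × ℤ, |tm α a| ≤ T →
      Bd (Icc p q) R (lam a.2.natAbs) C (deriv (V a)) := by
  obtain ⟨C1, hC1, h1⟩ := h1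
  obtain ⟨C2, hC2, h2⟩ := h2
  refine ⟨C1 + C2, by positivity, fun a ha => ?_⟩
  obtain ⟨m, l⟩ := a
  have h0 : 0 ≤ lam l.natAbs := by linarith [hlam l.natAbs]
  rcases Int.natAbs_eq l with e | e
  · have := h1 m l.natAbs (by rwa [← e])
    rw [← e] at this
    exact this.monoC h0 (by linarith)
  · have e2 : flipHom (m, (l.natAbs : ℤ)) = (m, l) := by
      simp only [flipHom, AddMonoidHom.coe_mk, ZeroHom.coe_mk]
      rw [← e]
    have := h2 m l.natAbs (by rw [← tm_flip, e2]; exact ha)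
    rw [e2] at this
    exact this.monoC h0 (by linarith)

lemma est1 (hV : Act p q V) (hS : PropS p q V α) (R T : ℕ) :
    ∃ C : ℝ, 0 ≤ C ∧ ∀ a : ℤ × ℤ, |tm α a| ≤ T →
      Bd (Icc p q) R (Real.sqrt (1 + a.2.natAbs)) C (deriv (V a)) := by
  refine ext_sign R T (fun l => Real.sqrt (1 + l)) (fun l => by rw [Real.one_le_sqrt]; simp)
    (est1_nat hV hS R T) (est1_nat (hV.hom flipHom) (propS_flip hS) R T)

end

end

section
open Set
open scoped ContDiff

lemma Bd.scale {J : Set ℝ} {R : ℕ} {L C c : ℝ} {u : ℝ → ℝ} (h : Bd J R (c * L) C u) (hc : 1 ≤ c)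
    (hL : 0 ≤ L) : Bd J R L (C * c ^ R) u := by
  intro j hj x hx
  have hC := h.nonneg ⟨x, hx⟩
  refine (h j hj x hx).trans ?_
  rw [mul_pow, mul_assoc]
  have : c ^ j ≤ c ^ R := pow_le_pow_right₀ hc hj
  gcongr

lemma rate_step {p q : ℝ} (hpq : p < q) (i : ℕ) {C c : ℝ} (hC : 0 ≤ C) (hc : 0 < c) :
    ∃ E : ℝ, 0 ≤ E ∧ ∀ (h H G : ℝ → ℝ) (L σ τ : ℝ), ContDiff ℝ ∞ h → ContDiff ℝ ∞ H →
      ContDiff ℝ ∞ G → 1 ≤ L → 0 ≤ σ → 0 ≤ τ → MapsTo h (Icc p q) (Icc p q) →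
      (∀ x, 0 < deriv H x) → (∀ x ∈ Icc p q, c ≤ deriv H x) →
      Bd (Icc p q) (i + 1) L C (deriv H) → Bd (Icc p q) (i + 1) L C (deriv h) →
      Bd (Icc p q) (i + 1) L C (deriv G) →
      EqOn (fun x => H (h x) - H x) (fun x => σ * (G x - x)) (Icc p q) →
      Bd (Icc p q) i L τ (fun x => h x - x) →
      Bd (Icc p q) i L (E * (σ + τ) * L) (deriv (fun x => h x - x)) := by
  obtain ⟨E1, hE1, hdel⟩ := Bd.delta_aux (convex_Icc p q) i hC
  obtain ⟨E2, hE2, hinv⟩ := Bd.inv_aux (J := Icc p q) i hC hc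
  refine ⟨2 ^ i * (1 + C + 2 ^ i * (E1 * C) * C) * E2, by positivity, ?_⟩
  intro h H G L σ τ sh sH sG hL hσ hτ hm hpos hlow bH bh bG heq bu
  have hL0 : 0 ≤ L := by linarith
  have sH' := sm_deriv sH
  have su : ContDiff ℝ ∞ (fun x => h x - x) := sh.sub contDiff_id
  have si : ContDiff ℝ ∞ (fun x => (deriv H x)⁻¹) := sH'.inv (fun x => (hpos x).ne')
  have b1 := hdel (deriv H) h L (C * L) τ sH' sh hL hm bH.dv (bh.monoR (by omega)) bu
  have sD : ContDiff ℝ ∞ (fun x => deriv H (h x) - deriv H x) := (sH'.comp sh).sub sH'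
  have b2 := b1.mul sD (sm_deriv sh) hL0 (bh.monoR (by omega))
  have b3 : Bd (Icc p q) i L (|σ| * (C + 1)) (fun x => σ * (deriv G x - 1)) :=
    ((bG.monoR (by omega)).sub (sm_deriv sG) contDiff_const (Bd.const (C := 1) 1 hL0 (by simp))).smul σ
  have s3 : ContDiff ℝ ∞ (fun x => σ * (deriv G x - 1)) :=
    contDiff_const.mul ((sm_deriv sG).sub contDiff_const)
  have b4 := (b3.sub s3 (sD.mul (sm_deriv sh)) b2).mul (s3.sub (sD.mul (sm_deriv sh))) si hL0
    (hinv (deriv H) L sH' hL (fun x => (hpos x).ne') (fun x hx => (hlow x hx).trans (le_abs_self _))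
      (bH.monoR (by omega)))
  have hd := eqOn_deriv hpq ((sH.comp sh).sub sH) (contDiff_const.mul (sG.sub contDiff_id)) heq
  have e : EqOn (fun x => (σ * (deriv G x - 1) - (deriv H (h x) - deriv H x) * deriv h x) * (deriv H x)⁻¹)
      (deriv (fun x => h x - x)) (Icc p q) := by
    intro x hx
    have e0 := hd hx
    have e1 : deriv (fun x => H (h x) - H x) x = deriv H (h x) * deriv h x - deriv H x :=
      (((sm_diff sH _).hasDerivAt.comp x (sm_diff sh x).hasDerivAt).sub (sm_diff sH x).hasDerivAt).deriv
    have e2 : deriv (fun x => σ * (G x - x)) x = σ * (deriv G x - 1) :=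
      (((sm_diff sG x).hasDerivAt.sub (hasDerivAt_id x)).const_mul σ).deriv
    have e3 : deriv (fun x => h x - x) x = deriv h x - 1 :=
      ((sm_diff sh x).hasDerivAt.sub (hasDerivAt_id x)).deriv
    have e4 : deriv H (h x) * deriv h x - deriv H x = σ * (deriv G x - 1) := by
      rw [← e1, ← e2]; exact e0
    simp only
    rw [e3, ← e4]
    have := (hpos x).ne'
    field_simp
    ring
  refine (Bd.congr hpq ((s3.sub (sD.mul (sm_deriv sh))).mul si) (sm_deriv su) e b4).monoC hL0 ?_
  rw [abs_of_nonneg hσ]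
  have g1 : 2 ^ i * (E1 * (C * L * τ)) * C ≤ 2 ^ i * (E1 * C) * C * (σ + τ) * L := by
    have : 2 ^ i * (E1 * (C * L * τ)) * C = 2 ^ i * (E1 * C) * C * τ * L := by ring
    rw [this]; gcongr; linarith
  have g2 : σ * (C + 1) ≤ (1 + C) * (σ + τ) * L := by
    have : σ ≤ (σ + τ) * L := by nlinarith
    nlinarith
  calc _ ≤ 2 ^ i * ((1 + C) * (σ + τ) * L + 2 ^ i * (E1 * C) * C * (σ + τ) * L) * E2 := by gcongr
    _ = _ := by ring

/-- subpolynomial growth of derivatives up to order `b` -/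
def PB (p q : ℝ) (V : ℤ × ℤ → ℝ → ℝ) (α : ℝ) (b : ℕ) : Prop :=
  ∀ (T : ℕ) (ε : ℝ), 0 < ε → ∃ C : ℝ, 0 ≤ C ∧ ∀ (m : ℤ) (l : ℕ), |tm α (m, l)| ≤ T →
    Bd (Icc p q) b ((1 + (l : ℝ)) ^ ε) C (deriv (V (m, l)))

section
variable {p q α : ℝ} {V : ℤ × ℤ → ℝ → ℝ}

lemma one_le_lam (l : ℕ) {ε : ℝ} (hε : 0 < ε) : 1 ≤ (1 + (l : ℝ)) ^ ε :=
  Real.one_le_rpow (by simp) hε.le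

lemma deriv_bounds (hV : Act p q V) (hS : PropS p q V α) (T : ℕ) : ∃ c C : ℝ, 0 < c ∧ 0 ≤ C ∧
    ∀ a, |tm α a| ≤ T → ∀ x ∈ Icc p q, c ≤ deriv (V a) x ∧ deriv (V a) x ≤ C := by
  obtain ⟨C, hC, hK⟩ := propK hV hS T
  refine ⟨Real.exp (-C), Real.exp C, Real.exp_pos _, (Real.exp_pos _).le, fun a ha x hx => ?_⟩
  have := abs_le.1 (hK a ha x hx)
  rw [← Real.le_log_iff_exp_le (hV.pos _ _), ← Real.log_le_iff_le_exp (hV.pos _ _)]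
  exact this

lemma PB_zero (hV : Act p q V) (hS : PropS p q V α) : PB p q V α 0 := by
  intro T ε hε
  obtain ⟨c, C, hc, hC, h⟩ := deriv_bounds hV hS T
  refine ⟨C, hC, fun m l hml j hj x hx => ?_⟩
  obtain rfl : j = 0 := by omega
  simp only [iteratedDeriv_zero, pow_zero, mul_one]
  rw [abs_of_pos (hV.pos _ _)]
  exact (h _ hml x hx).2

lemma Bd.finsum {J : Set ℝ} {R : ℕ} {L C : ℝ} (N : ℕ) (u : ℕ → ℝ → ℝ) (hs : ∀ j, ContDiff ℝ ∞ (u j))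
    (hL : 0 ≤ L) (h : ∀ j < N, Bd J R L C (u j)) :
    Bd J R L (N * C) (fun x => ∑ j ∈ Finset.range N, u j x) := by
  induction N with
  | zero => simpa using Bd.const (C := 0) 0 hL (by simp)
  | succ N ih =>
    have h1 := ih (fun j hj => h j (by omega))
    have := h1.add (ContDiff.sum (s := Finset.range N) fun j _ => hs j) (hs N) (h N (by omega))
    simp only [Finset.sum_range_succ]
    refine this.monoC hL (le_of_eq ?_)
    push_cast; ring

lemma rateB (hV : Act p q V) (hS : PropS p q V α) {b : ℕ} (hPB : PB p q V α b) {ε : ℝ} (hε : 0 < ε) :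
    ∃ C : ℝ, 0 ≤ C ∧ ∀ (m : ℤ) (k : ℕ), tm α (m, k) ≠ 0 → |tm α (m, k)| ≤ 1 →
      Bd (Icc p q) b ((1 + ((⌊1 / |tm α (m, k)|⌋₊ * k : ℕ) : ℝ)) ^ ε) (C * |tm α (m, k)|)
        (fun x => V (m, k) x - x) := by
  obtain ⟨C, hC, hB⟩ := hPB 1 ε hε
  obtain ⟨c, C', hc, hC', hder⟩ := deriv_bounds hV hS 1
  obtain ⟨C0, hC0, h0⟩ := rate0 hV hS
  suffices H : ∀ i ≤ b, ∃ C : ℝ, 0 ≤ C ∧ ∀ (m : ℤ) (k : ℕ), tm α (m, k) ≠ 0 → |tm α (m, k)| ≤ 1 →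
      Bd (Icc p q) i ((1 + ((⌊1 / |tm α (m, k)|⌋₊ * k : ℕ) : ℝ)) ^ ε) (C * |tm α (m, k)|)
        (fun x => V (m, k) x - x) from H b le_rfl
  intro i
  induction i with
  | zero =>
    intro _
    refine ⟨C0, hC0, fun m k hne hle j hj x hx => ?_⟩
    obtain rfl : j = 0 := by omega
    simpa using h0 _ hle x hx
  | succ i ih =>
    intro hi
    obtain ⟨Ci, hCi, ih⟩ := ih (by omega)
    obtain ⟨E, hE, hstep⟩ := rate_step hV.hpq i hC hc
    refine ⟨C0 + E * (2 + Ci), by positivity, fun m k hne hle => ?_⟩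
    set θ := |tm α (m, k)| with hθ
    have hθ0 : 0 < θ := abs_pos.2 hne
    set N := ⌊1 / θ⌋₊ with hN
    have hN1 : (N : ℝ) ≤ 1 / θ := Nat.floor_le (by positivity)
    have hN2 : 1 / θ < N + 1 := Nat.lt_floor_add_one _
    have hN0 : 1 ≤ N := Nat.le_floor (by rw [Nat.cast_one, le_div_iff₀ hθ0]; linarith)
    have hN0' : (1 : ℝ) ≤ N := by exact_mod_cast hN0
    have hNθ : N * θ ≤ 1 := by rwa [le_div_iff₀ hθ0] at hN1
    have hσ : 1 / (N : ℝ) ≤ 2 * θ := by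
      rw [div_lt_iff₀ hθ0] at hN2
      rw [div_le_iff₀ (by linarith)]
      nlinarith
    set L := (1 + ((N * k : ℕ) : ℝ)) ^ ε with hL
    have hL1 : 1 ≤ L := one_le_lam _ hε
    have hL0 : 0 ≤ L := by linarith
    have hj : ∀ j : ℕ, j • ((m, (k : ℤ)) : ℤ × ℤ) = (j * m, ((j * k : ℕ) : ℤ)) := fun j => by
      ext <;> simp
    have htj : ∀ j : ℕ, j ≤ N → |tm α (j • ((m, (k : ℤ)) : ℤ × ℤ))| ≤ (1 : ℕ) := fun j hjN => by
      rw [tm_nsmul, abs_mul, Nat.abs_cast, ← hθ]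
      have : (j : ℝ) ≤ N := by exact_mod_cast hjN
      push_cast
      nlinarith
    have hBj : ∀ j : ℕ, j ≤ N → Bd (Icc p q) (i + 1) L C (deriv (V (j • ((m, (k : ℤ)) : ℤ × ℤ)))) := by
      intro j hjN
      have h1 := htj j hjN
      rw [hj] at h1 ⊢
      refine (hB _ _ h1).mono hi hC (by positivity) ?_ le_rfl
      rw [hL]
      apply Real.rpow_le_rpow (by positivity) _ hε.le
      have : ((j * k : ℕ) : ℝ) ≤ ((N * k : ℕ) : ℝ) := by exact_mod_cast Nat.mul_le_mul_right k hjN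
      linarith
    have hsj : ∀ j : ℕ, ContDiff ℝ ∞ (V (j • ((m, (k : ℤ)) : ℤ × ℤ))) := fun j => hV.smooth _
    set H : ℝ → ℝ := fun x => (1 / (N : ℝ)) * ∑ j ∈ Finset.range N, V (j • ((m, (k : ℤ)) : ℤ × ℤ)) x with hH
    have sH : ContDiff ℝ ∞ H := contDiff_const.mul (ContDiff.sum fun j _ => hsj j)
    have dH : deriv H = fun x => (1 / (N : ℝ)) * ∑ j ∈ Finset.range N, deriv (V (j • ((m, (k : ℤ)) : ℤ × ℤ))) x := by
      funext x
      exact ((HasDerivAt.fun_sum fun j _ => (sm_diff (hsj j) x).hasDerivAt).const_mul _).deriv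
    have bH : Bd (Icc p q) (i + 1) L C (deriv H) := by
      rw [dH]
      refine ((Bd.finsum N _ (fun j => sm_deriv (hsj j)) hL0 (fun j hjN => hBj j hjN.le)).smul (1 / (N : ℝ))).monoC
        hL0 (le_of_eq ?_)
      rw [abs_of_pos (by positivity)]
      field_simp
    have lowH : ∀ x ∈ Icc p q, c ≤ deriv H x := by
      intro x hx
      rw [dH]
      have : (N : ℝ) * c ≤ ∑ j ∈ Finset.range N, deriv (V (j • ((m, (k : ℤ)) : ℤ × ℤ))) x := by
        have := Finset.card_nsmul_le_sum (Finset.range N)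
          (fun j => deriv (V (j • ((m, (k : ℤ)) : ℤ × ℤ))) x) c
          (fun j hjm => (hder _ (htj j (Finset.mem_range.1 hjm).le) x hx).1)
        simpa using this
      simp only
      rw [div_mul_eq_mul_div, one_mul, le_div_iff₀ (by linarith)]
      linarith
    have posH : ∀ x, 0 < deriv H x := by
      intro x
      rw [dH]
      have : 0 < ∑ j ∈ Finset.range N, deriv (V (j • ((m, (k : ℤ)) : ℤ × ℤ))) x :=
        Finset.sum_pos (fun j _ => hV.pos _ _) ⟨0, Finset.mem_range.2 hN0⟩
      simp only
      positivity
    have heq : EqOn (fun x => H (V (m, k) x) - H x)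
        (fun x => (1 / (N : ℝ)) * (V (N • ((m, (k : ℤ)) : ℤ × ℤ)) x - x)) (Icc p q) := by
      intro x hx
      simp only [hH]
      rw [← mul_sub]
      congr 1
      rw [← Finset.sum_sub_distrib]
      have : ∀ j ∈ Finset.range N, V (j • ((m, (k : ℤ)) : ℤ × ℤ)) (V (m, k) x) - V (j • ((m, (k : ℤ)) : ℤ × ℤ)) x =
          V ((j + 1) • ((m, (k : ℤ)) : ℤ × ℤ)) x - V (j • ((m, (k : ℤ)) : ℤ × ℤ)) x := by
        intro j _
        rw [succ_nsmul, hV.add _ _ x hx]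
      rw [Finset.sum_congr rfl this, Finset.sum_range_sub (fun j => V (j • ((m, (k : ℤ)) : ℤ × ℤ)) x)]
      rw [zero_nsmul, hV.zero hx]
    have bh := hBj 1 hN0
    rw [one_nsmul] at bh
    have := hstep (V (m, k)) H (V (N • ((m, (k : ℤ)) : ℤ × ℤ))) L (1 / N) (Ci * θ) (hV.smooth _) sH (hV.smooth _)
      hL1 (by positivity) (by positivity) (hV.maps _) posH lowH bH bh (hBj N le_rfl) heq (ih m k hne hle)
    apply Bd.of_deriv
    · intro x hx
      refine (h0 _ hle x hx).trans ?_
      rw [← hθ]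
      have : 0 ≤ E * (2 + Ci) * θ := by positivity
      linarith
    · refine this.monoC hL0 ?_
      refine mul_le_mul_of_nonneg_right ?_ hL0
      have : E * (1 / ↑N + Ci * θ) ≤ E * (2 * θ + Ci * θ) := by gcongr
      have : 0 ≤ C0 * θ := by positivity
      linarith

/-- Diophantine condition -/
def Dio (α c : ℝ) (τ : ℕ) : Prop :=
  0 < c ∧ ∀ (m : ℤ) (k : ℕ), 0 < k → c / (1 + (k : ℝ)) ^ τ ≤ |tm α (m, k)|

lemma Dio.ne {c : ℝ} {τ : ℕ} (h : Dio α c τ) {m : ℤ} {k : ℕ} (hk : 0 < k) : tm α (m, k) ≠ 0 := by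
  have := h.2 m k hk
  have h2 : 0 < c / (1 + (k : ℝ)) ^ τ := div_pos h.1 (by positivity)
  exact abs_pos.1 (h2.trans_le this)

lemma rateB' (hV : Act p q V) (hS : PropS p q V α) {b τ : ℕ} {c : ℝ} (hD : Dio α c τ)
    (hPB : PB p q V α b) {ε : ℝ} (hε : 0 < ε) :
    ∃ C : ℝ, 0 ≤ C ∧ ∀ (m : ℤ) (k : ℕ), 0 < k → |tm α (m, k)| ≤ 1 →
      Bd (Icc p q) b ((1 + (k : ℝ)) ^ ε) (C * |tm α (m, k)|) (fun x => V (m, k) x - x) := by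
  have hε0 : 0 < ε / (τ + 1) := by positivity
  obtain ⟨C, hC, h⟩ := rateB hV hS hPB hε0
  have hc := hD.1
  set c1 := (1 + 1 / c) ^ (ε / (τ + 1)) with hc1
  have hc1' : 1 ≤ c1 := Real.one_le_rpow (by have : 0 < 1 / c := by positivity
                                             linarith) hε0.le
  refine ⟨C * c1 ^ b, by positivity, fun m k hk hle => ?_⟩
  have h1 := h m k (hD.ne hk) hle
  set θ := |tm α (m, k)| with hθ
  have hθ0 : 0 < θ := abs_pos.2 (hD.ne hk)
  have h2 := hD.2 m k hk
  have hN1 : (⌊1 / θ⌋₊ : ℝ) ≤ 1 / θ := Nat.floor_le (by positivity)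
  have hlam : (1 + ((⌊1 / θ⌋₊ * k : ℕ) : ℝ)) ^ (ε / (τ + 1)) ≤ c1 * (1 + (k : ℝ)) ^ ε := by
    have e : (1 + (k : ℝ)) ^ ε = ((1 + (k : ℝ)) ^ (τ + 1)) ^ (ε / (τ + 1)) := by
      rw [← Real.rpow_natCast, ← Real.rpow_mul (by positivity)]
      congr 1
      push_cast
      field_simp
    rw [hc1, e, ← Real.mul_rpow (by positivity) (by positivity)]
    apply Real.rpow_le_rpow (by positivity) _ hε0.le
    have h3 : 1 / θ ≤ (1 + (k : ℝ)) ^ τ / c := by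
      rw [div_le_div_iff₀ hθ0 hc]
      rw [div_le_iff₀ (by positivity)] at h2
      linarith
    have h4 : (⌊1 / θ⌋₊ : ℝ) * k ≤ (1 + (k : ℝ)) ^ τ / c * (1 + k) := by
      apply mul_le_mul (hN1.trans h3) (by linarith) (by positivity) (by positivity)
    have h5 : (1 : ℝ) ≤ (1 + (k : ℝ)) ^ (τ + 1) := one_le_pow₀ (by simp)
    push_cast
    calc 1 + (⌊1 / θ⌋₊ : ℝ) * k ≤ (1 + (k : ℝ)) ^ (τ + 1) + (1 + (k : ℝ)) ^ τ / c * (1 + k) := by linarith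
      _ = _ := by ring
  have h6 := (h1.mono le_rfl (by positivity) (by positivity) hlam le_rfl).scale hc1' (by positivity)
  exact h6.monoC (by positivity) (le_of_eq (by ring))

end

end

section
open Set
open scoped ContDiff

section
variable {p q α : ℝ} {V : ℤ × ℤ → ℝ → ℝ}

lemma rpow_neg_pow {X : ℝ} (hX : 0 < X) (e : ℝ) (i : ℕ) : (X ^ e) ^ i = X ^ (e * i) := by
  rw [← Real.rpow_natCast, ← Real.rpow_mul hX.le]

lemma iter_sub_id {u : ℝ → ℝ} (hu : ContDiff ℝ ∞ u) (n : ℕ) (hn : 2 ≤ n) (x : ℝ) :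
    iteratedDeriv n (fun x => u x - x) x = iteratedDeriv (n - 1) (deriv u) x := by
  obtain ⟨n, rfl⟩ : ∃ k, n = k + 2 := ⟨n - 2, by omega⟩
  have e : deriv (fun x => u x - x) = fun x => deriv u x - 1 := by
    funext x
    exact ((sm_diff hu x).hasDerivAt.sub (hasDerivAt_id x)).deriv
  have e2 : deriv (fun x => deriv u x - 1) = deriv (deriv u) := by
    funext x
    exact ((sm_diff (sm_deriv hu) x).hasDerivAt.sub_const 1).deriv
  rw [iteratedDeriv_succ', e, iteratedDeriv_succ', e2, show n + 2 - 1 = n + 1 by omega,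
    iteratedDeriv_succ']

lemma rateS (hV : Act p q V) (hS : PropS p q V α) {b τ : ℕ} {c : ℝ} (hD : Dio α c τ)
    (hPB : PB p q V α b) {ε : ℝ} (hε : 0 < ε) (hε1 : ε ≤ 1) :
    ∃ C : ℝ, 0 ≤ C ∧ ∀ (m : ℤ) (k : ℕ), 0 < k → |tm α (m, k)| ≤ 1 → ∀ j ≤ b + 2, ∀ x ∈ Icc p q,
      |iteratedDeriv j (fun x => V (m, k) x - x) x| ≤ C * |tm α (m, k)| * (1 + (k : ℝ)) ^ (1 + ε) := by
  have hc := hD.1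
  set δ := ε / (b + 2) with hδ
  have hδ0 : 0 < δ := by positivity
  have hδε : δ * (b + 2) = ε := by rw [hδ]; field_simp
  have hδ1 : δ ≤ 1 := by
    have : (0 : ℝ) ≤ b := by positivity
    nlinarith
  obtain ⟨C, hC, hrate⟩ := rateB' hV hS hD hPB hδ0
  obtain ⟨K, hK⟩ := exists_nat_gt ((τ + b + 4) / δ + 2)
  have hK2 : 2 < K := by
    have : (0 : ℝ) ≤ (τ + b + 4) / δ := by positivity
    have : (2 : ℝ) < K := by linarith
    exact_mod_cast this
  have hKδ : (τ + b + 4 : ℝ) ≤ K * δ := by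
    have : (τ + b + 4) / δ < K := by linarith
    rw [div_lt_iff₀ hδ0] at this
    exact this.le
  obtain ⟨C1, hC1, hest⟩ := est1 hV hS (b + K - 1) 1
  obtain ⟨B, hB, hlan⟩ := landau p q hV.hpq K
  refine ⟨B * (C + C1 / c) + C, by positivity, fun m k hk hle j hj x hx => ?_⟩
  have hr := hrate m k hk hle
  set θ := |tm α (m, k)| with hθ
  have hθ0 : 0 < θ := abs_pos.2 (hD.ne hk)
  set X := 1 + (k : ℝ) with hX
  have hX1 : 1 ≤ X := by rw [hX]; simp
  have hX0 : 0 < X := by linarith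
  have su : ContDiff ℝ ∞ (fun x => V (m, k) x - x) := (hV.smooth _).sub contDiff_id
  have hlow : ∀ i ≤ b, ∀ x ∈ Icc p q, |iteratedDeriv i (fun x => V (m, k) x - x) x| ≤ C * θ * X ^ (δ * b) := by
    intro i hi x hx
    refine (hr i hi x hx).trans ?_
    rw [rpow_neg_pow hX0]
    refine mul_le_mul_of_nonneg_left ?_ (by positivity)
    apply Real.rpow_le_rpow_of_exponent_le hX1
    have : (i : ℝ) ≤ b := by exact_mod_cast hi
    gcongr
  have hexp : X ^ (δ * b) ≤ X ^ (1 + ε) := by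
    apply Real.rpow_le_rpow_of_exponent_le hX1
    nlinarith
  have hXp : 0 < X ^ (1 + ε) := by positivity
  rcases Nat.lt_or_ge b j with hbj | hbj
  · obtain ⟨i, rfl⟩ : ∃ i, j = i + b := ⟨j - b, by omega⟩
    have hi2 : i ≤ 2 := by omega
    have hi2' : (i : ℝ) ≤ 2 := by exact_mod_cast hi2
    set v := iteratedDeriv b (fun x => V (m, k) x - x) with hv
    have hvi : ∀ i, iteratedDeriv i v = iteratedDeriv (i + b) (fun x => V (m, k) x - x) := by
      intro i
      rw [hv, iteratedDeriv_eq_iterate, iteratedDeriv_eq_iterate, iteratedDeriv_eq_iterate,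
        Function.iterate_add_apply]
    have hMK : ∀ x ∈ Icc p q, |iteratedDeriv K v x| ≤ C1 * X ^ (((b : ℝ) + K) / 2) := by
      intro x hx
      rw [hvi, iter_sub_id (hV.smooth _) _ (by omega)]
      have := hest (m, k) (by simpa using hle) (K + b - 1) (by omega) x hx
      simp only [Int.natAbs_natCast] at this
      refine this.trans (mul_le_mul_of_nonneg_left ?_ hC1)
      rw [Real.sqrt_eq_rpow, ← hX, rpow_neg_pow hX0]
      apply Real.rpow_le_rpow_of_exponent_le hX1
      have : ((K + b - 1 : ℕ) : ℝ) ≤ K + b := by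
        have : K + b - 1 ≤ K + b := by omega
        exact_mod_cast this
      linarith
    have hη0 : 0 < X ^ (-(1 / 2 + δ)) := by positivity
    have hη1 : X ^ (-(1 / 2 + δ)) ≤ 1 := Real.rpow_le_one_of_one_le_of_nonpos hX1 (by linarith)
    have := hlan v (C * θ * X ^ (δ * b)) _ (sm_iter su b) (hlow b le_rfl) hMK _ hη0 hη1 i (by omega) x hx
    rw [hvi] at this
    refine this.trans ?_
    have e1 : C * θ * X ^ (δ * b) / (X ^ (-(1 / 2 + δ))) ^ i ≤ C * θ * X ^ (1 + ε) := by
      rw [rpow_neg_pow hX0, mul_div_assoc, ← Real.rpow_sub hX0]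
      refine mul_le_mul_of_nonneg_left ?_ (by positivity)
      apply Real.rpow_le_rpow_of_exponent_le hX1
      nlinarith
    have e2 : (X ^ (-(1 / 2 + δ))) ^ (K - i) * (C1 * X ^ (((b : ℝ) + K) / 2)) ≤ C1 / c * θ * X ^ (1 + ε) := by
      have hKi : ((K - i : ℕ) : ℝ) = K - i := Nat.cast_sub (by omega)
      rw [rpow_neg_pow hX0, mul_left_comm, ← Real.rpow_add hX0, hKi]
      have e3 : X ^ (-(1 / 2 + δ) * ((K : ℝ) - i) + ((b : ℝ) + K) / 2) ≤ X ^ (-(τ : ℝ)) := by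
        apply Real.rpow_le_rpow_of_exponent_le hX1
        have hi0 : (0 : ℝ) ≤ i := by positivity
        have hb0 : (0 : ℝ) ≤ b := by positivity
        nlinarith [mul_le_mul hδ1 hi2' hi0 (by norm_num)]
      have e4 : X ^ (-(τ : ℝ)) ≤ θ / c := by
        rw [Real.rpow_neg hX0.le, Real.rpow_natCast, le_div_iff₀ hc]
        have := hD.2 m k hk
        rw [← hθ, ← hX, div_eq_mul_inv] at this
        linarith
      have e5 : 1 ≤ X ^ (1 + ε) := Real.one_le_rpow hX1 (by linarith)
      calc _ ≤ C1 * (θ / c) := mul_le_mul_of_nonneg_left (e3.trans e4) hC1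
        _ = C1 / c * θ * 1 := by ring
        _ ≤ _ := by gcongr
    have : B * (C * θ * X ^ (δ * b) / (X ^ (-(1 / 2 + δ))) ^ i + (X ^ (-(1 / 2 + δ))) ^ (K - i) * (C1 * X ^ (((b : ℝ) + K) / 2)))
       ≤ B * (C * θ * X ^ (1 + ε) + C1 / c * θ * X ^ (1 + ε)) := by gcongr
    have h0 : 0 ≤ C * θ * X ^ (1 + ε) := by positivity
    linarith
  · refine (hlow j hbj x hx).trans ?_
    have : C * θ * X ^ (δ * b) ≤ C * θ * X ^ (1 + ε) := by gcongr
    have : 0 ≤ B * (C + C1 / c) * θ * X ^ (1 + ε) := by positivity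
    linarith

/-- log-derivative -/
noncomputable def lg (V : ℤ × ℤ → ℝ → ℝ) (a : ℤ × ℤ) (x : ℝ) : ℝ := Real.log (deriv (V a) x)

lemma lg_smooth (hV : Act p q V) (a : ℤ × ℤ) : ContDiff ℝ ∞ (lg V a) := hV.log_smooth a

lemma lg_deriv (hV : Act p q V) (a : ℤ × ℤ) :
    deriv (lg V a) = fun x => deriv (deriv (V a)) x * (deriv (V a) x)⁻¹ := by
  funext x
  exact ((sm_diff (sm_deriv (hV.smooth a)) x).hasDerivAt.log (hV.pos a x).ne').deriv

lemma di_smooth (hV : Act p q V) (a : ℤ × ℤ) : ContDiff ℝ ∞ (fun x => (deriv (V a) x)⁻¹) :=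
  (sm_deriv (hV.smooth a)).inv (fun x => (hV.pos a x).ne')

lemma logS (hV : Act p q V) (hS : PropS p q V α) {b τ : ℕ} {c : ℝ} (hD : Dio α c τ)
    (hPB : PB p q V α b) {ε : ℝ} (hε : 0 < ε) (hε1 : ε ≤ 1) :
    ∃ C : ℝ, 0 ≤ C ∧ ∀ (m : ℤ) (k : ℕ), 0 < k → |tm α (m, k)| ≤ 1 →
      Bd (Icc p q) b ((1 + (k : ℝ)) ^ ε) (C * |tm α (m, k)| * (1 + (k : ℝ)) ^ (1 + ε))
        (deriv (lg V (m, k))) := by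
  obtain ⟨C, hC, h⟩ := rateS hV hS hD hPB hε hε1
  obtain ⟨D, hD0, hB⟩ := hPB 1 ε hε
  obtain ⟨c', C', hc', hC', hder⟩ := deriv_bounds hV hS 1
  obtain ⟨E, hE, hinv⟩ := Bd.inv_aux (J := Icc p q) b hD0 hc'
  refine ⟨2 ^ b * C * E, by positivity, fun m k hk hle => ?_⟩
  have hle' : |tm α (m, k)| ≤ (1 : ℕ) := by simpa using hle
  have h1 := one_le_lam k hε
  rw [lg_deriv hV]
  have b1 : Bd (Icc p q) b ((1 + (k : ℝ)) ^ ε) (C * |tm α (m, k)| * (1 + (k : ℝ)) ^ (1 + ε))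
      (deriv (deriv (V (m, k)))) := by
    intro j hj x hx
    have := h m k hk hle (j + 2) (by omega) x hx
    rw [iter_sub_id (hV.smooth _) _ (by omega), show j + 2 - 1 = j + 1 by omega, iteratedDeriv_succ'] at this
    exact this.trans (le_mul_of_one_le_right (by positivity) (one_le_pow₀ h1))
  have b2 := hinv (deriv (V (m, k))) _ (sm_deriv (hV.smooth _)) h1 (fun x => (hV.pos _ x).ne')
    (fun x hx => (hder _ hle' x hx).1.trans (le_abs_self _)) (hB m k hle')
  exact (b1.mul (sm_deriv (sm_deriv (hV.smooth _))) (di_smooth hV _) (by linarith) b2).monoC (by linarith)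
    (le_of_eq (by ring))

lemma log_incr (hV : Act p q V) (b : ℕ) {C0 : ℝ} (hC0 : 0 ≤ C0) :
    ∃ E : ℝ, 0 ≤ E ∧ ∀ (a a' : ℤ × ℤ) (L S : ℝ), 1 ≤ L → Bd (Icc p q) b L S (deriv (lg V a)) →
      Bd (Icc p q) b L C0 (deriv (V a')) → ∀ x ∈ Icc p q,
      |iteratedDeriv (b + 1) (lg V (a + a')) x| ≤ |iteratedDeriv (b + 1) (lg V a') x| + E * S * L ^ b := by
  obtain ⟨F, hF, hcomp⟩ := Bd.comp_aux (J := Icc p q) b hC0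
  refine ⟨2 ^ b * F * C0, by positivity, fun a a' L S hL hS hB x hx => ?_⟩
  have hg : ContDiff ℝ ∞ (fun x => lg V a (V a' x)) := (lg_smooth hV a).comp (hV.smooth a')
  have e : EqOn (lg V (a + a')) (fun x => lg V a (V a' x) + lg V a' x) (Icc p q) :=
    fun x hx => hV.log_add a a' hx
  rw [eqOn_iter hV.hpq (lg_smooth hV _) (hg.add (lg_smooth hV _)) e _ hx,
    iteratedDeriv_fun_add (sm_at hg _ x) (sm_at (lg_smooth hV _) _ x)]
  refine (abs_add_le _ _).trans ?_
  have hd : deriv (fun x => lg V a (V a' x)) = fun x => deriv (lg V a) (V a' x) * deriv (V a') x := by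
    funext x
    exact ((sm_diff (lg_smooth hV a) _).hasDerivAt.comp x (hV.diff a' x).hasDerivAt).deriv
  have b1 := hcomp (deriv (lg V a)) (V a') L S (sm_deriv (lg_smooth hV a)) (hV.smooth _) hL (hV.maps _) hS
    (hB.monoR (Nat.sub_le _ _))
  have b2 := b1.mul ((sm_deriv (lg_smooth hV a)).comp (hV.smooth a')) (sm_deriv (hV.smooth a')) (by linarith) hB
  rw [iteratedDeriv_succ', hd]
  have : |iteratedDeriv b (fun x => deriv (lg V a) (V a' x) * deriv (V a') x) x| ≤
    2 ^ b * (F * S) * C0 * L ^ b := b2 b le_rfl x hx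
  have e3 : 2 ^ b * (F * S) * C0 * L ^ b = 2 ^ b * F * C0 * S * L ^ b := by ring
  linarith

lemma log_step (hV : Act p q V) (hS : PropS p q V α) {b τ : ℕ} {c : ℝ} (hD : Dio α c τ)
    (hPB : PB p q V α b) {ε : ℝ} (hε : 0 < ε) (hε1 : ε ≤ 1) :
    ∃ C : ℝ, 0 ≤ C ∧ ∀ l : ℕ, 1 ≤ l → ∃ l' : ℕ, 2 * l' ≤ l ∧ ∀ x ∈ Icc p q,
      |iteratedDeriv (b + 1) (lg V (kk α l)) x| ≤ |iteratedDeriv (b + 1) (lg V (kk α l')) x| +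
        C * ((1 + (l : ℝ)) ^ ε) ^ (b + 1) := by
  obtain ⟨C1, hC1, hlogS⟩ := logS hV hS hD hPB hε hε1
  obtain ⟨C0, hC0, hB⟩ := hPB 3 ε hε
  obtain ⟨E, hE, hincr⟩ := log_incr hV b hC0
  have := fun c : ℤ => exists_Bd p q (sm_deriv (lg_smooth hV (c, 0))) b
  choose A hA hAB using this
  set A' := ∑ c ∈ Finset.Icc (-3 : ℤ) 3, A c with hA'
  have hA0 : 0 ≤ A' := Finset.sum_nonneg fun c _ => hA c
  refine ⟨E * A' + E * (2 * C1), by positivity, fun l hl => ?_⟩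
  obtain ⟨j, k0, hk0, hkl, hDir⟩ := Real.exists_int_int_abs_mul_sub_le α (n := l) (by omega)
  obtain ⟨k, rfl⟩ : ∃ k : ℕ, k0 = k := ⟨k0.toNat, by omega⟩
  have hk : 0 < k := by exact_mod_cast hk0
  have hkl : k ≤ l := by exact_mod_cast hkl
  set h : ℤ × ℤ := (-j, k) with hh
  have hth : tm α h = k * α - j := by simp [tm, hh]; ring
  set θ := |tm α h| with hθ
  have hl1 : (1 : ℝ) ≤ l := by exact_mod_cast hl
  have hθl : θ ≤ 1 / (l + 1) := by rw [hθ, hth]; simpa using hDir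
  have hθ1 : θ ≤ 1 := hθl.trans (by rw [div_le_one] <;> linarith)
  set n := l / k with hn
  set l' := l % k with hl'
  have hdm : k * n + l' = l := Nat.div_add_mod l k
  have hl'k : l' < k := Nat.mod_lt l hk
  have hn1 : 1 ≤ n := (Nat.one_le_div_iff hk).2 hkl
  refine ⟨l', by nlinarith, ?_⟩
  set d : ℤ := (kk α l).1 + n * j - (kk α l').1 with hd
  have hdec : kk α l = n • h + ((d, 0) + kk α l') := by
    ext
    · simp [hd, hh]
    · simp [hh, kk, ← hdm]; ring
  have hnθ : n * θ ≤ 1 := by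
    have h1 : (n : ℝ) ≤ l := by exact_mod_cast Nat.div_le_self l k
    have h2 : (n : ℝ) * θ ≤ l * (1 / (l + 1)) := by gcongr
    refine h2.trans ?_
    rw [mul_one_div, div_le_one] <;> linarith
  have ht := congrArg (tm α) hdec
  rw [tm_add, tm_add, tm_nsmul] at ht
  have htd : tm α (d, 0) = d := by simp [tm]
  have t1 := abs_le.1 (tm_kk_le α l)
  have t2 := abs_le.1 (tm_kk_le α l')
  have t3 : |(n : ℝ) * tm α h| ≤ 1 := by rw [abs_mul, Nat.abs_cast]; exact hnθ
  have t3' := abs_le.1 t3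
  have hdm3 : d ∈ Finset.Icc (-3 : ℤ) 3 := by
    rw [Finset.mem_Icc]
    constructor
    · have : (-3 : ℝ) ≤ d := by linarith
      exact_mod_cast this
    · have : (d : ℝ) ≤ 3 := by linarith
      exact_mod_cast this
  have hAd : A d ≤ A' := Finset.single_le_sum (f := A) (fun c _ => hA c) hdm3
  set L := (1 + (l : ℝ)) ^ ε with hL
  have hL1 : 1 ≤ L := one_le_lam l hε
  have hmono : ∀ i : ℕ, i ≤ l → (1 + (i : ℝ)) ^ ε ≤ L := fun i hi => by
    apply Real.rpow_le_rpow (by positivity) _ hε.le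
    have : (i : ℝ) ≤ l := by exact_mod_cast hi
    linarith
  have hBk : Bd (Icc p q) b L C0 (deriv (V (kk α l'))) := by
    refine (hB _ l' ?_).mono le_rfl hC0 (by positivity) (hmono l' (by nlinarith)) le_rfl
    exact (tm_kk_le α l').trans (by norm_num)
  have hBi : ∀ i : ℕ, i ≤ n → Bd (Icc p q) b L C0 (deriv (V (i • h + ((d, 0) + kk α l')))) := by
    intro i hi
    have e : i • h + ((d, 0) + kk α l') = (-(i : ℤ) * j + d + (kk α l').1, ((i * k + l' : ℕ) : ℤ)) := by
      ext
      · simp [hh]; ring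
      · simp [hh, kk]
    have hti : |tm α (i • h + ((d, 0) + kk α l'))| ≤ (3 : ℕ) := by
      rw [tm_add, tm_add, tm_nsmul]
      have hin : (i : ℝ) ≤ n := by exact_mod_cast hi
      have : |(i : ℝ) * tm α h| ≤ 1 := by
        rw [abs_mul, Nat.abs_cast]
        exact (mul_le_mul_of_nonneg_right hin (abs_nonneg _)).trans hnθ
      have := abs_le.1 this
      rw [abs_le]
      push_cast
      constructor <;> linarith
    rw [e] at hti ⊢
    refine (hB _ _ hti).mono le_rfl hC0 (by positivity) (hmono _ ?_) le_rfl
    calc i * k + l' ≤ n * k + l' := by gcongr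
      _ = l := by rw [mul_comm]; exact hdm
  set S := C1 * θ * (1 + (k : ℝ)) ^ (1 + ε) with hSdef
  have hS0 : 0 ≤ S := by positivity
  have hbS : Bd (Icc p q) b L S (deriv (lg V h)) :=
    (hlogS (-j) k hk hθ1).mono le_rfl hS0 (by positivity) (hmono k hkl) le_rfl
  intro x hx
  have hind : ∀ i : ℕ, i ≤ n → |iteratedDeriv (b + 1) (lg V (i • h + ((d, 0) + kk α l'))) x| ≤
      |iteratedDeriv (b + 1) (lg V ((d, 0) + kk α l')) x| + i * (E * S * L ^ b) := by
    intro i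
    induction i with
    | zero => intro _; simp
    | succ i ih =>
      intro hi
      have i1 := ih (by omega)
      have i2 := hincr h _ L S hL1 hbS (hBi i (by omega)) x hx
      rw [succ_nsmul', add_assoc]
      push_cast
      linarith
  have i1 := hind n le_rfl
  have i2 := hincr (d, 0) (kk α l') L (A d) hL1 (hAB d L hL1) hBk x hx
  rw [← hdec] at i1
  have hL0 : 0 ≤ L ^ b := by positivity
  have hLb : L ^ b ≤ L ^ (b + 1) := pow_le_pow_right₀ hL1 (Nat.le_succ b)
  have g1 : E * A d * L ^ b ≤ E * A' * L ^ (b + 1) := by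
    have := hA d
    gcongr
  have g2 : n * S ≤ 2 * C1 * L := by
    have hX : 0 < 1 + (k : ℝ) := by positivity
    have e1 : (1 + (k : ℝ)) ^ (1 + ε) = (1 + (k : ℝ)) * (1 + (k : ℝ)) ^ ε := by
      rw [Real.rpow_add hX, Real.rpow_one]
    have hk1 : (1 : ℝ) ≤ k := by exact_mod_cast hk
    have hnk : (n : ℝ) * k ≤ l := by
      have : n * k ≤ l := by rw [mul_comm]; omega
      exact_mod_cast this
    have e2 : n * θ * (1 + (k : ℝ)) ≤ 2 := by
      have hθ0 : 0 ≤ θ := abs_nonneg _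
      have a1 : n * θ * (1 + (k : ℝ)) ≤ 2 * (n * k) * θ := by
        have : 0 ≤ n * θ := by positivity
        nlinarith
      have a2 : 2 * ((n : ℝ) * k) * θ ≤ 2 * l * (1 / (l + 1)) := by gcongr
      have a3 : 2 * (l : ℝ) * (1 / (l + 1)) ≤ 2 := by
        rw [mul_one_div, div_le_iff₀ (by linarith)]; linarith
      linarith
    calc n * S = C1 * (n * θ * (1 + (k : ℝ))) * (1 + (k : ℝ)) ^ ε := by rw [hSdef, e1]; ring
      _ ≤ C1 * 2 * L := by
        have := hmono k hkl
        gcongr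
      _ = _ := by ring
  have g3 : n * (E * S * L ^ b) ≤ E * (2 * C1) * L ^ (b + 1) := by
    calc n * (E * S * L ^ b) = E * (n * S) * L ^ b := by ring
      _ ≤ E * (2 * C1 * L) * L ^ b := by gcongr
      _ = _ := by ring
  linarith

lemma log_growth (hV : Act p q V) (hS : PropS p q V α) {b τ : ℕ} {c : ℝ} (hD : Dio α c τ)
    (hPB : PB p q V α b) {ε : ℝ} (hε : 0 < ε) (hε1 : ε ≤ 1) :
    ∃ C : ℝ, 0 ≤ C ∧ ∀ l : ℕ, ∀ x ∈ Icc p q,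
      |iteratedDeriv (b + 1) (lg V (kk α l)) x| ≤ C * ((1 + (l : ℝ)) ^ ε) ^ (b + 1) := by
  obtain ⟨E, hE, hstep⟩ := log_step hV hS hD hPB hε hε1
  obtain ⟨Y, hY, h0⟩ := bdd_Icc p q (sm_iter (lg_smooth hV (kk α 0)) (b + 1)).continuous
  set δ := ε * (b + 1 : ℕ) with hδ
  have hδ0 : 0 < δ := by positivity
  have hpow : ∀ l : ℕ, ((1 + (l : ℝ)) ^ ε) ^ (b + 1) = (1 + (l : ℝ)) ^ δ := fun l =>
    rpow_neg_pow (by positivity) _ _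
  set r := (3 / 4 : ℝ) ^ δ with hr
  have hr1 : r < 1 := Real.rpow_lt_one (by norm_num) (by norm_num) hδ0
  have hr0 : 0 ≤ r := by positivity
  have h1r : 0 < 1 - r := by linarith
  refine ⟨Y + E / (1 - r), by positivity, fun l => ?_⟩
  induction l using Nat.strong_induction_on with
  | _ l ih =>
    intro x hx
    rcases Nat.eq_zero_or_pos l with rfl | hl
    · have := h0 x hx
      have : 0 ≤ E / (1 - r) := by positivity
      simp
      linarith
    · obtain ⟨l', hl', h⟩ := hstep l hl
      have i1 := ih l' (by omega) x hx
      have i2 := h x hx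
      rw [hpow] at i1 i2 ⊢
      have hlr : (1 : ℝ) ≤ l := by exact_mod_cast hl
      have hl'r : 2 * (l' : ℝ) ≤ l := by exact_mod_cast hl'
      have i3 : (1 + (l' : ℝ)) ^ δ ≤ r * (1 + (l : ℝ)) ^ δ := by
        rw [hr, ← Real.mul_rpow (by norm_num) (by positivity)]
        apply Real.rpow_le_rpow (by positivity) _ hδ0.le
        linarith
      set Z := (1 + (l : ℝ)) ^ δ with hZ
      have hZ0 : 0 ≤ Z := by positivity
      have i4 : (Y + E / (1 - r)) * (1 + (l' : ℝ)) ^ δ ≤ (Y + E / (1 - r)) * (r * Z) :=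
        mul_le_mul_of_nonneg_left i3 (by positivity)
      have i5 : (Y + E / (1 - r)) * (r * Z) + E * Z = (Y * r + E / (1 - r)) * Z := by
        field_simp
        ring
      have i6 : (Y * r + E / (1 - r)) * Z ≤ (Y + E / (1 - r)) * Z := by
        refine mul_le_mul_of_nonneg_right ?_ hZ0
        nlinarith
      linarith

lemma PB_succ (hV : Act p q V) (hS : PropS p q V α) {b τ : ℕ} {c : ℝ} (hD : Dio α c τ)
    (hPB : PB p q V α b) : PB p q V α (b + 1) := by
  -- small exponents suffice
  suffices H : ∀ (T : ℕ) (ε : ℝ), 0 < ε → ε ≤ 1 → ∃ C : ℝ, 0 ≤ C ∧ ∀ (m : ℤ) (l : ℕ), |tm α (m, l)| ≤ T →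
    Bd (Icc p q) (b + 1) ((1 + (l : ℝ)) ^ ε) C (deriv (V (m, l))) by
    intro T ε hε
    obtain ⟨C, hC, h⟩ := H T (min ε 1) (lt_min hε one_pos) (min_le_right _ _)
    refine ⟨C, hC, fun m l hml => (h m l hml).mono le_rfl hC (by positivity) ?_ le_rfl⟩
    exact Real.rpow_le_rpow_of_exponent_le (by simp) (min_le_left _ _)
  intro T ε hε hε1
  obtain ⟨G, hG, hgrow⟩ := log_growth hV hS hD hPB hε hε1
  obtain ⟨D, hD0, hB⟩ := hPB 1 ε hε
  obtain ⟨c', C', hc', hC', hder⟩ := deriv_bounds hV hS 1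
  obtain ⟨E, hE, hinv⟩ := Bd.inv_aux (J := Icc p q) b hD0 hc'
  set M := 2 ^ b * (G + 2 ^ b * D * E) * D with hM
  refine ext_time hV (b + 1) T (fun l => (1 + (l : ℝ)) ^ ε) (fun l => one_le_lam l hε)
    (C := D + M) (by positivity) (fun l => ?_)
  have hle : |tm α (kk α l)| ≤ (1 : ℕ) := by simpa using tm_kk_le α l
  have bV : Bd (Icc p q) b ((1 + (l : ℝ)) ^ ε) D (deriv (V (kk α l))) := hB _ l hle
  set L := (1 + (l : ℝ)) ^ ε with hL
  have hL1 : 1 ≤ L := one_le_lam l hε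
  have hL0 : 0 ≤ L := by linarith
  have sV := hV.smooth (kk α l)
  have bi := hinv (deriv (V (kk α l))) _ (sm_deriv sV) hL1 (fun x => (hV.pos _ x).ne')
    (fun x hx => (hder _ hle x hx).1.trans (le_abs_self _)) bV
  have bl : Bd (Icc p q) b L ((G + 2 ^ b * D * E) * L) (deriv (lg V (kk α l))) := by
    intro j hj x hx
    have hLj : 0 ≤ L ^ j := by positivity
    rcases Nat.lt_or_ge j b with hjb | hjb
    · obtain ⟨b', rfl⟩ : ∃ b', b = b' + 1 := ⟨b - 1, by omega⟩
      have b1 := bV.dv.mul (sm_deriv (sm_deriv sV)) (di_smooth hV _) hL0 (bi.monoR (Nat.le_succ b'))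
      rw [lg_deriv hV]
      refine (b1 j (by omega) x hx).trans ?_
      refine mul_le_mul_of_nonneg_right ?_ hLj
      have : (2 : ℝ) ^ b' ≤ 2 ^ (b' + 1) := pow_le_pow_right₀ (by norm_num) (Nat.le_succ _)
      calc 2 ^ b' * (D * L) * E ≤ 2 ^ (b' + 1) * (D * L) * E := by gcongr
        _ ≤ _ := by
          have : 0 ≤ G * L := by positivity
          linarith
    · obtain rfl : j = b := by omega
      have := hgrow l x hx
      rw [iteratedDeriv_succ'] at this
      refine this.trans ?_
      rw [← hL]
      have : 0 ≤ 2 ^ j * D * E * L * L ^ j := by positivity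
      rw [pow_succ]
      linarith
  apply Bd.of_deriv
  · intro x hx
    have := bV.zero_le hx
    have : 0 ≤ M := by positivity
    linarith
  · have e : deriv (deriv (V (kk α l))) = fun x => deriv (lg V (kk α l)) x * deriv (V (kk α l)) x := by
      funext x
      rw [lg_deriv hV]
      have := (hV.pos (kk α l) x).ne'
      field_simp
    rw [e]
    refine (bl.mul (sm_deriv (lg_smooth hV _)) (sm_deriv sV) hL0 bV).monoC hL0 ?_
    have : 2 ^ b * ((G + 2 ^ b * D * E) * L) * D = M * L := by rw [hM]; ring
    rw [this]
    have : 0 ≤ D * L := by positivity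
    linarith

lemma PB_all (hV : Act p q V) (hS : PropS p q V α) {τ : ℕ} {c : ℝ} (hD : Dio α c τ) (b : ℕ) :
    PB p q V α b := by
  induction b with
  | zero => exact PB_zero hV hS
  | succ b ih => exact PB_succ hV hS hD ih

end

end

section
open Set
open scoped ContDiff

section
variable {p q α : ℝ} {V : ℤ × ℤ → ℝ → ℝ}

lemma interp_id (hV : Act p q V) (hS : PropS p q V α) (k : ℕ) {C : ℝ} (hC : 0 ≤ C) :
    ∃ D : ℝ, 0 ≤ D ∧ ∀ (a : ℤ × ℤ) (s : ℝ), 0 < s → s ≤ 1 → |tm α a| ≤ s →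
      (∀ x ∈ Icc p q, |iteratedDeriv k (deriv (V a)) x| ≤ C * s ^ (-(1 / (4 * ((k : ℝ) + 1))))) →
      Bd (Icc p q) k 1 (D * s ^ (1 / (4 * ((k : ℝ) + 1)))) (fun x => V a x - x) := by
  obtain ⟨C0, hC0, hr⟩ := rate0 hV hS
  obtain ⟨CL, hCL, hlan⟩ := landau p q hV.hpq (k + 1)
  set σ : ℝ := 1 / (4 * ((k : ℝ) + 1)) with hσ
  have hσ0 : 0 < σ := by positivity
  have hk : (4 * ((k : ℝ) + 1)) * σ = 1 := by rw [hσ]; field_simp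
  refine ⟨CL * (C0 + (C + 1)), by positivity, fun a s hs hs1 ht hd j hj x hx => ?_⟩
  have su : ContDiff ℝ ∞ (fun x => V a x - x) := (hV.smooth a).sub contDiff_id
  have h1 : ∀ x ∈ Icc p q, |V a x - x| ≤ C0 * s := fun x hx =>
    (hr a (ht.trans hs1) x hx).trans (mul_le_mul_of_nonneg_left ht hC0)
  have h2 : ∀ x ∈ Icc p q, |iteratedDeriv (k + 1) (fun x => V a x - x) x| ≤ (C + 1) * s ^ (-σ) := by
    intro x hx
    have hd' : deriv (fun x => V a x - x) = fun x => deriv (V a) x - 1 := by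
      funext x
      exact ((hV.diff a x).hasDerivAt.sub (hasDerivAt_id x)).deriv
    rw [iteratedDeriv_succ', hd', iteratedDeriv_fun_sub (sm_at (sm_deriv (hV.smooth a)) _ x) contDiffAt_const]
    refine (abs_sub _ _).trans ?_
    have e1 : |iteratedDeriv k (fun _ : ℝ => (1 : ℝ)) x| ≤ 1 := by
      rw [iteratedDeriv_const]; split_ifs <;> simp
    have e2 : 1 ≤ s ^ (-σ) := Real.one_le_rpow_of_pos_of_le_one_of_nonpos hs hs1 (by linarith)
    have := hd x hx
    linarith
  have hη0 : 0 < s ^ (2 * σ) := Real.rpow_pos_of_pos hs _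
  have hη1 : s ^ (2 * σ) ≤ 1 := Real.rpow_le_one hs.le hs1 (by positivity)
  have := hlan _ _ _ su h1 h2 (s ^ (2 * σ)) hη0 hη1 j (by omega) x hx
  refine this.trans ?_
  rw [one_pow, mul_one, mul_assoc]
  refine mul_le_mul_of_nonneg_left ?_ hCL
  have hjk : (j : ℝ) ≤ k := by exact_mod_cast hj
  have e1 : C0 * s / (s ^ (2 * σ)) ^ j ≤ C0 * s ^ σ := by
    rw [rpow_neg_pow hs, mul_div_assoc]
    refine mul_le_mul_of_nonneg_left ?_ hC0
    have : s / s ^ (2 * σ * j) = s ^ (1 - 2 * σ * j) := by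
      rw [Real.rpow_sub hs, Real.rpow_one]
    rw [this]
    apply Real.rpow_le_rpow_of_exponent_ge hs hs1
    nlinarith [mul_le_mul_of_nonneg_left hjk hσ0.le, mul_nonneg hσ0.le (Nat.cast_nonneg (α := ℝ) k)]
  have e2 : (s ^ (2 * σ)) ^ (k + 1 - j) * ((C + 1) * s ^ (-σ)) ≤ (C + 1) * s ^ σ := by
    have : (s ^ (2 * σ)) ^ (k + 1 - j) ≤ s ^ (2 * σ) := by
      calc _ ≤ (s ^ (2 * σ)) ^ 1 := pow_le_pow_of_le_one hη0.le hη1 (by omega)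
        _ = _ := pow_one _
    have h3 : 0 < s ^ (-σ) := Real.rpow_pos_of_pos hs _
    calc _ ≤ s ^ (2 * σ) * ((C + 1) * s ^ (-σ)) := mul_le_mul_of_nonneg_right this (by positivity)
      _ = (C + 1) * (s ^ (2 * σ) * s ^ (-σ)) := by ring
      _ = _ := by rw [← Real.rpow_add hs]; congr 2; ring
  linarith

lemma near_base (hV : Act p q V) (b0 : ℤ × ℤ) {k : ℕ} (hk1 : 1 ≤ k) {ε : ℝ} (hε : 0 < ε) :
    ∃ δ : ℝ, 0 < δ ∧ ∀ a, Bd (Icc p q) k 1 δ (fun x => V a x - x) →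
      Bd (Icc p q) k 1 ε (fun x => V (b0 + a) x - V b0 x) := by
  obtain ⟨E, hE, h⟩ := Bd.delta_aux (convex_Icc p q) k (C := 2) (by norm_num)
  obtain ⟨M, hM, hB⟩ := exists_Bd p q (sm_deriv (hV.smooth b0)) k
  refine ⟨min 1 (ε / (E * (M + 1))), by positivity, fun a ha => ?_⟩
  have hs := hV.smooth
  have hd' : deriv (fun x => V a x - x) = fun x => deriv (V a) x - 1 := by
    funext x
    exact ((hV.diff a x).hasDerivAt.sub (hasDerivAt_id x)).deriv
  have hk : Bd (Icc p q) (k - 1) 1 2 (deriv (V a)) := by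
    intro j hj x hx
    have h1 := ha (j + 1) (by omega) x hx
    rw [iteratedDeriv_succ', hd', iteratedDeriv_fun_sub (sm_at (sm_deriv (hs a)) _ x) contDiffAt_const,
      one_pow, mul_one] at h1
    have h2 : |iteratedDeriv j (fun _ : ℝ => (1 : ℝ)) x| ≤ 1 := by
      rw [iteratedDeriv_const]; split_ifs <;> simp
    have h3 := h1.trans (min_le_left _ _)
    rw [one_pow, mul_one]
    rw [abs_le] at h2 h3 ⊢
    constructor <;> linarith
  have := h (V b0) (V a) 1 M _ (hs b0) (hs a) le_rfl (hV.maps a) (hB 1 le_rfl) hk ha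
  have this := this.monoC zero_le_one (C' := ε) (by
    have : E * (M * min 1 (ε / (E * (M + 1)))) ≤ E * (M * (ε / (E * (M + 1)))) := by
      gcongr; exact min_le_right _ _
    refine this.trans ?_
    have : E * (M * (ε / (E * (M + 1)))) = ε * (M / (M + 1)) := by field_simp
    rw [this]
    have : M / (M + 1) ≤ 1 := by rw [div_le_one (by positivity)]; linarith
    nlinarith)
  refine this.congr hV.hpq (((hs _).comp (hs _)).sub (hs _)) ((hs _).sub (hs _)) ?_
  intro x hx
  simp only [hV.add b0 a x hx]
  rfl

/-- approximability by a cyclic group -/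
def CycApprox (p q : ℝ) (V : ℤ × ℤ → ℝ → ℝ) : Prop :=
  ∀ (k : ℕ) (ε : ℝ), 0 < ε → ∃ (a : ℤ × ℤ) (N1 N2 : ℤ),
    Bd (Icc p q) k 1 ε (fun x => V (N1 • a) x - V (1, 0) x) ∧
    Bd (Icc p q) k 1 ε (fun x => V (N2 • a) x - V (0, 1) x)

lemma cyc_of_near (hV : Act p q V)
    (h : ∀ (k : ℕ) (δ : ℝ), 0 < δ → ∃ (a : ℤ × ℤ) (N1 N2 : ℤ),
      Bd (Icc p q) k 1 δ (fun x => V (N1 • a - (1, 0)) x - x) ∧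
      Bd (Icc p q) k 1 δ (fun x => V (N2 • a - (0, 1)) x - x)) : CycApprox p q V := by
  intro k ε hε
  obtain ⟨δ1, hδ1, h1⟩ := near_base hV (1, 0) (k := k + 1) (by omega) hε
  obtain ⟨δ2, hδ2, h2⟩ := near_base hV (0, 1) (k := k + 1) (by omega) hε
  obtain ⟨a, N1, N2, ha1, ha2⟩ := h (k + 1) (min δ1 δ2) (lt_min hδ1 hδ2)
  refine ⟨a, N1, N2, ?_, ?_⟩
  · have := h1 _ (ha1.monoC zero_le_one (min_le_left _ _))
    rw [add_sub_cancel] at this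
    exact this.monoR (Nat.le_succ k)
  · have := h2 _ (ha2.monoC zero_le_one (min_le_right _ _))
    rw [add_sub_cancel] at this
    exact this.monoR (Nat.le_succ k)

/-- arithmetic input -/
def NT (α B : ℝ) : Prop := ∃ C : ℝ, 0 ≤ C ∧ ∀ s0 : ℝ, 0 < s0 → ∃ (a : ℤ × ℤ) (N1 N2 : ℤ) (s : ℝ),
  0 < s ∧ s ≤ s0 ∧ |tm α (N1 • a - (1, 0))| ≤ s ∧ |tm α (N2 • a - (0, 1))| ≤ s ∧
  ((N1 • a - (1, 0)).2.natAbs : ℝ) ≤ C * s ^ (-B) ∧ ((N2 • a - (0, 1)).2.natAbs : ℝ) ≤ C * s ^ (-B)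

lemma near_of_NT (hV : Act p q V) (hS : PropS p q V α) (k : ℕ) {B ε : ℝ} (hB : 0 ≤ B) (hε : 0 ≤ ε)
    (hBε : B * ε * k ≤ 1 / (4 * ((k : ℝ) + 1)))
    (hbd : ∃ C : ℝ, 0 ≤ C ∧ ∀ a : ℤ × ℤ, |tm α a| ≤ (1 : ℕ) →
      Bd (Icc p q) k ((1 + (a.2.natAbs : ℝ)) ^ ε) C (deriv (V a)))
    (hnt : NT α B) {δ : ℝ} (hδ : 0 < δ) : ∃ (a : ℤ × ℤ) (N1 N2 : ℤ),
      Bd (Icc p q) k 1 δ (fun x => V (N1 • a - (1, 0)) x - x) ∧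
      Bd (Icc p q) k 1 δ (fun x => V (N2 • a - (0, 1)) x - x) := by
  obtain ⟨C, hC, hbd⟩ := hbd
  obtain ⟨E, hE, hnt⟩ := hnt
  obtain ⟨D, hD, hI⟩ := interp_id hV hS k (C := C * ((1 + E) ^ ε) ^ k) (by positivity)
  set σ : ℝ := 1 / (4 * ((k : ℝ) + 1)) with hσ
  have hσ0 : 0 < σ := by positivity
  set s0 := min 1 ((δ / (D + 1)) ^ (1 / σ)) with hs0
  have hs0p : 0 < s0 := by positivity
  obtain ⟨a, N1, N2, s, hs, hss, t1, t2, l1, l2⟩ := hnt s0 hs0p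
  have hs1 : s ≤ 1 := hss.trans (min_le_left _ _)
  have hsσ : D * s ^ σ ≤ δ := by
    have : s ^ σ ≤ δ / (D + 1) := by
      calc s ^ σ ≤ ((δ / (D + 1)) ^ (1 / σ)) ^ σ :=
            Real.rpow_le_rpow hs.le (hss.trans (min_le_right _ _)) hσ0.le
        _ = _ := by rw [← Real.rpow_mul (by positivity), one_div_mul_cancel hσ0.ne', Real.rpow_one]
    calc D * s ^ σ ≤ D * (δ / (D + 1)) := mul_le_mul_of_nonneg_left this hD
      _ = δ * (D / (D + 1)) := by ring
      _ ≤ δ * 1 := by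
        refine mul_le_mul_of_nonneg_left ?_ hδ.le
        rw [div_le_one (by positivity)]; linarith
      _ = δ := mul_one _
  have key : ∀ c : ℤ × ℤ, |tm α c| ≤ s → (c.2.natAbs : ℝ) ≤ E * s ^ (-B) →
      Bd (Icc p q) k 1 δ (fun x => V c x - x) := by
    intro c hc hl
    refine (hI c s hs hs1 hc fun x hx => ?_).monoC zero_le_one hsσ
    refine (hbd c (by push_cast; exact hc.trans hs1) k le_rfl x hx).trans ?_
    rw [mul_assoc]
    refine mul_le_mul_of_nonneg_left ?_ hC
    have h1 : 1 ≤ s ^ (-B) := Real.one_le_rpow_of_pos_of_le_one_of_nonpos hs hs1 (by linarith)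
    have h2 : 1 + (c.2.natAbs : ℝ) ≤ (1 + E) * s ^ (-B) := by nlinarith
    have h3 : (1 + (c.2.natAbs : ℝ)) ^ ε ≤ (1 + E) ^ ε * s ^ (-B * ε) := by
      refine (Real.rpow_le_rpow (by positivity) h2 hε).trans ?_
      rw [Real.mul_rpow (by positivity) (by positivity), ← Real.rpow_mul hs.le]
    calc ((1 + (c.2.natAbs : ℝ)) ^ ε) ^ k ≤ ((1 + E) ^ ε * s ^ (-B * ε)) ^ k :=
          pow_le_pow_left₀ (by positivity) h3 _
      _ = ((1 + E) ^ ε) ^ k * s ^ (-B * ε * k) := by rw [mul_pow, rpow_neg_pow hs]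
      _ ≤ _ := by
        refine mul_le_mul_of_nonneg_left ?_ (by positivity)
        apply Real.rpow_le_rpow_of_exponent_ge hs hs1
        linarith
  exact ⟨a, N1, N2, key _ t1 l1, key _ t2 l2⟩

lemma NT_irr (hα : Irrational α) : NT α 2 := by
  refine ⟨|α| + 3, by positivity, fun s0 hs0 => ?_⟩
  obtain ⟨n, hn⟩ := exists_nat_one_div_lt (lt_min hs0 one_pos)
  obtain ⟨j, k, hk0, hkn, hjk⟩ := Real.exists_int_int_abs_mul_sub_le α (n := n + 1) (by omega)
  set t : ℝ := (k : ℝ) * α - j with ht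
  have ht0 : t ≠ 0 := by
    have := (hα.intCast_mul hk0.ne').sub_intCast j
    exact this.ne_zero
  have hta : 0 < |t| := abs_pos.2 ht0
  have hn1 : |t| * ((n : ℝ) + 2) ≤ 1 := by
    push_cast at hjk
    rw [le_div_iff₀ (by positivity)] at hjk
    linarith
  have hts : |t| ≤ min s0 1 := by
    refine le_trans ?_ hn.le
    rw [le_div_iff₀ (by positivity)]
    nlinarith
  have ht1 : |t| ≤ 1 := hts.trans (min_le_right _ _)
  have hkt : (k : ℝ) * |t| ≤ 1 := by
    have : (k : ℝ) ≤ n + 1 := by exact_mod_cast hkn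
    nlinarith
  have hkr : (1 : ℝ) ≤ k := by exact_mod_cast hk0
  have hpow : |t| ^ (-2 : ℝ) = 1 / |t| ^ 2 := by
    rw [Real.rpow_neg hta.le, one_div]; norm_cast
  have hr : ∀ y : ℝ, |(round (y / t) : ℝ) * t - y| ≤ |t| ∧ |(round (y / t) : ℝ)| * |t| ≤ |y| + |t| := by
    intro y
    have h1 := abs_sub_round (y / t)
    have h2 : (round (y / t) : ℝ) * t - y = - ((y / t - round (y / t)) * t) := by field_simp; ring
    have h3 : |(round (y / t) : ℝ) * t - y| ≤ |t| := by
      rw [h2, abs_neg, abs_mul]; nlinarith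
    refine ⟨h3, ?_⟩
    rw [← abs_mul]
    have := abs_sub_abs_le_abs_sub ((round (y / t) : ℝ) * t) y
    linarith
  have htm : tm α (-j, k) = t := by simp [tm, ht]; ring
  refine ⟨(-j, k), round (1 / t), round (α / t), |t|, hta, hts.trans (min_le_left _ _), ?_, ?_, ?_, ?_⟩
  · rw [sub_eq_add_neg, tm_add, tm_zsmul, tm_neg, htm]
    have := (hr 1).1
    simpa [tm, sub_eq_add_neg] using this
  · rw [sub_eq_add_neg, tm_add, tm_zsmul, tm_neg, htm]
    have := (hr α).1
    simpa [tm, sub_eq_add_neg] using this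
  · rw [hpow, mul_one_div, le_div_iff₀ (by positivity)]
    have := (hr 1).2
    rw [Nat.cast_natAbs, Int.cast_abs]
    have e : (((round (1 / t) • ((-j, k) : ℤ × ℤ) - (1, 0)).2 : ℤ) : ℝ) = round (1 / t) * k := by simp
    rw [e, abs_mul, abs_of_pos (by linarith : (0 : ℝ) < k), abs_one] at *
    have h5 : 0 ≤ |(round (1 / t) : ℝ)| * |t| := by positivity
    have : |(round (1 / t) : ℝ)| * k * |t| ^ 2 ≤ 2 := by
      calc _ = (|(round (1 / t) : ℝ)| * |t|) * (k * |t|) := by ring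
        _ ≤ 2 * 1 := mul_le_mul (by linarith) hkt (by positivity) (by norm_num)
        _ = 2 := by norm_num
    linarith [abs_nonneg α]
  · rw [hpow, mul_one_div, le_div_iff₀ (by positivity)]
    have := (hr α).2
    rw [Nat.cast_natAbs, Int.cast_abs]
    have e : (((round (α / t) • ((-j, k) : ℤ × ℤ) - (0, 1)).2 : ℤ) : ℝ) = round (α / t) * k - 1 := by simp
    rw [e]
    have h6 : |(round (α / t) : ℝ) * k - 1| ≤ |(round (α / t) : ℝ)| * k + 1 := by
      refine (abs_sub _ _).trans ?_
      rw [abs_mul, abs_of_pos (by linarith : (0 : ℝ) < k), abs_one]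
    have : |(round (α / t) : ℝ)| * k * |t| ^ 2 ≤ |α| + 1 := by
      calc _ = (|(round (α / t) : ℝ)| * |t|) * (k * |t|) := by ring
        _ ≤ (|α| + 1) * 1 := mul_le_mul (by linarith) hkt (by positivity) (by positivity)
        _ = _ := by ring
    have h7 : |t| ^ 2 ≤ 1 := pow_le_one₀ hta.le ht1
    nlinarith [sq_nonneg |t|]

lemma NT_liouville (hα : Liouville α) {B : ℝ} (hB : 0 < B) : NT α B := by
  obtain ⟨m, hm⟩ := exists_nat_gt (2 / B)
  refine ⟨(|α| + 2) * (|α| + 2) ^ B, by positivity, fun s0 hs0 => ?_⟩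
  set C := |α| + 2 with hC
  have hC1 : 2 ≤ C := by have := abs_nonneg α; linarith
  obtain ⟨r, hr⟩ := exists_pow_lt_of_lt_one (div_pos hs0 (by linarith : 0 < C)) (by norm_num : (1 / 2 : ℝ) < 1)
  obtain ⟨P0, b, hb, -, hPb⟩ := hα (2 + (m + r))
  obtain ⟨g, hg⟩ : ∃ g : ℤ, g = ((Int.gcd P0 b : ℕ) : ℤ) := ⟨_, rfl⟩
  have hbr : (2 : ℝ) ≤ b := by exact_mod_cast hb
  have hgpos : 0 < Int.gcd P0 b := Int.gcd_pos_of_ne_zero_right _ (by omega)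
  obtain ⟨P, hP⟩ : g ∣ P0 := hg ▸ Int.gcd_dvd_left ..
  obtain ⟨Q, hQ⟩ : g ∣ b := hg ▸ Int.gcd_dvd_right ..
  have hg0 : 0 < g := by rw [hg]; exact_mod_cast hgpos
  have hQ0 : 0 < Q := by
    have : 0 < g * Q := by omega
    exact (mul_pos_iff_of_pos_left hg0).1 this
  have hcop : IsCoprime P Q := by
    rw [Int.isCoprime_iff_gcd_eq_one]
    have : Int.gcd (g * P) (g * Q) = Int.gcd P0 b := by rw [← hP, ← hQ]
    rw [Int.gcd_mul_left] at this
    have h2 : g.natAbs = Int.gcd P0 b := by simp [hg]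
    rw [h2] at this
    exact Nat.eq_of_mul_eq_mul_left hgpos (by simpa using this)
  have hQb : (Q : ℝ) ≤ b := by
    have : Q ≤ b := by rw [hQ]; nlinarith
    exact_mod_cast this
  have hQr : (0 : ℝ) < Q := by exact_mod_cast hQ0
  have hgr : (0 : ℝ) < g := by exact_mod_cast hg0
  have hfrac : (P0 : ℝ) / b = P / Q := by
    rw [hP, hQ]; push_cast; rw [mul_div_mul_left _ _ hgr.ne']
  rw [hfrac] at hPb
  obtain ⟨v0, u0, huv⟩ := hcop
  obtain ⟨u, v, huv, hv0, hvQ⟩ : ∃ u v : ℤ, u * Q + v * P = 1 ∧ 0 ≤ v ∧ v < Q := by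
    refine ⟨u0 + (v0 / Q) * P, v0 % Q, ?_, Int.emod_nonneg _ hQ0.ne', Int.emod_lt_of_pos _ hQ0⟩
    have := Int.emod_add_mul_ediv v0 Q
    have h3 : v0 % Q = v0 - Q * (v0 / Q) := by linarith
    rw [h3]; linear_combination huv
  have huvr : (u : ℝ) * Q + v * P = 1 := by exact_mod_cast huv
  have hv0r : (0 : ℝ) ≤ v := by exact_mod_cast hv0
  have hvQr : (v : ℝ) < Q := by exact_mod_cast hvQ
  set N := 2 + (m + r) with hN
  have hb0 : (0 : ℝ) < b := by linarith
  have hd1 : |α - P / Q| * (b : ℝ) ^ N ≤ 1 := by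
    rw [lt_div_iff₀ (by positivity)] at hPb; exact hPb.le
  have hbN : (1 : ℝ) ≤ (b : ℝ) ^ N := one_le_pow₀ (by linarith)
  have hPQ : |(P : ℝ) / Q| ≤ |α| + 1 := by
    have h1 : |α - P / Q| ≤ 1 := by nlinarith [abs_nonneg (α - P / Q)]
    have := abs_sub_abs_le_abs_sub ((P : ℝ) / Q) α
    rw [abs_sub_comm] at this
    linarith
  have hPa : |(P : ℝ)| ≤ (|α| + 1) * Q := by
    rwa [abs_div, abs_of_pos hQr, div_le_iff₀ hQr] at hPQ
  have hQ1 : (1 : ℝ) ≤ Q := by exact_mod_cast hQ0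
  have hua : |(u : ℝ)| ≤ C * b := by
    have h1 : |(u : ℝ)| * Q ≤ 1 + Q * ((|α| + 1) * Q) := by
      rw [← abs_of_pos hQr, ← abs_mul, abs_of_pos hQr]
      have : (u : ℝ) * Q = 1 - v * P := by linarith
      rw [this]
      refine (abs_sub _ _).trans ?_
      rw [abs_one, abs_mul, abs_of_nonneg hv0r]
      have := mul_le_mul hvQr.le hPa (abs_nonneg _) hQr.le
      linarith
    have h2 : |(u : ℝ)| * Q ≤ (C * Q) * Q := by rw [hC]; nlinarith
    have := le_of_mul_le_mul_right h2 hQr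
    nlinarith
  have hva : |(v : ℝ)| ≤ C * b := by
    rw [abs_of_nonneg hv0r]; nlinarith
  have hl : ∀ w : ℝ, |w| ≤ C * b → |w * Q| ≤ C * b ^ 2 := by
    intro w hw
    rw [abs_mul, abs_of_pos hQr]
    calc |w| * Q ≤ (C * b) * b := mul_le_mul hw hQb hQr.le (by positivity)
      _ = _ := by ring
  set s : ℝ := C * ((1 : ℝ) / b) ^ (m + r) with hs
  have hs0' : 0 < s := by positivity
  have htime : ∀ w : ℝ, |w| ≤ C * b → |w * Q * (α - P / Q)| ≤ s := by
    intro w hw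
    rw [abs_mul]
    have h1 := hl w hw
    have h2 : |α - P / Q| ≤ 1 / b ^ N := hPb.le
    calc _ ≤ (C * b ^ 2) * (1 / b ^ N) := mul_le_mul h1 h2 (abs_nonneg _) (by positivity)
      _ = s := by rw [hs, hN, pow_add, one_div_pow]; field_simp
  have hbs : (b : ℝ) ^ 2 ≤ C ^ B * s ^ (-B) := by
    have h1 : s ^ (-B) = C ^ (-B) * ((b : ℝ) ^ (m + r)) ^ B := by
      rw [hs, Real.mul_rpow (by positivity) (by positivity), one_div, inv_pow,
        Real.inv_rpow (by positivity), Real.rpow_neg (by positivity : (0 : ℝ) ≤ (b : ℝ) ^ (m + r)), inv_inv]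
    rw [h1, ← mul_assoc, ← Real.rpow_add (by linarith), add_neg_cancel, Real.rpow_zero, one_mul,
      ← Real.rpow_natCast (b : ℝ) (m + r), ← Real.rpow_mul hb0.le, ← Real.rpow_natCast (b : ℝ) 2]
    apply Real.rpow_le_rpow_of_exponent_le (by linarith)
    rw [div_lt_iff₀ hB] at hm
    push_cast
    nlinarith [mul_nonneg (Nat.cast_nonneg (α := ℝ) r) hB.le]
  have hlen : ∀ w : ℝ, |w| ≤ C * b → |w * Q| ≤ C * C ^ B * s ^ (-B) := by
    intro w hw
    refine (hl w hw).trans ?_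
    rw [mul_assoc]
    exact mul_le_mul_of_nonneg_left hbs (by linarith)
  refine ⟨(u, v), Q, P, s, hs0', ?_, ?_, ?_, ?_, ?_⟩
  · have h1 : ((1 : ℝ) / b) ^ (m + r) ≤ (1 / 2) ^ r := by
      calc ((1 : ℝ) / b) ^ (m + r) ≤ ((1 : ℝ) / 2) ^ (m + r) := by gcongr
        _ ≤ (1 / 2) ^ r := pow_le_pow_of_le_one (by norm_num) (by norm_num) (by omega)
    rw [lt_div_iff₀ (by linarith)] at hr
    rw [hs]
    nlinarith
  · have e : tm α (Q • ((u, v) : ℤ × ℤ) - (1, 0)) = v * Q * (α - P / Q) := by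
      simp [tm]; field_simp; linear_combination huvr
    rw [e]; exact htime v hva
  · have e : tm α (P • ((u, v) : ℤ × ℤ) - (0, 1)) = (-u) * Q * (α - P / Q) := by
      simp [tm]; field_simp; linear_combination α * huvr
    rw [e]; exact htime (-u) (by rwa [abs_neg])
  · rw [Nat.cast_natAbs, Int.cast_abs]
    have e : (((Q • ((u, v) : ℤ × ℤ) - (1, 0)).2 : ℤ) : ℝ) = v * Q := by simp; ring
    rw [e]; exact hlen v hva
  · rw [Nat.cast_natAbs, Int.cast_abs]
    have e : (((P • ((u, v) : ℤ × ℤ) - (0, 1)).2 : ℤ) : ℝ) = (-u) * Q := by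
      simp; linear_combination huvr
    rw [e]; exact hlen (-u) (by rwa [abs_neg])

lemma dio_of_not (hα : Irrational α) (hL : ¬ Liouville α) : ∃ c τ, Dio α c τ := by
  unfold Liouville at hL
  push Not at hL
  obtain ⟨n, hn⟩ := hL
  have hd : 0 < |α - round α| := by
    have := (hα.sub_intCast (round α)).ne_zero
    exact abs_pos.2 this
  refine ⟨min 1 |α - round α|, n, lt_min one_pos hd, fun m k hk => ?_⟩
  have hpk : (1 : ℝ) ≤ (1 + (k : ℝ)) ^ n := one_le_pow₀ (by simp)
  rcases Nat.lt_or_ge 1 k with h1 | h1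
  · have hk0 : (0 : ℝ) < k := by positivity
    have hk1 : (1 : ℝ) ≤ k := by exact_mod_cast hk
    have h2 := hn (-m) k (by exact_mod_cast h1) (by
      intro h
      apply hα.ne_rational (-m) k
      exact h)
    have h3 : |tm α (m, k)| = k * |α - ((-m : ℤ) : ℝ) / ((k : ℤ) : ℝ)| := by
      rw [← abs_of_pos hk0, ← abs_mul]
      congr 1
      simp [tm]; field_simp; ring
    rw [h3]
    calc _ ≤ 1 / (1 + (k : ℝ)) ^ n := by gcongr; exact min_le_left _ _
      _ ≤ 1 / (k : ℝ) ^ n := by gcongr; linarith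
      _ ≤ |α - ((-m : ℤ) : ℝ) / ((k : ℤ) : ℝ)| := by simpa using h2
      _ ≤ _ := le_mul_of_one_le_left (abs_nonneg _) hk1
  · obtain rfl : k = 1 := by omega
    have := round_le α (-m)
    have h3 : |tm α (m, (1 : ℕ))| = |α - ((-m : ℤ) : ℝ)| := by
      congr 1; simp [tm]; ring
    rw [h3]
    refine le_trans ?_ this
    exact (div_le_self (by positivity) hpk).trans (min_le_right _ _)

lemma PropS.id_of_tm (hV : Act p q V) (hS : PropS p q V α) {a : ℤ × ℤ} (ha : tm α a = 0) {x : ℝ}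
    (hx : x ∈ Icc p q) : V a x = x := by
  have := hS a 0 (by simp [ha]) x hx
  have h0 : (((-((0 : ℕ) : ℤ)), 0) : ℤ × ℤ) = 0 := by ext <;> simp
  have h1 : ((((0 : ℕ) : ℤ), 0) : ℤ × ℤ) = 0 := by ext <;> simp
  rw [h0, h1, uIcc_self, mem_singleton_iff, hV.zero hx] at this
  exact this

lemma Bd_id (hV : Act p q V) {a : ℤ × ℤ} (h : ∀ x ∈ Icc p q, V a x = x) (k : ℕ) {δ : ℝ} (hδ : 0 ≤ δ) :
    Bd (Icc p q) k 1 δ (fun x => V a x - x) := by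
  have : Bd (Icc p q) k 1 δ (fun _ => (0 : ℝ)) := Bd.const 0 zero_le_one (by simpa using hδ)
  refine this.congr hV.hpq contDiff_const ((hV.smooth a).sub contDiff_id) ?_
  intro x hx
  simp [h x hx]

theorem core (hV : Act p q V) (hS : PropS p q V α) : CycApprox p q V := by
  apply cyc_of_near hV
  intro k δ hδ
  by_cases hα : Irrational α
  · by_cases hL : Liouville α
    · refine near_of_NT hV hS k (B := 2 * (1 / (4 * ((k : ℝ) + 1))) / (k + 1)) (ε := 1 / 2)
        (by positivity) (by norm_num) ?_ ?_ (NT_liouville hL (by positivity)) hδ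
      · have : 2 * (1 / (4 * ((k : ℝ) + 1))) / (k + 1) * (1 / 2) * k =
          (1 / (4 * ((k : ℝ) + 1))) * (k / (k + 1)) := by field_simp
        rw [this]
        refine mul_le_of_le_one_right (by positivity) ?_
        rw [div_le_one (by positivity)]; linarith
      · obtain ⟨C, hC, h⟩ := est1 hV hS k 1
        refine ⟨C, hC, fun a ha => ?_⟩
        rw [← Real.sqrt_eq_rpow]
        exact h a ha
    · obtain ⟨c, τ, hD⟩ := dio_of_not hα hL
      have hα' : Irrational (-α) := hα.neg
      obtain ⟨c', τ', hD'⟩ := dio_of_not hα' (by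
        intro h
        apply hL
        intro n
        obtain ⟨a, b, hb, h1, h2⟩ := h n
        refine ⟨-a, b, hb, ?_, ?_⟩
        · intro h; apply h1; rw [h]; push_cast; ring
        · have : α - ((-a : ℤ) : ℝ) / b = - (-α - a / b) := by push_cast; ring
          rw [this, abs_neg]; exact h2)
      set ε : ℝ := (1 / (4 * ((k : ℝ) + 1))) / (2 * (k + 1)) with hε
      have hε0 : 0 < ε := by positivity
      refine near_of_NT hV hS k (B := 2) (ε := ε) (by norm_num) hε0.le ?_ ?_ (NT_irr hα) hδ
      · have : 2 * ε * k = (1 / (4 * ((k : ℝ) + 1))) * (k / (k + 1)) := by rw [hε]; field_simp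
        rw [this]
        refine mul_le_of_le_one_right (by positivity) ?_
        rw [div_le_one (by positivity)]; linarith
      · refine ext_sign k 1 (fun l => (1 + (l : ℝ)) ^ ε) (fun l => one_le_lam l hε0) ?_ ?_
        · exact PB_all hV hS hD k 1 ε hε0
        · exact PB_all (hV.hom flipHom) (propS_flip hS) hD' k 1 ε hε0
  · obtain ⟨r, rfl⟩ : ∃ r : ℚ, (r : ℝ) = α := by
      simpa [Irrational] using hα
    obtain ⟨v, u, huv⟩ : IsCoprime r.num (r.den : ℤ) := by
      rw [Int.isCoprime_iff_gcd_eq_one]; exact r.reduced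
    have hd : (r.den : ℝ) ≠ 0 := by exact_mod_cast r.den_ne_zero
    have hr : (r : ℝ) = r.num / r.den := Rat.cast_def r
    have huvr : (v : ℝ) * r.num + u * r.den = 1 := by exact_mod_cast huv
    refine ⟨(u, v), r.den, r.num, ?_, ?_⟩
    · refine Bd_id hV (fun x hx => hS.id_of_tm hV ?_ hx) k hδ.le
      simp [tm]; rw [hr]; field_simp; linear_combination huvr
    · refine Bd_id hV (fun x hx => hS.id_of_tm hV ?_ hx) k hδ.le
      simp [tm]; rw [hr]; field_simp; linear_combination (r.num : ℝ) * huvr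

end

end

section
open Set Filter Topology
open scoped ContDiff

namespace Act
variable {Γ : Type*} [AddCommGroup Γ] {p q : ℝ} {W : Γ → ℝ → ℝ}

lemma restrict (h : Act p q W) {lo hi : ℝ} (h1 : p ≤ lo) (h2 : lo < hi) (h3 : hi ≤ q)
    (hlo : ∀ a, W a lo = lo) (hhi : ∀ a, W a hi = hi) : Act lo hi W where
  hpq := h2
  smooth := h.smooth
  pos := h.pos
  left := hlo
  right := hhi
  add a b x hx := h.add a b x ⟨h1.trans hx.1, hx.2.trans h3⟩

lemma iter_fix (h : Act p q W) {x : ℝ} (hx : x ∈ Icc p q) {a : Γ} (ha : W a x = x) (j : ℕ) :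
    W (j • a) x = x := by
  induction j with
  | zero => rw [zero_smul, h.zero hx]
  | succ j ih => rw [succ_nsmul, h.add _ _ x hx, ha, ih]

lemma kopell_right (h : Act p q W) {a b : Γ} {x0 : ℝ} (hx0 : x0 ∈ Icc p q) (ha : W a x0 = x0)
    (hb : x0 < W b x0) : ∀ y ∈ Icc x0 (W b x0), W a y = y := by
  set X : ℕ → ℝ := fun N => W (N • b) x0 with hX
  have hX0 : X 0 = x0 := by simp [hX, h.zero hx0]
  have hX1 : X 1 = W b x0 := by simp [hX]
  have hXs : ∀ N, X (N + 1) = W (N • b) (W b x0) := fun N => by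
    simp only [hX]; rw [succ_nsmul, h.add _ _ x0 hx0]
  have hXlt : ∀ N, X N < X (N + 1) := fun N => by rw [hXs]; exact h.mono _ hb
  have hXm : ∀ N, X N ∈ Icc p q := fun N => h.maps _ hx0
  have hIm : ∀ y ∈ Icc x0 (W b x0), y ∈ Icc p q := fun y hy =>
    ⟨hx0.1.trans hy.1, hy.2.trans (h.maps b hx0).2⟩
  have hfy : ∀ N, ∀ y ∈ Icc x0 (W b x0), W (N • b) y ∈ Icc (X N) (X (N + 1)) := fun N y hy =>
    ⟨(h.mono _).monotone hy.1, by rw [hXs]; exact (h.mono _).monotone hy.2⟩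
  have hfix : ∀ j N, W (j • a) (X N) = X N := fun j N => by
    simp only [hX]
    rw [h.comm _ _ hx0, h.iter_fix hx0 ha j]
  have hvm : ∀ j : ℕ, MapsTo (W (j • a)) (Icc x0 (W b x0)) (Icc x0 (W b x0)) := fun j y hy => by
    have h0 := hfix j 0
    have h1 := hfix j 1
    rw [hX0] at h0; rw [hX1] at h1
    exact ⟨by rw [← h0]; exact (h.mono _).monotone hy.1, by rw [← h1]; exact (h.mono _).monotone hy.2⟩
  obtain ⟨M, hM, hlip⟩ := lip_Icc p q (h.log_smooth b)
  have dist : ∀ N : ℕ, ∀ y ∈ Icc x0 (W b x0), ∀ z ∈ Icc x0 (W b x0),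
      |Real.log (deriv (W (N • b)) y) - Real.log (deriv (W (N • b)) z)| ≤ M * (q - p) := by
    intro N y hy z hz
    rw [h.log_nsmul b N (hIm y hy), h.log_nsmul b N (hIm z hz), ← Finset.sum_sub_distrib]
    refine (Finset.abs_sum_le_sum_abs _ _).trans ?_
    calc _ ≤ ∑ i ∈ Finset.range N, M * (X (i + 1) - X i) := by
          refine Finset.sum_le_sum fun i _ => ?_
          refine (hlip _ (h.maps _ (hIm y hy)) _ (h.maps _ (hIm z hz))).trans ?_
          refine mul_le_mul_of_nonneg_left ?_ hM
          have h1 := hfy i y hy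
          have h2 := hfy i z hz
          rw [abs_le]
          constructor <;> linarith [h1.1, h1.2, h2.1, h2.2]
      _ = M * (X N - X 0) := by rw [← Finset.mul_sum, Finset.sum_range_sub]
      _ ≤ _ := by
        refine mul_le_mul_of_nonneg_left ?_ hM
        linarith [(hXm N).2, (hXm 0).1]
  have hsmall : ∀ ε : ℝ, 0 < ε → ∃ N, X (N + 1) - X N < ε := by
    intro ε hε
    by_contra! hcon
    obtain ⟨n, hn⟩ := exists_nat_gt ((q - p) / ε)
    rw [div_lt_iff₀ hε] at hn
    have : ∑ i ∈ Finset.range n, (X (i + 1) - X i) ≥ ∑ i ∈ Finset.range n, ε :=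
      Finset.sum_le_sum fun i _ => hcon i
    rw [Finset.sum_range_sub, Finset.sum_const, Finset.card_range, nsmul_eq_mul] at this
    linarith [(hXm n).2, (hXm 0).1]
  have key : ∀ j : ℕ, ∀ y ∈ Icc x0 (W b x0), |Real.log (deriv (W (j • a)) y)| ≤ M * (q - p) := by
    intro j y hy
    obtain ⟨L, hL, hLip⟩ := lip_Icc p q (h.log_smooth (j • a))
    refine le_of_forall_pos_le_add fun ε hε => ?_
    obtain ⟨N, hN⟩ := hsmall (ε / (L + 1)) (by positivity)
    have e1 := h.log_add (N • b) (j • a) (hIm y hy)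
    rw [add_comm (N • b), h.log_add (j • a) (N • b) (hIm y hy)] at e1
    obtain ⟨ξ, hξ, hs⟩ := exists_deriv_eq_slope (W (j • a)) (hXlt N) (h.diff _).continuous.continuousOn
      (h.diff _).differentiableOn
    rw [hfix, hfix, div_self (sub_pos.2 (hXlt N)).ne'] at hs
    have hξm : ξ ∈ Icc p q := ⟨(hXm N).1.trans hξ.1.le, hξ.2.le.trans (hXm (N + 1)).2⟩
    have e2 := hLip (W (N • b) y) (h.maps _ (hIm y hy)) ξ hξm
    rw [hs, Real.log_one, sub_zero] at e2
    have e3 : |W (N • b) y - ξ| ≤ X (N + 1) - X N := by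
      have h1 := hfy N y hy
      rw [abs_le]; constructor <;> linarith [h1.1, h1.2, hξ.1, hξ.2]
    have e4 := dist N y hy (W (j • a) y) (hvm j hy)
    have e5 : L * |W (N • b) y - ξ| ≤ ε := by
      rw [lt_div_iff₀ (by positivity)] at hN
      have := hXlt N
      nlinarith [abs_nonneg (W (N • b) y - ξ)]
    have e6 := e2.trans e5
    rw [abs_le] at e4 e6 ⊢
    constructor <;> linarith
  intro y hy
  by_contra hne
  set C := M * (q - p)
  -- displacement of iterates bounded below
  have step : ∀ j : ℕ, Real.exp (-C) * |W a y - y| ≤ |W ((j + 1) • a) y - W (j • a) y| := by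
    intro j
    have hay : W a y ∈ Icc x0 (W b x0) := by simpa using hvm 1 hy
    rw [succ_nsmul, h.add _ _ y (hIm y hy)]
    have hpt : ∀ ξ ∈ Icc x0 (W b x0), Real.exp (-C) ≤ deriv (W (j • a)) ξ := by
      intro ξ hξ
      rw [← Real.exp_log (h.pos (j • a) ξ), Real.exp_le_exp]
      exact (abs_le.1 (key j ξ hξ)).1
    have hmv : ∀ u ∈ Icc x0 (W b x0), ∀ v ∈ Icc x0 (W b x0), u < v →
        Real.exp (-C) * |v - u| ≤ |W (j • a) v - W (j • a) u| := by
      intro u hu v hv huv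
      have := (convex_Icc x0 (W b x0)).mul_sub_le_image_sub_of_le_deriv (f := W (j • a))
        (h.diff _).continuous.continuousOn (h.diff _).differentiableOn
        (C := Real.exp (-C)) (fun ξ hξ => hpt ξ (interior_subset hξ)) u hu v hv huv.le
      rw [abs_of_pos (sub_pos.2 huv)]
      exact this.trans (le_abs_self _)
    rcases lt_or_gt_of_ne hne with hlt | hlt
    · have := hmv _ hay _ hy hlt
      rw [abs_sub_comm, abs_sub_comm (W (j • a) (W a y))]
      exact this
    · exact hmv _ hy _ hay hlt
  set d := Real.exp (-C) * |W a y - y| with hd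
  have hd0 : 0 < d := mul_pos (Real.exp_pos _) (abs_pos.2 (sub_ne_zero.2 hne))
  have hbound : ∀ n : ℕ, n * d ≤ |W (n • a) y - y| := by
    intro n
    have hy0 : W (0 • a) y = y := by rw [zero_smul, h.zero (hIm y hy)]
    have hsm : ∀ j : ℕ, W ((j + 1) • a) y = W (j • a) (W a y) := fun j => by
      rw [succ_nsmul, h.add _ _ y (hIm y hy)]
    rcases lt_or_gt_of_ne hne with hlt | hlt
    · have hm : ∀ j : ℕ, W ((j + 1) • a) y - W (j • a) y ≤ -d := fun j => by
        have h1 := step j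
        have h2 : W ((j + 1) • a) y < W (j • a) y := by rw [hsm]; exact h.mono _ hlt
        rw [abs_of_neg (sub_neg.2 h2)] at h1
        linarith
      have : ∑ i ∈ Finset.range n, (W ((i + 1) • a) y - W (i • a) y) ≤ ∑ i ∈ Finset.range n, (-d) :=
        Finset.sum_le_sum fun i _ => hm i
      rw [Finset.sum_range_sub (fun i => W (i • a) y), Finset.sum_const, Finset.card_range, nsmul_eq_mul, hy0] at this
      refine le_trans ?_ (neg_le_abs _)
      linarith
    · have hm : ∀ j : ℕ, d ≤ W ((j + 1) • a) y - W (j • a) y := fun j => by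
        have h1 := step j
        have h2 : W (j • a) y < W ((j + 1) • a) y := by rw [hsm]; exact h.mono _ hlt
        rwa [abs_of_pos (sub_pos.2 h2)] at h1
      have : ∑ i ∈ Finset.range n, d ≤ ∑ i ∈ Finset.range n, (W ((i + 1) • a) y - W (i • a) y) :=
        Finset.sum_le_sum fun i _ => hm i
      rw [Finset.sum_range_sub (fun i => W (i • a) y), Finset.sum_const, Finset.card_range, nsmul_eq_mul, hy0] at this
      exact this.trans (le_abs_self _)
  obtain ⟨n, hn⟩ := exists_nat_gt ((q - p) / d)
  rw [div_lt_iff₀ hd0] at hn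
  have h1 := hbound n
  have h2 := h.maps (n • a) (hIm y hy)
  have h3 := hIm y hy
  have : |W (n • a) y - y| ≤ q - p := by
    rw [abs_le]; constructor <;> linarith [h2.1, h2.2, h3.1, h3.2]
  linarith

lemma kopell (h : Act p q W) {a b : Γ} {x0 : ℝ} (hx0 : x0 ∈ Icc p q) (ha : W a x0 = x0)
    (hb : W b x0 ≠ x0) : ∀ᶠ y in 𝓝 x0, W a y = y := by
  have main : ∀ b, x0 < W b x0 → ∀ᶠ y in 𝓝 x0, W a y = y := by
    intro b hb
    have hr := h.kopell_right hx0 ha hb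
    have hl : W (-b) x0 < x0 := by
      have := h.mono (-b) hb
      rwa [h.neg_cancel b hx0] at this
    filter_upwards [Ioo_mem_nhds hl hb] with y hy
    rcases le_or_gt x0 y with h1 | h1
    · exact hr y ⟨h1, hy.2.le⟩
    · have hyI : y ∈ Icc p q := ⟨(h.maps (-b) hx0).1.trans hy.1.le, h1.le.trans hx0.2⟩
      have hby : W b y ∈ Icc x0 (W b x0) := by
        refine ⟨?_, (h.mono b).monotone h1.le⟩
        have := (h.mono b).monotone hy.1.le
        rwa [h.neg_cancel' b hx0] at this
      have := hr _ hby
      rw [h.comm a b hyI] at this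
      exact (h.mono b).injective this
  rcases lt_or_gt_of_ne hb with hb | hb
  · apply main (-b)
    have := h.mono (-b) hb
    rwa [h.neg_cancel b hx0] at this
  · exact main b hb

/-- sign of the displacement -/
noncomputable def _root_.sg (W : Γ → ℝ → ℝ) (x : ℝ) (a : Γ) : SignType := SignType.sign (W a x - x)

/-- common fixed points -/
def _root_.CF (W : Γ → ℝ → ℝ) : Set ℝ := {x | ∀ a, W a x = x}

lemma maps_Ioo (h : Act p q W) (a : Γ) : MapsTo (W a) (Ioo p q) (Ioo p q) := fun x hx =>
  ⟨by rw [← h.left a]; exact h.mono a hx.1, by rw [← h.right a]; exact h.mono a hx.2⟩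

lemma sg_const (h : Act p q W) (hfree : ∀ x ∈ Ioo p q, x ∉ CF W) :
    ∀ x ∈ Ioo p q, ∀ y ∈ Ioo p q, sg W x = sg W y := by
  intro x hx y hy
  funext a
  have hpre : IsPreconnected (Ioo p q) := isPreconnected_Ioo
  refine hpre.induction₂ (fun x y => sg W x a = sg W y a) ?_ (fun _ _ _ _ _ _ h1 h2 => h1.trans h2)
    (fun _ _ _ _ h => h.symm) hx hy
  intro z hz
  apply Filter.Eventually.filter_mono nhdsWithin_le_nhds
  have hc : Continuous (fun x => W a x - x) := (h.diff a).continuous.sub continuous_id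
  rcases lt_trichotomy (W a z - z) 0 with h1 | h1 | h1
  · filter_upwards [hc.continuousAt.eventually_lt continuousAt_const h1] with y hy
    simp only [sg]; rw [sign_neg h1, sign_neg hy]
  · have hnf := hfree z hz
    simp only [CF, Set.mem_ofPred_eq, not_forall] at hnf
    obtain ⟨b, hb⟩ := hnf
    filter_upwards [h.kopell (Ioo_subset_Icc_self hz) (sub_eq_zero.1 h1) hb] with y hy
    simp only [sg]; rw [h1, hy, sub_self]
  · filter_upwards [continuousAt_const.eventually_lt hc.continuousAt h1] with y hy
    simp only [sg]; rw [sign_pos h1, sign_pos hy]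

lemma arch (h : Act p q W) (hfree : ∀ x ∈ Ioo p q, x ∉ CF W) {x : ℝ} (hx : x ∈ Ioo p q) {b : Γ}
    (hb : x < W b x) (a : Γ) : ∃ N : ℕ, W a x ≤ W (N • b) x := by
  by_contra! hcon
  have hxI := Ioo_subset_Icc_self hx
  have hmono : Monotone (fun N : ℕ => W (N • b) x) := monotone_nat_of_le_succ fun N => by
    rw [succ_nsmul, h.add _ _ x hxI]
    exact ((h.mono _) hb).le
  have hbd : BddAbove (range fun N : ℕ => W (N • b) x) := ⟨W a x, by rintro _ ⟨N, rfl⟩; exact (hcon N).le⟩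
  have hlim := tendsto_atTop_ciSup hmono hbd
  set e := ⨆ N : ℕ, W (N • b) x
  have he1 : x ≤ e := by
    have := le_ciSup hbd 0
    simpa [h.zero hxI] using this
  have he2 : e ≤ W a x := ciSup_le fun N => (hcon N).le
  have heI : e ∈ Ioo p q := ⟨hx.1.trans_le he1, he2.trans_lt (h.maps_Ioo a hx).2⟩
  have hfix : W b e = e := by
    have h1 : Tendsto (fun N : ℕ => W ((N + 1) • b) x) atTop (𝓝 e) :=
      (tendsto_add_atTop_iff_nat (f := fun N : ℕ => W (N • b) x) 1).2 hlim
    have h2 : Tendsto (fun N : ℕ => W b (W (N • b) x)) atTop (𝓝 (W b e)) :=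
      ((h.diff b).continuous.tendsto e).comp hlim
    refine tendsto_nhds_unique h2 (h1.congr fun N => ?_)
    rw [succ_nsmul', h.add _ _ x hxI]
  have := congrFun (h.sg_const hfree x hx e heI) b
  simp only [sg] at this
  rw [hfix, sub_self, sign_pos (sub_pos.2 hb)] at this
  simp at this

lemma exists_comp (h : Act p q W) {x : ℝ} (hx : x ∈ Ioo p q) (hxF : x ∉ CF W) :
    ∃ lo hi, Act lo hi W ∧ p ≤ lo ∧ lo < x ∧ x < hi ∧ hi ≤ q ∧ (lo ∈ CF W) ∧ (hi ∈ CF W) ∧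
      ∀ y ∈ Ioo lo hi, y ∉ CF W := by
  have hcl : IsClosed (CF W) := by
    have : CF W = ⋂ a, {x | W a x = x} := by ext; simp [CF]
    rw [this]
    exact isClosed_iInter fun a => isClosed_eq (h.diff a).continuous continuous_id
  set A := CF W ∩ Icc p x
  set B := CF W ∩ Icc x q
  have hA : IsCompact A := isCompact_Icc.inter_left hcl
  have hB : IsCompact B := isCompact_Icc.inter_left hcl
  have hAn : A.Nonempty := ⟨p, fun a => h.left a, le_rfl, hx.1.le⟩
  have hBn : B.Nonempty := ⟨q, fun a => h.right a, hx.2.le, le_rfl⟩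
  have h1 := hA.sSup_mem hAn
  have h2 := hB.sInf_mem hBn
  have h3 : sSup A < x := lt_of_le_of_ne h1.2.2 (fun e => hxF (e ▸ h1.1))
  have h4 : x < sInf B := lt_of_le_of_ne h2.2.1 (fun e => hxF (e ▸ h2.1))
  refine ⟨sSup A, sInf B, h.restrict h1.2.1 (h3.trans h4) h2.2.2 h1.1 h2.1, h1.2.1, h3, h4, h2.2.2,
    h1.1, h2.1, fun y hy hyF => ?_⟩
  rcases le_total y x with hyx | hyx
  · exact absurd (le_csSup hA.bddAbove ⟨hyF, h1.2.1.trans hy.1.le, hyx⟩) (not_le.2 hy.1)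
  · exact absurd (csInf_le hB.bddBelow ⟨hyF, hyx, hy.2.le.trans h2.2.2⟩) (not_le.2 hy.2)

end Act

end

section
open Set Filter Topology Asymptotics
open scoped ContDiff

lemma taylor_flat {u : ℝ → ℝ} (hu : ContDiff ℝ ∞ u) {c : ℝ} {r : ℕ}
    (h : ∀ j < r, iteratedDeriv j u c = 0) :
    (fun x => u x - iteratedDeriv r u c / (r.factorial : ℝ) * (x - c) ^ r) =o[𝓝 c] fun x => (x - c) ^ r := by
  have := taylor_isLittleO_univ (x₀ := c) (n := r) (hu.of_le (by exact_mod_cast le_top))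
  refine this.congr_left fun x => ?_
  rw [taylor_within_apply, Finset.sum_range_succ, Finset.sum_eq_zero, zero_add, iteratedDerivWithin_univ]
  · simp only [smul_eq_mul]; ring
  · intro j hj
    rw [iteratedDerivWithin_univ, h j (Finset.mem_range.1 hj), smul_zero]

namespace Act
variable {Γ : Type*} [AddCommGroup Γ] {p q : ℝ} {W : Γ → ℝ → ℝ}

/-- displacement small to order `r` -/
def _root_.Sml (W : Γ → ℝ → ℝ) (c : ℝ) (r : ℕ) (v : Γ) : Prop :=
  (fun x => W v x - x) =o[𝓝 c] fun x => (x - c) ^ r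

lemma bigO_pow (h : Act p q W) {c : ℝ} (hc : c ∈ CF W) (r : ℕ) (b : Γ) :
    (fun x => (W b x - c) ^ r) =O[𝓝 c] fun x => (x - c) ^ r := by
  have h1 : (fun x => W b x - c) =O[𝓝 c] fun x => x - c := by
    have := (h.diff b c).hasFDerivAt.isBigO_sub
    rwa [hc b] at this
  exact h1.pow r

lemma comp_small (h : Act p q W) {c : ℝ} (hc : c ∈ CF W) {r : ℕ} {v : Γ} (hv : Sml W c r v) (b : Γ) :
    (fun x => W v (W b x) - W b x) =o[𝓝 c] fun x => (x - c) ^ r := by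
  have ht : Tendsto (W b) (𝓝 c) (𝓝 c) := by
    have := (h.diff b).continuous.tendsto c
    rwa [hc b] at this
  exact (hv.comp_tendsto ht).trans_isBigO (h.bigO_pow hc r b)

lemma small_add (h : Act p q W) {c : ℝ} (hcI : c ∈ Ioo p q) (hc : c ∈ CF W) {r : ℕ} {v w : Γ}
    (hv : Sml W c r v) (hw : Sml W c r w) : Sml W c r (v + w) := by
  have := (h.comp_small hc hv w).add hw
  refine this.congr' ?_ EventuallyEq.rfl
  filter_upwards [Icc_mem_nhds hcI.1 hcI.2] with x hx
  rw [h.add v w x hx]; ring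

lemma small_neg (h : Act p q W) {c : ℝ} (hcI : c ∈ Ioo p q) (hc : c ∈ CF W) {r : ℕ} {v : Γ}
    (hv : Sml W c r v) : Sml W c r (-v) := by
  have := (h.comp_small hc hv (-v)).neg_left
  refine this.congr' ?_ EventuallyEq.rfl
  filter_upwards [Icc_mem_nhds hcI.1 hcI.2] with x hx
  rw [h.neg_cancel' v hx]; ring

lemma small_nsmul (h : Act p q W) {c : ℝ} (hcI : c ∈ Ioo p q) (hc : c ∈ CF W) {r : ℕ} {v : Γ}
    (hv : Sml W c r v) (n : ℕ) : Sml W c r (n • v) := by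
  induction n with
  | zero =>
    have : (fun _ : ℝ => (0 : ℝ)) =o[𝓝 c] fun x => (x - c) ^ r := isLittleO_zero _ _
    refine this.congr' ?_ EventuallyEq.rfl
    filter_upwards [Icc_mem_nhds hcI.1 hcI.2] with x hx
    rw [zero_smul, h.zero hx, sub_self]
  | succ n ih => rw [succ_nsmul]; exact h.small_add hcI hc ih hv

/-- leading coefficient -/
noncomputable def _root_.lc (W : Γ → ℝ → ℝ) (c : ℝ) (r : ℕ) (v : Γ) : ℝ :=
  iteratedDeriv r (fun x => W v x - x) c / (r.factorial : ℝ)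

/-- all displacements are flat to order `r` -/
def _root_.Flt (W : Γ → ℝ → ℝ) (c : ℝ) (r : ℕ) : Prop :=
  ∀ v, ∀ j < r, iteratedDeriv j (fun x => W v x - x) c = 0

lemma tay (h : Act p q W) {c : ℝ} {r : ℕ} (hF : Flt W c r) (v : Γ) :
    (fun x => (W v x - x) - lc W c r v * (x - c) ^ r) =o[𝓝 c] fun x => (x - c) ^ r :=
  taylor_flat ((h.smooth v).sub contDiff_id) (hF v)

lemma small_of_lc (h : Act p q W) {c : ℝ} {r : ℕ} (hF : Flt W c r) {v : Γ} (hv : lc W c r v = 0) :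
    Sml W c r v := by
  have := h.tay hF v
  simpa [hv, Sml] using this

lemma lc_of_side (h : Act p q W) {c : ℝ} {r : ℕ} (hF : Flt W c r) {v : Γ} {l : Filter ℝ} [l.NeBot]
    (hl : l ≤ 𝓝[≠] c) (ho : (fun x => W v x - x) =o[l] fun x => (x - c) ^ r) : lc W c r v = 0 := by
  have h1 := (h.tay hF v).mono (hl.trans nhdsWithin_le_nhds)
  have h2 := ho.sub h1
  by_contra hne
  have h3 : (fun x : ℝ => (x - c) ^ r) =o[l] fun x => (x - c) ^ r := by
    have h4 : (fun x : ℝ => lc W c r v * (x - c) ^ r) =o[l] fun x => (x - c) ^ r :=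
      h2.congr_left fun x => by ring
    exact (isLittleO_const_mul_left_iff hne).1 h4
  have h5 : ∃ᶠ x in l, (x - c) ^ r ≠ 0 := by
    apply Eventually.frequently
    filter_upwards [hl self_mem_nhdsWithin] with x hx
    exact pow_ne_zero _ (sub_ne_zero.2 hx)
  exact isLittleO_irrefl h5 h3

lemma sign_lc (h : Act p q W) {c : ℝ} {r : ℕ} (hF : Flt W c r) {v : Γ} (hv : lc W c r v ≠ 0) :
    ∀ᶠ z in 𝓝[≠] c, sg W z v = SignType.sign (lc W c r v) * SignType.sign (z - c) ^ r := by
  have h1 := (h.tay hF v).def (c := |lc W c r v| / 2) (by positivity)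
  filter_upwards [h1.filter_mono nhdsWithin_le_nhds, self_mem_nhdsWithin] with z hz hzc
  have hp : (z - c) ^ r ≠ 0 := pow_ne_zero _ (sub_ne_zero.2 hzc)
  rw [sg, ← sign_pow, ← sign_mul]
  rw [Real.norm_eq_abs, Real.norm_eq_abs] at hz
  have hm : 0 < |lc W c r v * (z - c) ^ r| := abs_pos.2 (mul_ne_zero hv hp)
  have hz' : |W v z - z - lc W c r v * (z - c) ^ r| < |lc W c r v * (z - c) ^ r| := by
    refine hz.trans_lt ?_
    rw [abs_mul] at *
    linarith
  rcases lt_or_gt_of_ne (mul_ne_zero hv hp) with hs | hs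
  · rw [abs_of_neg hs, abs_lt] at hz'
    rw [sign_neg hs, sign_neg (by linarith)]
  · rw [abs_of_pos hs, abs_lt] at hz'
    rw [sign_pos hs, sign_pos (by linarith)]

lemma zero_side (h : Act p q W) {c : ℝ} (hcI : c ∈ Ioo p q) (hc : c ∈ CF W) {r : ℕ} (hF : Flt W c r)
    {w : Γ} (hw : lc W c r w ≠ 0) {lo hi : ℝ} (hk : Act lo hi W)
    (hfree : ∀ x ∈ Ioo lo hi, x ∉ CF W) {l : Filter ℝ} [l.NeBot] (hl : l ≤ 𝓝[≠] c)
    (hlI : Ioo lo hi ∈ l) {v : Γ} (hv : lc W c r v = 0) : ∀ x ∈ Ioo lo hi, sg W x v = 0 := by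
  intro x hx
  have hxI := Ioo_subset_Icc_self hx
  by_contra hne
  have hvs := h.small_of_lc hF hv
  have hne' : W v x ≠ x := by
    intro e; apply hne; simp [sg, e]
  -- choose signs
  have flip : ∀ u : Γ, W u x < x → x < W (-u) x := by
    intro u hu
    have := hk.mono (-u) hu
    rwa [hk.neg_cancel u hxI] at this
  obtain ⟨v', hv's, hv'x⟩ : ∃ v', Sml W c r v' ∧ x < W v' x := by
    rcases lt_or_gt_of_ne hne' with h1 | h1
    · exact ⟨-v, h.small_neg hcI hc hvs, flip v h1⟩
    · exact ⟨v, hvs, h1⟩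
  obtain ⟨w', hw's, hw'x⟩ : ∃ w', ¬ Sml W c r w' ∧ x ≤ W w' x := by
    have hwn : ¬ Sml W c r w := fun hs => hw (h.lc_of_side hF hl (hs.mono (hl.trans nhdsWithin_le_nhds)))
    rcases lt_or_ge (W w x) x with h1 | h1
    · refine ⟨-w, fun hs => hwn ?_, (flip w h1).le⟩
      have := h.small_neg hcI hc hs
      rwa [neg_neg] at this
    · exact ⟨w, hwn, h1⟩
  obtain ⟨N, hN⟩ := hk.arch hfree hx hv'x w'
  have hsm := h.small_nsmul hcI hc hv's N
  apply hw's
  apply h.small_of_lc hF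
  apply h.lc_of_side hF hl
  refine IsBigO.trans_isLittleO ?_ (hsm.mono (hl.trans nhdsWithin_le_nhds))
  refine IsBigO.of_bound 1 ?_
  filter_upwards [hlI] with z hz
  have hzI := Ioo_subset_Icc_self hz
  have s1 : z ≤ W w' z := by
    have := congrFun (hk.sg_const hfree x hx z hz) w'
    simp only [sg] at this
    have h2 : 0 ≤ SignType.sign (W w' z - z) := by
      rw [← this, sign_nonneg_iff]; linarith
    rw [sign_nonneg_iff] at h2; linarith
  have s2 : W w' z ≤ W (N • v') z := by
    have := congrFun (hk.sg_const hfree x hx z hz) (-w' + N • v')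
    simp only [sg] at this
    have h1 : x ≤ W (-w' + N • v') x := by
      rw [hk.add _ _ x hxI]
      have := (hk.mono (-w')).monotone hN
      rwa [hk.neg_cancel _ hxI] at this
    have h2 : 0 ≤ SignType.sign (W (-w' + N • v') z - z) := by
      rw [← this, sign_nonneg_iff]; linarith
    rw [sign_nonneg_iff, hk.add _ _ z hzI] at h2
    have h3 := (hk.mono w').monotone (sub_nonneg.1 h2)
    rwa [hk.neg_cancel' _ (hk.maps _ hzI)] at h3
  rw [Real.norm_eq_abs, Real.norm_eq_abs, abs_of_nonneg (by linarith), abs_of_nonneg (by linarith)]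
  linarith

/-- local structure of signs -/
def _root_.Cls (W : Γ → ℝ → ℝ) (c : ℝ) (ε : Γ → SignType) : Prop :=
  ∀ᶠ z in 𝓝[≠] c, z ∉ CF W ∧ (sg W z = ε ∨ sg W z = -ε)

lemma cls_free (h : Act p q W) {c : ℝ} (hcI : c ∈ Ioo p q) (hc : c ∉ CF W) : Cls W c (sg W c) := by
  obtain ⟨lo, hi, hk, h1, h2, h3, h4, h5, h6, h7⟩ := h.exists_comp hcI hc
  refine Eventually.filter_mono nhdsWithin_le_nhds ?_
  filter_upwards [Ioo_mem_nhds h2 h3] with z hz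
  exact ⟨h7 z hz, Or.inl (hk.sg_const h7 z hz c ⟨h2, h3⟩)⟩

lemma cls_exists (h : Act p q W) (hnf : ∀ c ∈ Ioo p q, ∃ (a : Γ) (k : ℕ),
    iteratedDeriv k (fun x => W a x - x) c ≠ 0) {c : ℝ} (hcI : c ∈ Ioo p q) : ∃ ε, Cls W c ε := by
  classical
  by_cases hc : c ∈ CF W
  swap
  · exact ⟨_, h.cls_free hcI hc⟩
  have hex : ∃ r, ∃ a : Γ, iteratedDeriv r (fun x => W a x - x) c ≠ 0 := by
    obtain ⟨a, k, hak⟩ := hnf c hcI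
    exact ⟨k, a, hak⟩
  obtain ⟨r, ⟨w, hw⟩, hmin⟩ : ∃ r, (∃ a : Γ, iteratedDeriv r (fun x => W a x - x) c ≠ 0) ∧
      Flt W c r := by
    refine ⟨Nat.find hex, Nat.find_spec hex, fun v j hj => ?_⟩
    have := Nat.find_min hex hj
    push Not at this
    exact this v
  have hw' : lc W c r w ≠ 0 := div_ne_zero hw (by positivity)
  have hfr : ∀ᶠ z in 𝓝[≠] c, z ∉ CF W := by
    filter_upwards [h.sign_lc hmin hw', self_mem_nhdsWithin] with z hz hzc hzF
    rw [sg, hzF w, sub_self, sign_zero, ← sign_pow, ← sign_mul, eq_comm, sign_eq_zero_iff] at hz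
    exact mul_ne_zero hw' (pow_ne_zero _ (sub_ne_zero.2 hzc)) hz
  obtain ⟨a, b, hab, hsub⟩ : ∃ a b, c ∈ Ioo a b ∧ ∀ z ∈ Ioo a b, z ≠ c → z ∉ CF W ∧ z ∈ Ioo p q := by
    rw [eventually_nhdsWithin_iff] at hfr
    have h2 := hfr.and (Ioo_mem_nhds hcI.1 hcI.2)
    obtain ⟨a, b, hab, hs⟩ := mem_nhds_iff_exists_Ioo_subset.1 h2
    exact ⟨a, b, hab, fun z hz hzc => ⟨(hs hz).1 hzc, (hs hz).2⟩⟩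
  set ε : Γ → SignType := fun v => SignType.sign (lc W c r v)
  have side : ∀ (lo hi : ℝ) (hk : Act lo hi W) (hfree : ∀ x ∈ Ioo lo hi, x ∉ CF W) (l : Filter ℝ)
      (_ : l.NeBot) (hl : l ≤ 𝓝[≠] c) (hlI : Ioo lo hi ∈ l) (σ : SignType)
      (hσ : ∀ᶠ z in l, SignType.sign (z - c) ^ r = σ), ∀ x ∈ Ioo lo hi, ∀ v, sg W x v = ε v * σ := by
    intro lo hi hk hfree l hne hl hlI σ hσ x hx v
    by_cases hv : lc W c r v = 0
    · rw [h.zero_side hcI hc hmin hw' hk hfree hl hlI hv x hx]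
      simp [ε, hv]
    · obtain ⟨z, hz1, hz2, hz3⟩ := ((h.sign_lc hmin hv).filter_mono hl |>.and (hσ.and hlI)).exists
      rw [hk.sg_const hfree x hx z hz3, hz1, hz2]
  -- right side
  have hR : ∃ hi, c < hi ∧ ∀ x ∈ Ioo c hi, ∀ v, sg W x v = ε v := by
    obtain ⟨z1, hz1⟩ := exists_between hab.2
    have hz1' := hsub z1 ⟨hab.1.trans hz1.1, hz1.2⟩ hz1.1.ne'
    obtain ⟨lo, hi, hk, h1, h2, h3, h4, h5, h6, h7⟩ := h.exists_comp hz1'.2 hz1'.1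
    obtain rfl : lo = c := by
      rcases lt_trichotomy lo c with hlt | heq | hgt
      · exact absurd hc (h7 c ⟨hlt, hz1.1.trans h3⟩)
      · exact heq
      · exact absurd h5 (hsub lo ⟨hab.1.trans hgt, h2.trans hz1.2⟩ hgt.ne').1
    refine ⟨hi, hk.hpq, fun x hx v => ?_⟩
    have := side lo hi hk h7 (𝓝[>] lo) inferInstance (nhdsWithin_mono _ (fun z hz => (ne_of_gt hz)))
      (Ioo_mem_nhdsGT hk.hpq) 1 ?_ x hx v
    · simpa using this
    · filter_upwards [self_mem_nhdsWithin] with z hz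
      rw [sign_pos (sub_pos.2 hz), one_pow]
  have hL : ∃ lo, lo < c ∧ ∀ x ∈ Ioo lo c, ∀ v, sg W x v = ε v * (-1) ^ r := by
    obtain ⟨z1, hz1⟩ := exists_between hab.1
    have hz1' := hsub z1 ⟨hz1.1, hz1.2.trans hab.2⟩ hz1.2.ne
    obtain ⟨lo, hi, hk, h1, h2, h3, h4, h5, h6, h7⟩ := h.exists_comp hz1'.2 hz1'.1
    obtain rfl : hi = c := by
      rcases lt_trichotomy hi c with hlt | heq | hgt
      · exact absurd h6 (hsub hi ⟨hz1.1.trans h3, hlt.trans hab.2⟩ hlt.ne).1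
      · exact heq
      · exact absurd hc (h7 c ⟨h2.trans hz1.2, hgt⟩)
    refine ⟨lo, hk.hpq, fun x hx v => ?_⟩
    refine side lo hi hk h7 (𝓝[<] hi) inferInstance (nhdsWithin_mono _ (fun z hz => (ne_of_lt hz)))
      (Ioo_mem_nhdsLT hk.hpq) _ ?_ x hx v
    filter_upwards [self_mem_nhdsWithin] with z hz
    rw [sign_neg (sub_neg.2 hz)]
  obtain ⟨hi, hhi, hR⟩ := hR
  obtain ⟨lo, hlo, hL⟩ := hL
  refine ⟨ε, ?_⟩
  unfold Cls
  filter_upwards [hfr, Eventually.filter_mono nhdsWithin_le_nhds (Ioo_mem_nhds hlo hhi),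
    self_mem_nhdsWithin] with z hz1 hz2 hz3
  refine ⟨hz1, ?_⟩
  rcases lt_or_gt_of_ne hz3 with hlt | hgt
  · have := hL z ⟨hz2.1, hlt⟩
    rcases Nat.even_or_odd r with hr | hr
    · left; funext v; rw [this v, hr.neg_one_pow, mul_one]
    · right; funext v; rw [this v, hr.neg_one_pow, mul_neg_one]; rfl
  · left; funext v; exact hR z ⟨hgt, hz2.2⟩ v

lemma cls_cls {c : ℝ} {ε ε' : Γ → SignType} (h1 : Cls W c ε) (h2 : Cls W c ε') : ε = ε' ∨ ε = -ε' := by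
  obtain ⟨z, hz⟩ := (h1.and h2).exists
  rcases hz.1.2 with e1 | e1 <;> rcases hz.2.2 with e2 | e2
  · left; rw [← e1, e2]
  · right; rw [← e1, e2]
  · right; rw [← e2, e1, neg_neg]
  · left; rw [← neg_inj, ← e1, e2]

lemma Cls.neg' {c : ℝ} {ε : Γ → SignType} (h : Cls W c ε) : Cls W c (-ε) := by
  unfold Cls at *
  filter_upwards [h] with z hz
  rw [neg_neg]
  exact ⟨hz.1, hz.2.symm⟩

theorem sg_global (h : Act p q W) (hnf : ∀ c ∈ Ioo p q, ∃ (a : Γ) (k : ℕ),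
    iteratedDeriv k (fun x => W a x - x) c ≠ 0) {x y : ℝ} (hx : x ∈ Ioo p q) (hy : y ∈ Ioo p q)
    (hxF : x ∉ CF W) (hyF : y ∉ CF W) : sg W x = sg W y ∨ sg W x = - sg W y := by
  have : ∃ ε, Cls W x ε ∧ Cls W y ε := by
    refine isPreconnected_Ioo.induction₂ (fun x y => ∃ ε, Cls W x ε ∧ Cls W y ε) ?_ ?_ ?_ hx hy
    · intro c hc
      obtain ⟨ε, hε⟩ := h.cls_exists hnf hc
      refine Eventually.filter_mono nhdsWithin_le_nhds ?_
      have h2 : ∀ᶠ y in 𝓝[≠] c, Cls W y ε := by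
        have h3 : ∀ᶠ y in 𝓝[≠] c, ∀ᶠ z in 𝓝[≠] c ⊓ 𝓝 y, z ∉ CF W ∧ (sg W z = ε ∨ sg W z = -ε) := by
          have := eventually_eventually_nhdsWithin.2 hε
          filter_upwards [this] with y hy
          refine hy.filter_mono ?_
          rw [nhdsWithin, nhdsWithin]
          exact le_inf inf_le_right (inf_le_left.trans inf_le_right)
        have hε' := eventually_nhdsWithin_iff.1 hε
        have h4 := eventually_eventually_nhds.2 hε'
        rw [eventually_nhdsWithin_iff]
        filter_upwards [h4] with y hy hyc
        unfold Cls
        have hyn : ∀ᶠ z in 𝓝 y, z ≠ c := isOpen_ne.mem_nhds hyc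
        exact (hy.and hyn).filter_mono nhdsWithin_le_nhds |>.mono fun z hz => hz.1 hz.2
      rw [eventually_nhdsWithin_iff] at h2
      filter_upwards [h2] with y hy
      by_cases hyc : y = c
      · exact ⟨ε, hε, hyc ▸ hε⟩
      · exact ⟨ε, hε, hy hyc⟩
    · rintro a b c - - - ⟨ε, h1, h2⟩ ⟨ε', h3, h4⟩
      rcases cls_cls h2 h3 with rfl | rfl
      · exact ⟨_, h1, h4⟩
      · exact ⟨_, h1, Cls.neg' h4⟩
    · rintro a b - - ⟨ε, h1, h2⟩
      exact ⟨ε, h2, h1⟩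
  obtain ⟨ε, h1, h2⟩ := this
  rcases cls_cls (h.cls_free hx hxF) h1 with e1 | e1 <;>
    rcases cls_cls (h.cls_free hy hyF) h2 with e2 | e2 <;> rw [e1, e2]
  · left; rfl
  · right; rw [neg_neg]
  · right; rfl
  · left; rfl

end Act

end

section
open Set Filter Topology
open scoped ContDiff

lemma exists_alpha (P : ℤ × ℤ → Prop) (tot : ∀ a, P a ∨ P (-a))
    (hadd : ∀ a b, P a → P b → P (a + b)) (h1 : P (1, 0)) (hn : ¬ P (-1, 0))
    (harch : ∀ b, ¬ P (-b) → ∀ a, ∃ N : ℕ, P (N • b - a)) :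
    ∃ α : ℝ, ∀ a, P a ↔ 0 ≤ tm α a := by
  have h0 : P 0 := by rcases tot 0 with h | h <;> simpa using h
  have hns : ∀ (N : ℕ) a, P a → P (N • a) := fun N a ha => by
    induction N with
    | zero => simpa using h0
    | succ N ih => rw [succ_nsmul]; exact hadd _ _ ih ha
  have hzero : ∀ m : ℤ, P (m, 0) → 0 ≤ m := fun m hm => by
    by_contra hlt
    push Not at hlt
    apply hn
    have := hadd _ _ hm (hns (-m - 1).toNat _ h1)
    have e : ((-m - 1).toNat : ℤ) = -m - 1 := Int.toNat_of_nonneg (by omega)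
    have e2 : (m, (0:ℤ)) + (-m - 1).toNat • ((1 : ℤ), (0 : ℤ)) = (-1, 0) := by
      ext
      · simp; omega
      · simp
    rwa [e2] at this
  have hcross : ∀ m l m' l' : ℤ, 0 < l → 0 < l' → P (m, l) → P (m', -l') → 0 ≤ l' * m + l * m' := by
    intro m l m' l' hl hl' h h'
    apply hzero
    have := hadd _ _ (hns l'.toNat _ h) (hns l.toNat _ h')
    have e : (l.toNat : ℤ) = l := Int.toNat_of_nonneg hl.le
    have e' : (l'.toNat : ℤ) = l' := Int.toNat_of_nonneg hl'.le
    convert this using 1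
    ext
    · simp [e, e']
    · simp [e, e']; ring
  set S : Set ℝ := {r | ∃ m l : ℤ, 0 < l ∧ P (m, l) ∧ r = -(m : ℝ) / l} with hS
  have h1n : ¬ P (-(1, 0)) := by simpa using hn
  have hne : S.Nonempty := by
    obtain ⟨N, hN⟩ := harch _ h1n (0, -1)
    exact ⟨_, N, 1, one_pos, by simpa using hN, rfl⟩
  have hub : ∀ m' l' : ℤ, 0 < l' → P (m', -l') → ∀ r ∈ S, r ≤ m' / l' := by
    rintro m' l' hl' h' r ⟨m, l, hl, h, rfl⟩
    have := hcross m l m' l' hl hl' h h'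
    have hlR : (0 : ℝ) < l := by exact_mod_cast hl
    have hlR' : (0 : ℝ) < l' := by exact_mod_cast hl'
    rw [div_le_div_iff₀ hlR hlR']
    have t : (0 : ℝ) ≤ l' * m + l * m' := by exact_mod_cast this
    nlinarith
  have hbd : BddAbove S := by
    obtain ⟨N, hN⟩ := harch _ h1n (0, 1)
    exact ⟨_, fun r hr => hub N 1 one_pos (by simpa using hN) r hr⟩
  have hfw : ∀ a, P a → 0 ≤ tm (sSup S) a := by
    rintro ⟨m, l⟩ h
    simp only [tm]
    rcases lt_trichotomy l 0 with hl | hl | hl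
    · have hlR : (l : ℝ) < 0 := by exact_mod_cast hl
      have := csSup_le hne (hub m (-l) (by omega) (by simpa using h))
      push_cast at this
      rw [le_div_iff₀ (by linarith)] at this
      linarith
    · subst hl
      have := hzero m h
      simpa using this
    · have hlR : (0 : ℝ) < l := by exact_mod_cast hl
      have := le_csSup hbd (⟨m, l, hl, h, rfl⟩ : -(m : ℝ) / l ∈ S)
      rw [div_le_iff₀ hlR] at this
      linarith
  refine ⟨sSup S, fun a => ⟨hfw a, fun ha => ?_⟩⟩
  by_contra hP
  obtain ⟨N, hN⟩ := harch (-a) (by simpa using hP) (1, 0)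
  have := hfw _ hN
  rw [sub_eq_add_neg, tm_add, tm_nsmul, tm_neg, tm_neg] at this
  have e : tm (sSup S) (1, 0) = 1 := by simp [tm]
  rw [e] at this
  have : (0 : ℝ) ≤ N * tm (sSup S) a := by positivity
  linarith

namespace Act
variable {Γ : Type*} [AddCommGroup Γ] {p q : ℝ} {W : Γ → ℝ → ℝ}

lemma le_iff_neg (h : Act p q W) {x : ℝ} (hx : x ∈ Icc p q) (a : Γ) :
    x ≤ W a x ↔ W (-a) x ≤ x := by
  rw [← (h.mono (-a)).le_iff_le (a := x), h.neg_cancel a hx]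

lemma exists_alpha_pos (h : Act p q W) (φ : ℤ × ℤ →+ Γ) {x : ℝ} (hx : x ∈ Ioo p q)
    (h1 : x < W (φ (1, 0)) x) : ∃ α, ∀ a, x ≤ W (φ a) x ↔ 0 ≤ tm α a := by
  have hxI := Ioo_subset_Icc_self hx
  apply exists_alpha (fun a => x ≤ W (φ a) x)
  · intro a
    simp only [map_neg]
    rw [h.le_iff_neg hxI (-φ a), neg_neg]
    exact le_total _ _
  · intro a b ha hb
    simp only [map_add]
    rw [h.add _ _ x hxI]
    exact ha.trans ((h.mono _).monotone hb)
  · exact h1.le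
  · have e : ((-1 : ℤ), (0:ℤ)) = -(1, 0) := by simp
    rw [e, map_neg, h.le_iff_neg hxI, neg_neg, not_le]
    exact h1
  · intro b hb a
    rw [map_neg, h.le_iff_neg hxI, neg_neg, not_le] at hb
    have hxF : x ∉ CF W := fun hh => (hh (φ b) ▸ hb).false
    obtain ⟨lo, hi, hA, -, g1, g2, -, -, -, hfree⟩ := h.exists_comp hx hxF
    obtain ⟨N, hN⟩ := hA.arch hfree ⟨g1, g2⟩ hb (φ a)
    refine ⟨N, ?_⟩
    rw [map_sub, map_nsmul, sub_eq_neg_add, h.add _ _ x hxI]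
    calc x = W (-φ a) (W (φ a) x) := (h.neg_cancel _ hxI).symm
      _ ≤ _ := (h.mono _).monotone hN

lemma exists_alpha_sg (h : Act p q W) (φ : ℤ × ℤ →+ Γ) {x : ℝ} (hx : x ∈ Ioo p q)
    (h1 : W (φ (1, 0)) x ≠ x) :
    ∃ α, (∀ a, 0 ≤ tm α a → x ≤ W (φ a) x) ∨ (∀ a, 0 ≤ tm α a → W (φ a) x ≤ x) := by
  have hxI := Ioo_subset_Icc_self hx
  rcases lt_or_gt_of_ne h1 with hlt | hgt
  · obtain ⟨α, hα⟩ := h.exists_alpha_pos (-φ) hx (by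
      by_contra hcon
      push Not at hcon
      rw [AddMonoidHom.neg_apply, ← h.le_iff_neg hxI] at hcon
      linarith)
    refine ⟨α, Or.inr fun a ha => ?_⟩
    have := (hα a).2 ha
    rw [AddMonoidHom.neg_apply, h.le_iff_neg hxI, neg_neg] at this
    exact this
  · obtain ⟨α, hα⟩ := h.exists_alpha_pos φ hx hgt
    exact ⟨α, Or.inl fun a ha => (hα a).2 ha⟩

lemma propS_of (h : Act p q W) (φ : ℤ × ℤ →+ Γ) {α : ℝ}
    (H : ∀ x ∈ Icc p q, (∀ a, 0 ≤ tm α a → x ≤ W (φ a) x) ∨ (∀ a, 0 ≤ tm α a → W (φ a) x ≤ x)) :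
    PropS p q (fun a => W (φ a)) α := by
  intro a T haT x hx
  have hab := abs_le.1 haT
  set u : ℤ × ℤ := ((T : ℤ), 0) with hu
  set v : ℤ × ℤ := (-(T : ℤ), 0) with hv
  have tu : tm α u = T := by simp [tm, hu]
  have tv : tm α v = -T := by simp [tm, hv]
  have e1 : W (φ u) x = W (φ a) (W (φ (u - a)) x) := by
    rw [← h.add _ _ x hx, ← map_add]; simp
  have e2 : W (φ a) x = W (φ v) (W (φ (a - v)) x) := by
    rw [← h.add _ _ x hx, ← map_add]; simp
  have t1 : 0 ≤ tm α (u - a) := by rw [sub_eq_add_neg, tm_add, tm_neg, tu]; linarith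
  have t2 : 0 ≤ tm α (a - v) := by rw [sub_eq_add_neg, tm_add, tm_neg, tv]; linarith
  rw [mem_uIcc]
  show (W (φ v) x ≤ W (φ a) x ∧ W (φ a) x ≤ W (φ u) x) ∨ (W (φ u) x ≤ W (φ a) x ∧ W (φ a) x ≤ W (φ v) x)
  rcases H x hx with H | H
  · left
    exact ⟨by rw [e2]; exact (h.mono _).monotone (H _ t2), by rw [e1]; exact (h.mono _).monotone (H _ t1)⟩
  · right
    exact ⟨by rw [e1]; exact (h.mono _).monotone (H _ t1), by rw [e2]; exact (h.mono _).monotone (H _ t2)⟩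

theorem piece_core (h : Act p q W)
    (hnf : ∀ c ∈ Ioo p q, ∃ (a : Γ) (k : ℕ), iteratedDeriv k (fun x => W a x - x) c ≠ 0)
    (φ : ℤ × ℤ →+ Γ) : CycApprox p q (fun a => W (φ a)) := by
  have hV : Act p q (fun a => W (φ a)) := h.hom φ
  by_cases htriv : ∀ x ∈ Ioo p q, W (φ (1, 0)) x = x
  · have htriv' : ∀ x ∈ Icc p q, W (φ (1, 0)) x = x := by
      intro x hx
      rcases eq_or_lt_of_le hx.1 with rfl | h1
      · exact h.left _
      rcases eq_or_lt_of_le hx.2 with rfl | h2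
      · exact h.right _
      exact htriv x ⟨h1, h2⟩
    intro k ε hε
    refine ⟨(0, 1), 0, 1, ?_, ?_⟩
    · have hz : Bd (Icc p q) k 1 ε (fun _ => (0 : ℝ)) := by
        intro j _ x _
        rw [iteratedDeriv_const]
        simp [hε.le]
      refine hz.congr h.hpq contDiff_const ((hV.smooth _).sub (hV.smooth _)) ?_
      intro x hx
      simp only [zero_smul, map_zero, htriv' x hx, h.zero hx, sub_self]
    · intro j _ x _
      simp [iteratedDeriv_const, hε.le]
  · push Not at htriv
    obtain ⟨x0, hx0, hne⟩ := htriv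
    obtain ⟨α, hα⟩ := h.exists_alpha_sg φ hx0 hne
    have hx0F : x0 ∉ CF W := fun hh => hne (hh _)
    refine core (α := α) hV (h.propS_of φ fun x hx => ?_)
    by_cases hxF : x ∈ CF W
    · exact Or.inl fun a _ => (hxF _).ge
    have hxo : x ∈ Ioo p q := by
      constructor
      · exact lt_of_le_of_ne hx.1 fun hh => hxF (hh ▸ fun a => h.left a)
      · exact lt_of_le_of_ne hx.2 fun hh => hxF (hh ▸ fun a => h.right a)
    have hs := h.sg_global hnf hxo hx0 hxF hx0F
    have k1 : ∀ y a, y ≤ W a y ↔ 0 ≤ sg W y a := fun y a => by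
      unfold sg; rw [sign_nonneg_iff, sub_nonneg]
    have k2 : ∀ y a, W a y ≤ y ↔ sg W y a ≤ 0 := fun y a => by
      unfold sg; rw [sign_nonpos_iff, sub_nonpos]
    simp only [k1, k2] at hα ⊢
    have k3 : ∀ s : SignType, 0 ≤ -s ↔ s ≤ 0 := by decide
    have k4 : ∀ s : SignType, -s ≤ 0 ↔ 0 ≤ s := by decide
    rcases hs with hs | hs
    · rw [hs]; exact hα
    · rw [hs]; simp only [Pi.neg_apply, k3, k4]; exact hα.symm

end Act

end

section
open Set Filter Topology
open scoped ContDiff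

/-- globally defined, globally increasing lifts -/
structure GD (f : ℝ → ℝ) : Prop where
  smooth : ContDiff ℝ ∞ f
  pos : ∀ x, 0 < deriv f x
  surj : Function.Surjective f
  zero : f 0 = 0
  one : f 1 = 1

lemma GD.mono {f : ℝ → ℝ} (h : GD f) : StrictMono f := strictMono_of_deriv_pos h.pos

lemma GD.maps {f : ℝ → ℝ} (h : GD f) : MapsTo f (Icc 0 1) (Icc 0 1) := fun x hx =>
  ⟨by rw [← h.zero]; exact h.mono.monotone hx.1, by rw [← h.one]; exact h.mono.monotone hx.2⟩

lemma GD.sd {f : ℝ → ℝ} (h : GD f) : SmoothDiffeoI f :=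
  ⟨h.smooth, h.zero, h.one, fun x _ => h.pos x, h.maps⟩

lemma GD.id : GD id := ⟨contDiff_id, fun x => by simp, Function.surjective_id, rfl, rfl⟩

lemma GD.comp {f g : ℝ → ℝ} (hf : GD f) (hg : GD g) : GD (f ∘ g) where
  smooth := hf.smooth.comp hg.smooth
  pos x := by
    rw [deriv_comp x (sm_diff hf.smooth _) (sm_diff hg.smooth _)]
    exact mul_pos (hf.pos _) (hg.pos _)
  surj := hf.surj.comp hg.surj
  zero := by simp [hf.zero, hg.zero]
  one := by simp [hf.one, hg.one]

lemma GD.inv {f : ℝ → ℝ} (hf : GD f) : ∃ g, GD g ∧ (∀ x, g (f x) = x) ∧ ∀ x, f (g x) = x := by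
  set e : ℝ ≃ₜ ℝ := (hf.mono.orderIsoOfSurjective f hf.surj).toHomeomorph with he
  have hef : ⇑e = f := rfl
  have hl : ∀ x, e.symm (f x) = x := fun x => by rw [← hef]; exact e.symm_apply_apply x
  have hr : ∀ x, f (e.symm x) = x := fun x => by rw [← hef]; exact e.apply_symm_apply x
  have hs : ContDiff ℝ ∞ e.symm := e.contDiff_symm_deriv (f' := deriv f)
    (fun x => (hf.pos x).ne') (fun x => (sm_diff hf.smooth x).hasDerivAt) hf.smooth
  refine ⟨e.symm, ⟨hs, fun x => ?_, e.symm.surjective, ?_, ?_⟩, hl, hr⟩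
  · have h1 : deriv (f ∘ e.symm) x = 1 := by
      have : f ∘ e.symm = _root_.id := funext hr
      rw [this]; simp
    rw [deriv_comp x (sm_diff hf.smooth _) (sm_diff hs _)] at h1
    have := hf.pos (e.symm x)
    by_contra hc
    push Not at hc
    nlinarith
  · conv_lhs => rw [← hf.zero]
    exact hl 0
  · conv_lhs => rw [← hf.one]
    exact hl 1

lemma SmoothDiffeoI.ext_gd {f : ℝ → ℝ} (h : SmoothDiffeoI f) : ∃ w, GD w ∧ EqOn w f (Icc 0 1) := by
  obtain ⟨hs, h0, h1, hp, hm⟩ := h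
  have hd := sm_deriv hs
  obtain ⟨x0, hx0, hmin⟩ := isCompact_Icc.exists_isMinOn (nonempty_Icc.2 (zero_le_one (α := ℝ)))
    hd.continuous.continuousOn
  set m := deriv f x0 with hm0
  have hmp : 0 < m := hp x0 hx0
  have hmle : ∀ x ∈ Icc (0:ℝ) 1, m ≤ deriv f x := fun x hx => hmin hx
  set h : ℝ → ℝ := fun x => m / 2 + (deriv f x - m / 2) *
    Real.smoothTransition ((deriv f x - m / 2) / (m / 2)) with hh
  have hhs : ContDiff ℝ ∞ h := by
    refine contDiff_const.add ((hd.sub contDiff_const).mul ?_)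
    exact (Real.smoothTransition.contDiff (n := ⊤)).comp ((hd.sub contDiff_const).div_const _)
  have hlow : ∀ x, m / 2 ≤ h x := fun x => by
    simp only [hh]
    rcases le_total (deriv f x - m / 2) 0 with hx | hx
    · rw [Real.smoothTransition.zero_of_nonpos (div_nonpos_of_nonpos_of_nonneg hx (by positivity))]
      simp
    · have := Real.smoothTransition.nonneg ((deriv f x - m / 2) / (m / 2))
      nlinarith [mul_nonneg hx this]
  have heq : ∀ x ∈ Icc (0:ℝ) 1, h x = deriv f x := fun x hx => by
    simp only [hh]
    rw [Real.smoothTransition.one_of_one_le]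
    · ring
    · rw [one_le_div (by positivity)]
      linarith [hmle x hx]
  set w : ℝ → ℝ := fun x => ∫ t in (0:ℝ)..x, h t with hw
  have hwd : ∀ x, HasDerivAt w (h x) x := fun x =>
    intervalIntegral.integral_hasDerivAt_right (hhs.continuous.intervalIntegrable _ _)
      (hhs.continuous.stronglyMeasurableAtFilter _ _) hhs.continuous.continuousAt
  have hwdd : deriv w = h := funext fun x => (hwd x).deriv
  have hwdf : Differentiable ℝ w := fun x => (hwd x).differentiableAt
  have hws : ContDiff ℝ ∞ w := contDiff_infty_iff_deriv.2 ⟨hwdf, by rw [hwdd]; exact hhs⟩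
  have hw0 : w 0 = 0 := by simp [hw]
  have hweq : EqOn w f (Icc 0 1) := by
    intro x hx
    have : w x = ∫ t in (0:ℝ)..x, deriv f t := by
      apply intervalIntegral.integral_congr
      intro t ht
      rw [uIcc_of_le hx.1] at ht
      exact heq t ⟨ht.1, ht.2.trans hx.2⟩
    rw [this, intervalIntegral.integral_deriv_eq_sub (fun t _ => sm_diff hs t)
      (hd.continuous.intervalIntegrable _ _), h0, sub_zero]
  have hgrow := mul_sub_le_image_sub_of_le_deriv hwdf (C := m / 2) (fun x => by rw [hwdd]; exact hlow x)
  refine ⟨w, ⟨hws, fun x => ?_, hws.continuous.surjective ?_ ?_, hw0, ?_⟩, hweq⟩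
  · rw [hwdd]; linarith [hlow x]
  · refine tendsto_atTop_mono' atTop (f₁ := fun x => m / 2 * x) ?_ (tendsto_id.const_mul_atTop (by positivity))
    filter_upwards [eventually_ge_atTop 0] with x hx
    have := hgrow hx
    rw [hw0] at this; linarith
  · refine tendsto_atBot_mono' atBot (f₁ := fun x => m / 2 * x) ?_ (tendsto_id.const_mul_atBot (half_pos hmp))
    filter_upwards [eventually_le_atBot 0] with x hx
    have := hgrow hx
    rw [hw0] at this; linarith
  · rw [hweq ⟨zero_le_one, le_rfl⟩, h1]

/-- the group of smooth diffeomorphisms of the interval -/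
def DS : Subgroup (Equiv.Perm (Icc (0:ℝ) 1)) where
  carrier := {σ | ∃ f, GD f ∧ ∀ x : Icc (0:ℝ) 1, f x = σ x}
  mul_mem' := by
    rintro σ τ ⟨f, hf, hfe⟩ ⟨g, hg, hge⟩
    exact ⟨f ∘ g, hf.comp hg, fun x => by simp [hge, hfe]⟩
  one_mem' := ⟨id, GD.id, fun x => rfl⟩
  inv_mem' := by
    rintro σ ⟨f, hf, hfe⟩
    obtain ⟨g, hg, hl, hr⟩ := hf.inv
    refine ⟨g, hg, fun x => ?_⟩
    have : f (σ⁻¹ x : Icc (0:ℝ) 1) = x := by rw [hfe]; simp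
    rw [← this, hl]

open Classical in
/-- chosen lift -/
noncomputable def lft (σ : DS) : ℝ → ℝ := if σ = 1 then id else σ.2.choose

lemma lft_one : lft 1 = id := by simp [lft]

lemma lft_gd (σ : DS) : GD (lft σ) := by
  unfold lft
  split_ifs
  · exact GD.id
  · exact σ.2.choose_spec.1

lemma lft_coe (σ : DS) (x : Icc (0:ℝ) 1) : lft σ x = σ.1 x := by
  unfold lft
  split_ifs with h
  · subst h; rfl
  · exact σ.2.choose_spec.2 x

lemma lft_eq (σ : DS) {x : ℝ} (hx : x ∈ Icc (0:ℝ) 1) : lft σ x = σ.1 ⟨x, hx⟩ := lft_coe σ ⟨x, hx⟩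

lemma lft_mul (σ τ : DS) {x : ℝ} (hx : x ∈ Icc (0:ℝ) 1) : lft (σ * τ) x = lft σ (lft τ x) := by
  rw [lft_eq _ hx, lft_eq τ hx, lft_coe]; rfl

lemma lft_inj {σ τ : DS} (h : EqOn (lft σ) (lft τ) (Icc 0 1)) : σ = τ := by
  ext x
  rw [← lft_coe, ← lft_coe, h x.2]

lemma lft_inv (σ : DS) {x : ℝ} (hx : x ∈ Icc (0:ℝ) 1) : lft σ⁻¹ (lft σ x) = x := by
  rw [← lft_mul _ _ hx, inv_mul_cancel, lft_one]; rfl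

lemma lft_inv' (σ : DS) {x : ℝ} (hx : x ∈ Icc (0:ℝ) 1) : lft σ (lft σ⁻¹ x) = x := by
  rw [← lft_mul _ _ hx, mul_inv_cancel, lft_one]; rfl

lemma exists_DS {f : ℝ → ℝ} (h : SmoothDiffeoI f) : ∃ σ : DS, EqOn (lft σ) f (Icc 0 1) := by
  obtain ⟨w, hw, he⟩ := h.ext_gd
  obtain ⟨v, hv, hl, hr⟩ := hw.inv
  refine ⟨⟨⟨fun x => ⟨w x, hw.maps x.2⟩, fun x => ⟨v x, hv.maps x.2⟩, fun x => ?_, fun x => ?_⟩,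
    w, hw, fun x => rfl⟩, ?_⟩
  · simp [hl]
  · simp [hr]
  · intro x hx
    rw [lft_eq _ hx, ← he hx]; rfl

/-- element of `DS` attached to a smooth diffeomorphism -/
noncomputable def toDS {f : ℝ → ℝ} (h : SmoothDiffeoI f) : DS := (exists_DS h).choose

lemma toDS_spec {f : ℝ → ℝ} (h : SmoothDiffeoI f) : EqOn (lft (toDS h)) f (Icc 0 1) :=
  (exists_DS h).choose_spec

end

section
open Set Filter Topology
open scoped ContDiff

/-- jets -/
noncomputable def jetC (σ : DS) (k : ℕ) : C(Icc (0:ℝ) 1, ℝ) :=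
  ContinuousMap.mk (fun x : Icc (0 : ℝ) 1 => iteratedDeriv k (lft σ) x)
    ((sm_iter (lft_gd σ).smooth k).continuous.comp continuous_subtype_val)

noncomputable instance : TopologicalSpace DS := TopologicalSpace.induced jetC inferInstance

lemma DS.inducing : IsInducing jetC := ⟨rfl⟩

lemma DS.tendsto_iff {ι : Type*} {l : Filter ι} {f : ι → DS} {σ : DS} :
    Tendsto f l (𝓝 σ) ↔ ∀ k, ∀ ε > 0, ∀ᶠ i in l,
      Bd (Icc 0 1) k 1 ε (fun x => lft (f i) x - lft σ x) := by
  rw [DS.inducing.tendsto_nhds_iff, tendsto_pi_nhds]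
  simp only [Metric.tendsto_nhds, Function.comp_apply]
  have key : ∀ (τ : DS) (j : ℕ) (x : ℝ), iteratedDeriv j (fun x => lft τ x - lft σ x) x =
      iteratedDeriv j (lft τ) x - iteratedDeriv j (lft σ) x := fun τ j x =>
    iteratedDeriv_fun_sub (sm_at (lft_gd _).smooth j x) (sm_at (lft_gd _).smooth j x)
  constructor
  · intro h k ε hε
    have : ∀ᶠ i in l, ∀ j ∈ Finset.range (k + 1), dist (jetC (f i) j) (jetC σ j) < ε := by
      rw [Filter.eventually_all_finset]
      exact fun j _ => h j ε hε
    filter_upwards [this] with i hi j hj x hx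
    have h1 := hi j (by simp; omega)
    have h2 := (ContinuousMap.dist_apply_le_dist (f := jetC (f i) j) (g := jetC σ j) ⟨x, hx⟩).trans h1.le
    rw [key]
    simpa [jetC, Real.dist_eq] using h2
  · intro h k ε hε
    filter_upwards [h k (ε / 2) (by positivity)] with i hi
    rw [ContinuousMap.dist_lt_iff hε]
    intro x
    have := hi k le_rfl x x.2
    rw [key] at this
    simp only [jetC, Real.dist_eq, ContinuousMap.coe_mk]
    simp at this
    linarith

lemma DS.mem_nhds {σ : DS} {U : Set DS} (h : U ∈ 𝓝 σ) : ∃ k : ℕ, ∃ ε > 0, ∀ τ,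
    Bd (Icc 0 1) k 1 ε (fun x => lft τ x - lft σ x) → τ ∈ U := by
  by_contra! hc
  choose τ h1 h2 using fun k : ℕ => hc k (1 / (k + 1)) (by positivity)
  have : Tendsto τ atTop (𝓝 σ) := by
    rw [DS.tendsto_iff]
    intro k ε hε
    obtain ⟨N, hN⟩ := exists_nat_one_div_lt hε
    filter_upwards [eventually_ge_atTop k, eventually_ge_atTop N] with i hi hi'
    refine ((h1 i).monoR hi).monoC zero_le_one ?_
    refine le_trans ?_ hN.le
    apply one_div_le_one_div_of_le (by positivity)
    have : (N : ℝ) ≤ i := by exact_mod_cast hi'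
    linarith
  obtain ⟨i, hi⟩ := (this.eventually h).exists
  exact h2 i hi

lemma DS.nhds_mem (σ : DS) (k : ℕ) {ε : ℝ} (hε : 0 < ε) :
    ∀ᶠ τ in 𝓝 σ, Bd (Icc 0 1) k 1 ε (fun x => lft τ x - lft σ x) :=
  DS.tendsto_iff.1 (tendsto_id (α := DS)) k ε hε

lemma lsm (σ : DS) : ContDiff ℝ ∞ (lft σ) := (lft_gd σ).smooth

lemma lmaps (σ : DS) : MapsTo (lft σ) (Icc 0 1) (Icc 0 1) := (lft_gd σ).maps

lemma Bd.cg {u v : ℝ → ℝ} {R : ℕ} {L C : ℝ} (hb : Bd (Icc 0 1) R L C u) (hu : ContDiff ℝ ∞ u)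
    (hv : ContDiff ℝ ∞ v) (he : ∀ x ∈ Icc (0:ℝ) 1, u x = v x) : Bd (Icc 0 1) R L C v :=
  hb.congr zero_lt_one hu hv he

lemma Bd.deriv_close {J : Set ℝ} {R : ℕ} {c C : ℝ} {u v : ℝ → ℝ} (hu : ContDiff ℝ ∞ u)
    (hv : ContDiff ℝ ∞ v) (h : Bd J (R + 1) 1 c (fun x => u x - v x)) (h' : Bd J R 1 C (deriv v)) :
    Bd J R 1 (c + C) (deriv u) := by
  have e : deriv u = fun x => deriv (fun x => u x - v x) x + deriv v x := by
    funext x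
    rw [deriv_fun_sub (sm_diff hu x) (sm_diff hv x)]; ring
  rw [e]
  have h2 := h.dv
  rw [mul_one] at h2
  exact h2.add (sm_deriv (hu.sub hv)) (sm_deriv hv) h'

lemma DS.mul_est (σ0 τ0 : DS) (k : ℕ) : ∃ K : ℝ, 0 < K ∧ ∀ δ, 0 < δ → δ ≤ 1 → ∀ σ τ : DS,
    Bd (Icc 0 1) (k + 1) 1 δ (fun x => lft σ x - lft σ0 x) →
    Bd (Icc 0 1) (k + 1) 1 δ (fun x => lft τ x - lft τ0 x) →
    Bd (Icc 0 1) k 1 (K * δ) (fun x => lft (σ * τ) x - lft (σ0 * τ0) x) := by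
  obtain ⟨C0, hC0, hB0⟩ := exists_Bd 0 1 (sm_deriv (lsm τ0)) k
  obtain ⟨C2, hC2, hB2⟩ := exists_Bd 0 1 (sm_deriv (lsm τ0⁻¹)) k
  obtain ⟨M, hM, hBM⟩ := exists_Bd 0 1 (sm_deriv (lsm σ0)) k
  obtain ⟨E1, hE1, c1⟩ := Bd.comp_aux (J := Icc 0 1) k (C := 1 + C0) (by positivity)
  obtain ⟨E2, hE2, c2⟩ := Bd.comp_aux (J := Icc 0 1) (k + 1) (C := C2) hC2
  obtain ⟨E3, hE3, c3⟩ := Bd.delta_aux (convex_Icc (0:ℝ) 1) k (C := E2 + 1) (by positivity)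
  refine ⟨E1 + E1 * (E3 * (M * E2)), by positivity, fun δ hδ hδ1 σ τ hσ hτ => ?_⟩
  have t1 : Bd (Icc 0 1) k 1 (E1 * δ) (fun x => lft σ (lft τ x) - lft σ0 (lft τ x)) := by
    refine c1 _ _ 1 δ ((lsm σ).sub (lsm σ0)) (lsm τ) le_rfl (lmaps τ) (hσ.monoR (by omega)) ?_
    have := (hτ.deriv_close (lsm τ) (lsm τ0) (hB0 1 le_rfl))
    exact (this.monoC zero_le_one (by linarith)).monoR (by omega)
  set h : ℝ → ℝ := fun x => lft τ (lft τ0⁻¹ x) with hh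
  have hsm : ContDiff ℝ ∞ h := (lsm τ).comp (lsm _)
  have hid : Bd (Icc 0 1) (k + 1) 1 (E2 * δ) (fun x => h x - x) := by
    have := c2 _ _ 1 δ ((lsm τ).sub (lsm τ0)) (lsm τ0⁻¹) le_rfl (lmaps _) hτ
      ((hB2 1 le_rfl).monoR (by omega))
    refine this.cg (((lsm τ).sub (lsm τ0)).comp (lsm _)) (hsm.sub contDiff_id) ?_
    intro x hx
    simp only [hh]
    rw [lft_inv' τ0 hx]
  have hdh : Bd (Icc 0 1) k 1 (E2 + 1) (deriv h) := by
    have h1 : Bd (Icc 0 1) k 1 1 (deriv fun x : ℝ => x) := by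
      have : (deriv fun x : ℝ => x) = fun _ => 1 := by funext x; simp
      rw [this]
      exact Bd.const 1 zero_le_one (by simp)
    refine (hid.deriv_close hsm contDiff_id h1).monoC zero_le_one ?_
    nlinarith
  have t2 := c3 (lft σ0) h 1 M (E2 * δ) (lsm σ0) hsm le_rfl ((lmaps τ).comp (lmaps _))
    (hBM 1 le_rfl) (hdh.monoR (by omega)) (hid.monoR (by omega))
  have t3 := c1 _ (lft τ0) 1 _ (((lsm σ0).comp hsm).sub (lsm σ0)) (lsm τ0) le_rfl (lmaps τ0) t2
    (((hB0 1 le_rfl).monoC zero_le_one (by linarith)).monoR (by omega))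
  have t4 := t1.add (((lsm σ).comp (lsm τ)).sub ((lsm σ0).comp (lsm τ)))
    ((((lsm σ0).comp hsm).sub (lsm σ0)).comp (lsm τ0)) t3
  have t5 := t4.cg (v := fun x => lft (σ * τ) x - lft (σ0 * τ0) x)
    ((((lsm σ).comp (lsm τ)).sub ((lsm σ0).comp (lsm τ))).add
      ((((lsm σ0).comp hsm).sub (lsm σ0)).comp (lsm τ0))) ((lsm _).sub (lsm _)) (by
    intro x hx
    simp only [hh, Function.comp_apply]
    rw [lft_inv τ0 hx, lft_mul _ _ hx, lft_mul _ _ hx]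
    ring)
  exact t5.monoC zero_le_one (le_of_eq (by ring))

instance : ContinuousMul DS := by
  constructor
  rw [continuous_iff_continuousAt]
  rintro ⟨σ0, τ0⟩
  rw [ContinuousAt, DS.tendsto_iff]
  intro k ε hε
  obtain ⟨K, hK, hh⟩ := DS.mul_est σ0 τ0 k
  set δ := min 1 (ε / K) with hδ
  have hδ0 : 0 < δ := lt_min one_pos (by positivity)
  have h1 := (DS.nhds_mem σ0 (k + 1) hδ0).prod_inl_nhds τ0
  have h2 := (DS.nhds_mem τ0 (k + 1) hδ0).prod_inr_nhds σ0
  filter_upwards [h1, h2] with p hp1 hp2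
  refine (hh δ hδ0 (min_le_left _ _) _ _ hp1 hp2).monoC zero_le_one ?_
  calc K * δ ≤ K * (ε / K) := by gcongr; exact min_le_right _ _
    _ = ε := by field_simp

lemma lft_inv_deriv (σ : DS) {x : ℝ} (hx : x ∈ Icc (0:ℝ) 1) :
    deriv (lft σ⁻¹) x = (deriv (lft σ) (lft σ⁻¹ x))⁻¹ := by
  have h := eqOn_deriv zero_lt_one (u := fun x => lft σ (lft σ⁻¹ x)) (v := fun x => x)
    ((lsm σ).comp (lsm _)) contDiff_id (fun x hx => lft_inv' σ hx) hx
  have e : deriv (fun x => lft σ (lft σ⁻¹ x)) x = deriv (lft σ) (lft σ⁻¹ x) * deriv (lft σ⁻¹) x :=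
    deriv_comp x (sm_diff (lsm σ) _) (sm_diff (lsm _) _)
  rw [e] at h
  have := (lft_gd σ).pos (lft σ⁻¹ x)
  simp at h
  field_simp
  linarith

lemma DS.inv_est (R : ℕ) : ∃ E : ℝ, 0 ≤ E ∧ ∀ σ : DS,
    Bd (Icc 0 1) (R + 1) 1 (1 / 2) (fun x => lft σ x - x) →
    Bd (Icc 0 1) R 1 E (deriv (lft σ⁻¹)) := by
  have hone : ∀ k, Bd (Icc 0 1) k 1 1 (deriv fun x : ℝ => x) := fun k => by
    have : (deriv fun x : ℝ => x) = fun _ => 1 := by funext x; simp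
    rw [this]
    exact Bd.const 1 zero_le_one (by simp)
  have hlow : ∀ σ : DS, ∀ k, Bd (Icc 0 1) (k + 1) 1 (1 / 2) (fun x => lft σ x - x) →
      ∀ x ∈ Icc (0:ℝ) 1, 1 / 2 ≤ |deriv (lft σ) (lft σ⁻¹ x)| := by
    intro σ k hσ x hx
    have := hσ 1 (by omega) _ (lmaps σ⁻¹ hx)
    rw [iteratedDeriv_one, deriv_fun_sub (sm_diff (lsm σ) _) differentiableAt_fun_id] at this
    simp only [deriv_id'', one_pow, mul_one] at this
    rw [abs_le] at this
    exact le_trans (by linarith) (le_abs_self _)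
  induction R with
  | zero =>
    refine ⟨2, by norm_num, fun σ hσ j hj x hx => ?_⟩
    obtain rfl : j = 0 := by omega
    rw [iteratedDeriv_zero, lft_inv_deriv σ hx, abs_inv]
    have := hlow σ 0 hσ x hx
    rw [pow_zero, mul_one]
    calc _ ≤ (1 / 2 : ℝ)⁻¹ := inv_anti₀ (by norm_num) this
      _ = 2 := by norm_num
  | succ R ih =>
    obtain ⟨E, hE, ih⟩ := ih
    obtain ⟨E1, hE1, c1⟩ := Bd.comp_aux (J := Icc 0 1) (R + 1) (C := E) hE
    obtain ⟨E2, hE2, c2⟩ := Bd.inv_aux (J := Icc 0 1) (R + 1) (C := E1 * (3 / 2)) (c := 1 / 2)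
      (by positivity) (by norm_num)
    refine ⟨E2, hE2, fun σ hσ => ?_⟩
    have h1 := ih σ (hσ.monoR (by omega))
    have h2 := (hσ.deriv_close (lsm σ) contDiff_id (hone _)).monoC zero_le_one
      (show (1/2 : ℝ) + 1 ≤ 3 / 2 by norm_num)
    have h3 := c1 _ (lft σ⁻¹) 1 _ (sm_deriv (lsm σ)) (lsm _) le_rfl (lmaps _) h2 h1
    have hsm : ContDiff ℝ ∞ (fun x => deriv (lft σ) (lft σ⁻¹ x)) := (sm_deriv (lsm σ)).comp (lsm _)
    have hne : ∀ x, deriv (lft σ) (lft σ⁻¹ x) ≠ 0 := fun x => ((lft_gd σ).pos _).ne'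
    have h4 := c2 _ 1 hsm le_rfl hne (hlow σ _ hσ) h3
    exact h4.cg (hsm.inv hne) (sm_deriv (lsm _)) fun x hx => (lft_inv_deriv σ hx).symm

lemma DS.inv_one : Tendsto (fun σ : DS => σ⁻¹) (𝓝 1) (𝓝 1) := by
  rw [DS.tendsto_iff]
  intro k ε hε
  obtain ⟨E, hE, h⟩ := DS.inv_est k
  obtain ⟨E1, hE1, c1⟩ := Bd.comp_aux (J := Icc 0 1) k (C := E) hE
  have hE1' : 0 < E1 := by linarith
  filter_upwards [DS.nhds_mem 1 (k + 1) (ε := 1 / 2) (by norm_num),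
    DS.nhds_mem 1 k (ε := ε / E1) (by positivity)] with σ h1 h2
  simp only [lft_one, id] at h1 h2 ⊢
  have h3 := h σ h1
  have h4 := c1 _ (lft σ⁻¹) 1 _ ((lsm σ).sub contDiff_id) (lsm _) le_rfl (lmaps _) h2
    (h3.monoR (by omega))
  have h5 := h4.neg.cg (v := fun x => lft σ⁻¹ x - x)
    (((lsm σ).sub contDiff_id).comp (lsm _)).neg ((lsm _).sub contDiff_id) (by
      intro x hx
      simp only [id]
      rw [lft_inv' σ hx]; ring)
  exact h5.monoC zero_le_one (le_of_eq (by field_simp))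

instance : ContinuousInv DS := by
  constructor
  rw [continuous_iff_continuousAt]
  intro σ0
  have e : (fun σ : DS => σ⁻¹) = fun σ => σ0⁻¹ * (σ * σ0⁻¹)⁻¹ := by funext σ; group
  rw [ContinuousAt, e]
  have h1 : Tendsto (fun σ : DS => σ * σ0⁻¹) (𝓝 σ0) (𝓝 1) := by
    have : Continuous fun σ : DS => σ * σ0⁻¹ := continuous_id.mul continuous_const
    simpa [ContinuousAt] using this.continuousAt (x := σ0)
  have h2 := (tendsto_const_nhds (x := σ0⁻¹)).mul (DS.inv_one.comp h1)
  simpa using h2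

instance : IsTopologicalGroup DS := {}

end

section
open Set Filter Topology
open scoped ContDiff

/-- diffeomorphisms supported in `[x,y]` -/
def Supp (x y : ℝ) : Subgroup DS where
  carrier := {σ | ∀ t ∈ Icc (0:ℝ) 1, t ∉ Icc x y → lft σ t = t}
  mul_mem' := by
    intro σ τ hσ hτ t ht ht'
    rw [lft_mul _ _ ht, hτ t ht ht', hσ t ht ht']
  one_mem' := by intro t _ _; rw [lft_one]; rfl
  inv_mem' := by
    intro σ hσ t ht ht'
    have := lft_inv σ ht
    rwa [hσ t ht ht'] at this

lemma Supp.fix_right {x y : ℝ} {σ : DS} (h : σ ∈ Supp x y) (hy : y ∈ Icc (0:ℝ) 1) {t : ℝ}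
    (ht : t ∈ Icc y 1) : lft σ t = t := by
  rcases eq_or_lt_of_le hy.2 with h1 | h1
  · obtain rfl : t = 1 := le_antisymm ht.2 (h1 ▸ ht.1)
    exact (lft_gd σ).one
  have hcl : IsClosed {t | lft σ t = t} := isClosed_eq (lsm σ).continuous continuous_id
  have hsub : Ioo y 1 ⊆ {t | lft σ t = t} := fun t ht =>
    h t ⟨hy.1.trans ht.1.le, ht.2.le⟩ fun hh => absurd hh.2 (not_le.2 ht.1)
  have := hcl.closure_subset_iff.2 hsub
  rw [closure_Ioo h1.ne] at this
  exact this ht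

lemma Supp.fix_left {x y : ℝ} {σ : DS} (h : σ ∈ Supp x y) (hx : x ∈ Icc (0:ℝ) 1) {t : ℝ}
    (ht : t ∈ Icc 0 x) : lft σ t = t := by
  rcases eq_or_lt_of_le hx.1 with h1 | h1
  · obtain rfl : t = 0 := le_antisymm (h1.symm ▸ ht.2) ht.1
    exact (lft_gd σ).zero
  have hcl : IsClosed {t | lft σ t = t} := isClosed_eq (lsm σ).continuous continuous_id
  have hsub : Ioo 0 x ⊆ {t | lft σ t = t} := fun t ht =>
    h t ⟨ht.1.le, ht.2.le.trans hx.2⟩ fun hh => absurd hh.1 (not_le.2 ht.2)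
  have := hcl.closure_subset_iff.2 hsub
  rw [closure_Ioo h1.ne] at this
  exact this ht

lemma commute_iff {σ τ : DS} :
    Commute σ τ ↔ ∀ t ∈ Icc (0:ℝ) 1, lft σ (lft τ t) = lft τ (lft σ t) := by
  constructor
  · intro h t ht
    rw [← lft_mul _ _ ht, ← lft_mul _ _ ht, h.eq]
  · intro h
    apply lft_inj
    intro t ht
    rw [lft_mul _ _ ht, lft_mul _ _ ht, h t ht]

lemma lft_fix_le {σ : DS} {c t : ℝ} (hc : lft σ c = c) (ht : t ≤ c) : lft σ t ≤ c := by
  conv_rhs => rw [← hc]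
  exact (lft_gd σ).mono.monotone ht

lemma lft_fix_ge {σ : DS} {c t : ℝ} (hc : lft σ c = c) (ht : c ≤ t) : c ≤ lft σ t := by
  conv_lhs => rw [← hc]
  exact (lft_gd σ).mono.monotone ht

lemma Supp.commute {x y z : ℝ} {σ τ : DS} (hσ : σ ∈ Supp x y) (hτ : τ ∈ Supp y z)
    (hy : y ∈ Icc (0:ℝ) 1) : Commute σ τ := by
  rw [commute_iff]
  intro t ht
  have f1 := Supp.fix_right hσ hy ⟨le_rfl, hy.2⟩
  have f2 := Supp.fix_left hτ hy ⟨hy.1, le_rfl⟩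
  rcases le_total t y with h | h
  · rw [Supp.fix_left hτ hy ⟨ht.1, h⟩, Supp.fix_left hτ hy ⟨(lmaps σ ht).1, lft_fix_le f1 h⟩]
  · rw [Supp.fix_right hσ hy ⟨h, ht.2⟩, Supp.fix_right hσ hy ⟨lft_fix_ge f2 h, (lmaps τ ht).2⟩]

lemma Supp.mono {x y x' y' : ℝ} (h1 : x' ≤ x) (h2 : y ≤ y') : Supp x y ≤ Supp x' y' :=
  fun _ hσ t ht ht' => hσ t ht fun hh => ht' ⟨h1.trans hh.1, hh.2.trans h2⟩

/-- commuting tuples supported in `[x,y]` -/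
def EE (n : ℕ) (x y : ℝ) : Set (Fin n → DS) :=
  {F | (∀ i j, Commute (F i) (F j)) ∧ ∀ i, F i ∈ Supp x y}

/-- those joined to the identity -/
def PP (n : ℕ) (x y : ℝ) : Set (Fin n → DS) := {F | JoinedIn (EE n x y) 1 F}

lemma EE.one (n : ℕ) (x y : ℝ) : (1 : Fin n → DS) ∈ EE n x y :=
  ⟨fun _ _ => Commute.one_left _, fun _ => one_mem _⟩

lemma PP.one (n : ℕ) (x y : ℝ) : (1 : Fin n → DS) ∈ PP n x y := JoinedIn.refl (EE.one n x y)

lemma EE.mul {n : ℕ} {x y z : ℝ} {F G : Fin n → DS} (hF : F ∈ EE n x y) (hG : G ∈ EE n y z)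
    (hy : y ∈ Icc (0:ℝ) 1) (hxy : x ≤ y) (hyz : y ≤ z) : F * G ∈ EE n x z := by
  refine ⟨fun i j => ?_, fun i => mul_mem (Supp.mono le_rfl hyz (hF.2 i)) (Supp.mono hxy le_rfl (hG.2 i))⟩
  have c : ∀ i j, Commute (F i) (G j) := fun i j => Supp.commute (hF.2 i) (hG.2 j) hy
  exact ((hF.1 i j).mul_right (c i j)).mul_left ((c j i).symm.mul_right (hG.1 i j))

lemma PP.mul {n : ℕ} {x y z : ℝ} {F G : Fin n → DS} (hF : F ∈ PP n x y) (hG : G ∈ PP n y z)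
    (hy : y ∈ Icc (0:ℝ) 1) (hxy : x ≤ y) (hyz : y ≤ z) : F * G ∈ PP n x z := by
  have := JoinedIn.mul hF hG
  rw [one_mul] at this
  refine this.mono ?_
  rintro _ ⟨f, hf, g, hg, rfl⟩
  exact EE.mul hf hg hy hxy hyz

lemma PP.closure_mul {n : ℕ} {x y z : ℝ} {F G : Fin n → DS} (hF : F ∈ closure (PP n x y))
    (hG : G ∈ closure (PP n y z))
    (hy : y ∈ Icc (0:ℝ) 1) (hxy : x ≤ y) (hyz : y ≤ z) : F * G ∈ closure (PP n x z) :=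
  map_mem_closure₂ continuous_mul hF hG fun _ ha _ hb => PP.mul ha hb hy hxy hyz

lemma glue_deriv {u : ℝ → ℝ} (hu : ContDiff ℝ ∞ u) {c : ℝ} (h0 : u c = 0) (h1 : deriv u c = 0)
    (t : ℝ) : HasDerivAt (fun t => if t ≤ c then u t else 0) (if t ≤ c then deriv u t else 0) t := by
  rcases lt_trichotomy t c with h | h | h
  · rw [if_pos h.le]
    refine (sm_diff hu t).hasDerivAt.congr_of_eventuallyEq ?_
    filter_upwards [Iio_mem_nhds h] with s hs
    rw [if_pos (le_of_lt hs)]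
  · subst h
    rw [if_pos le_rfl, h1, hasDerivAt_iff_isLittleO]
    have h2 := (sm_diff hu t).hasDerivAt
    rw [h1, hasDerivAt_iff_isLittleO] at h2
    refine (Asymptotics.IsBigO.of_bound 1 (Eventually.of_forall fun s => ?_)).trans_isLittleO h2
    simp only [le_refl, if_true, h0, smul_zero, sub_zero, one_mul]
    split_ifs
    · exact le_rfl
    · simp
  · rw [if_neg (not_le.2 h)]
    refine (hasDerivAt_const t (0:ℝ)).congr_of_eventuallyEq ?_
    filter_upwards [Ioi_mem_nhds h] with s hs
    rw [if_neg (not_le.2 hs)]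

lemma glue_smooth {c : ℝ} : ∀ {u : ℝ → ℝ} (_ : ContDiff ℝ ∞ u) (_ : ∀ k, iteratedDeriv k u c = 0),
    ContDiff ℝ ∞ (fun t => if t ≤ c then u t else 0) := by
  suffices H : ∀ (n : ℕ) {u : ℝ → ℝ} (_ : ContDiff ℝ ∞ u) (_ : ∀ k, iteratedDeriv k u c = 0),
      ContDiff ℝ n (fun t => if t ≤ c then u t else 0) by
    intro u hu hk
    rw [contDiff_infty]
    exact fun n => H n hu hk
  intro n
  have hd : ∀ {u : ℝ → ℝ} (_ : ContDiff ℝ ∞ u) (_ : ∀ k, iteratedDeriv k u c = 0) (t : ℝ),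
      HasDerivAt (fun t => if t ≤ c then u t else 0) (if t ≤ c then deriv u t else 0) t :=
    fun hu hk t => glue_deriv hu (by simpa using hk 0) (by simpa using hk 1) t
  induction n with
  | zero =>
    intro u hu hk
    rw [Nat.cast_zero, contDiff_zero]
    exact continuous_iff_continuousAt.2 fun t => (hd hu hk t).continuousAt
  | succ n ih =>
    intro u hu hk
    push_cast
    rw [contDiff_succ_iff_deriv]
    refine ⟨fun t => (hd hu hk t).differentiableAt, by simp, ?_⟩
    have : deriv (fun t => if t ≤ c then u t else 0) = fun t => if t ≤ c then deriv u t else 0 :=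
      funext fun t => (hd hu hk t).deriv
    rw [this]
    exact ih (sm_deriv hu) fun k => by rw [← iteratedDeriv_succ']; exact hk (k + 1)

/-- flatness of a displacement -/
def FlatAt (σ : DS) (c : ℝ) : Prop := ∀ k, iteratedDeriv k (fun t => lft σ t - t) c = 0

lemma FlatAt.fix {σ : DS} {c : ℝ} (h : FlatAt σ c) : lft σ c = c := by
  have := h 0
  rw [iteratedDeriv_zero] at this
  linarith

lemma cut {σ : DS} {c : ℝ} (hc : c ∈ Icc (0:ℝ) 1) (h : FlatAt σ c) :
    ∃ τ : DS, (∀ t ∈ Icc 0 c, lft τ t = lft σ t) ∧ ∀ t ∈ Icc c 1, lft τ t = t := by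
  set u : ℝ → ℝ := fun t => lft σ t - t with hu
  have hus : ContDiff ℝ ∞ u := (lsm σ).sub contDiff_id
  set f : ℝ → ℝ := fun t => t + if t ≤ c then u t else 0 with hf
  have hfs : ContDiff ℝ ∞ f := contDiff_id.add (glue_smooth hus h)
  have hfl : ∀ t ≤ c, f t = lft σ t := fun t ht => by simp [hf, hu, ht]
  have hfr : ∀ t, c ≤ t → f t = t := fun t ht => by
    rcases eq_or_lt_of_le ht with rfl | ht
    · rw [hfl _ le_rfl, h.fix]
    · simp [hf, not_le.2 ht]
  have hsd : SmoothDiffeoI f := by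
    refine ⟨hfs, ?_, ?_, ?_, ?_⟩
    · rw [hfl 0 hc.1, (lft_gd σ).zero]
    · rw [hfr 1 hc.2]
    · intro t _
      have hd : HasDerivAt f (1 + if t ≤ c then deriv u t else 0) t :=
        (hasDerivAt_id t).add (glue_deriv hus (by simpa using h 0) (by simpa using h 1) t)
      rw [hd.deriv]
      split_ifs
      · have : deriv u t = deriv (lft σ) t - 1 := by
          rw [hu, deriv_fun_sub (sm_diff (lsm σ) t) differentiableAt_fun_id]; simp
        rw [this]
        have := (lft_gd σ).pos t
        linarith
      · simp
    · intro t ht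
      rcases le_total t c with h' | h'
      · rw [hfl t h']; exact lmaps σ ht
      · rw [hfr t h']; exact ht
  refine ⟨toDS hsd, fun t ht => ?_, fun t ht => ?_⟩
  · rw [toDS_spec hsd ⟨ht.1, ht.2.trans hc.2⟩, hfl t ht.2]
  · rw [toDS_spec hsd ⟨hc.1.trans ht.1, ht.2⟩, hfr t ht.1]

lemma split {n : ℕ} {x c z : ℝ} {F : Fin n → DS} (hF : F ∈ EE n x z) (hc : c ∈ Icc (0:ℝ) 1)
    (hfl : ∀ i, FlatAt (F i) c) :
    ∃ G ∈ EE n x c, ∃ H ∈ EE n c z, (∀ i, ∀ t ∈ Icc 0 c, lft (G i) t = lft (F i) t) ∧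
      (∀ i, ∀ t ∈ Icc c 1, lft (H i) t = lft (F i) t) := by
  choose G hG1 hG2 using fun i => cut hc (hfl i)
  have hFc : ∀ i, lft (F i) c = c := fun i => (hfl i).fix
  have hFl : ∀ i, ∀ t ∈ Icc 0 c, lft (F i) t ∈ Icc 0 c := fun i t ht =>
    ⟨(lmaps (F i) ⟨ht.1, ht.2.trans hc.2⟩).1, lft_fix_le (hFc i) ht.2⟩
  have hFr : ∀ i, ∀ t ∈ Icc c 1, lft (F i) t ∈ Icc c 1 := fun i t ht =>
    ⟨lft_fix_ge (hFc i) ht.1, (lmaps (F i) ⟨hc.1.trans ht.1, ht.2⟩).2⟩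
  have hcomm : ∀ i j, ∀ t ∈ Icc (0:ℝ) 1, lft (F i) (lft (F j) t) = lft (F j) (lft (F i) t) :=
    fun i j => commute_iff.1 (hF.1 i j)
  set H : Fin n → DS := fun i => (G i)⁻¹ * F i with hH
  have hHl : ∀ i, ∀ t ∈ Icc 0 c, lft (H i) t = t := fun i t ht => by
    have ht1 : t ∈ Icc (0:ℝ) 1 := ⟨ht.1, ht.2.trans hc.2⟩
    simp only [hH]
    rw [lft_mul _ _ ht1, ← hG1 i t ht, lft_inv _ ht1]
  have hHr : ∀ i, ∀ t ∈ Icc c 1, lft (H i) t = lft (F i) t := fun i t ht => by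
    have ht1 : t ∈ Icc (0:ℝ) 1 := ⟨hc.1.trans ht.1, ht.2⟩
    simp only [hH]
    rw [lft_mul _ _ ht1]
    have := lft_inv (G i) (lmaps (F i) ht1)
    rwa [hG2 i _ (hFr i t ht)] at this
  refine ⟨G, ⟨fun i j => commute_iff.2 fun t ht => ?_, fun i t ht ht' => ?_⟩, H,
    ⟨fun i j => commute_iff.2 fun t ht => ?_, fun i t ht ht' => ?_⟩, hG1, hHr⟩
  · rcases le_total t c with h | h
    · have ht2 : t ∈ Icc 0 c := ⟨ht.1, h⟩
      rw [hG1 i t ht2, hG1 j t ht2, hG1 i _ (hFl j t ht2), hG1 j _ (hFl i t ht2), hcomm i j t ht]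
    · have ht2 : t ∈ Icc c 1 := ⟨h, ht.2⟩
      rw [hG2 i t ht2, hG2 j t ht2, hG2 i t ht2]
  · rcases le_total t c with h | h
    · rw [hG1 i t ⟨ht.1, h⟩]
      by_cases hz : t ∈ Icc x z
      · exact absurd ⟨hz.1, h⟩ ht'
      · exact hF.2 i t ht hz
    · exact hG2 i t ⟨h, ht.2⟩
  · rcases le_total t c with h | h
    · have ht2 : t ∈ Icc 0 c := ⟨ht.1, h⟩
      rw [hHl i t ht2, hHl j t ht2, hHl i t ht2]
    · have ht2 : t ∈ Icc c 1 := ⟨h, ht.2⟩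
      rw [hHr i t ht2, hHr j t ht2, hHr i _ (hFr j t ht2), hHr j _ (hFr i t ht2), hcomm i j t ht]
  · rcases le_total t c with h | h
    · exact hHl i t ⟨ht.1, h⟩
    · rw [hHr i t ⟨h, ht.2⟩]
      by_cases hz : t ∈ Icc x z
      · exact absurd ⟨h, hz.2⟩ ht'
      · exact hF.2 i t ht hz

end

section
open Set Filter Topology
open scoped ContDiff

lemma pi_mem_nhds {n : ℕ} {F : Fin n → DS} {U : Set (Fin n → DS)} (h : U ∈ 𝓝 F) :
    ∃ k : ℕ, ∃ ε > 0, ∀ G : Fin n → DS,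
      (∀ i, Bd (Icc 0 1) k 1 ε (fun x => lft (G i) x - lft (F i) x)) → G ∈ U := by
  by_contra! hc
  choose τ h1 h2 using fun k : ℕ => hc k (1 / (k + 1)) (by positivity)
  have : Tendsto τ atTop (𝓝 F) := by
    rw [tendsto_pi_nhds]
    intro a
    rw [DS.tendsto_iff]
    intro k ε hε
    obtain ⟨N, hN⟩ := exists_nat_one_div_lt hε
    filter_upwards [eventually_ge_atTop k, eventually_ge_atTop N] with i hi hi'
    refine ((h1 i a).monoR hi).monoC zero_le_one ?_
    refine le_trans ?_ hN.le
    apply one_div_le_one_div_of_le (by positivity)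
    have : (N : ℝ) ≤ i := by exact_mod_cast hi'
    linarith
  obtain ⟨i, hi⟩ := (this.eventually h).exists
  exact h2 i hi

lemma Bd.zero_ext {x y : ℝ} {k : ℕ} {ε : ℝ} (hε : 0 ≤ ε) {u : ℝ → ℝ} (hu : ContDiff ℝ ∞ u)
    (h : Bd (Icc x y) k 1 ε u) (hl : ∀ t ∈ Icc 0 x, u t = 0) (hr : ∀ t ∈ Icc y 1, u t = 0) :
    Bd (Icc 0 1) k 1 ε u := by
  intro j hj t ht
  by_cases h1 : t < x
  · have := eqOn_iter (ht.1.trans_lt h1) hu (contDiff_const (c := (0:ℝ))) hl j ⟨ht.1, h1.le⟩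
    rw [this, iteratedDeriv_const]
    simp [hε]
  by_cases h2 : y < t
  · have := eqOn_iter (h2.trans_le ht.2) hu (contDiff_const (c := (0:ℝ))) hr j ⟨h2.le, ht.2⟩
    rw [this, iteratedDeriv_const]
    simp [hε]
  exact h j hj t ⟨not_lt.1 h1, not_lt.1 h2⟩

/-- bound on `[x,y]` suffices for tuples supported there -/
lemma EE.bd_ext {x y : ℝ} (hx : x ∈ Icc (0:ℝ) 1) (hy : y ∈ Icc (0:ℝ) 1) {σ τ : DS}
    (hσ : σ ∈ Supp x y) (hτ : τ ∈ Supp x y) {k : ℕ} {ε : ℝ} (hε : 0 ≤ ε)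
    (h : Bd (Icc x y) k 1 ε (fun t => lft σ t - lft τ t)) :
    Bd (Icc 0 1) k 1 ε (fun t => lft σ t - lft τ t) := by
  refine h.zero_ext hε ((lsm σ).sub (lsm τ)) (fun t ht => ?_) (fun t ht => ?_)
  · rw [Supp.fix_left hσ hx ht, Supp.fix_left hτ hx ht, sub_self]
  · rw [Supp.fix_right hσ hy ht, Supp.fix_right hτ hy ht, sub_self]

lemma mem_closure_of_bd {n : ℕ} {x y : ℝ} (hx : x ∈ Icc (0:ℝ) 1) (hy : y ∈ Icc (0:ℝ) 1)
    {F : Fin n → DS} (hF : F ∈ EE n x y)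
    (H : ∀ k : ℕ, ∀ ε > 0, ∃ G ∈ EE n x y, G ∈ closure (PP n x y) ∧
      ∀ i, Bd (Icc x y) k 1 ε (fun t => lft (G i) t - lft (F i) t)) :
    F ∈ closure (PP n x y) := by
  rw [← closure_closure, mem_closure_iff_nhds]
  intro U hU
  obtain ⟨k, ε, hε, h⟩ := pi_mem_nhds hU
  obtain ⟨G, hG, hGc, hb⟩ := H k ε hε
  exact ⟨G, h G fun i => EE.bd_ext hx hy (hG.2 i) (hF.2 i) hε.le (hb i), hGc⟩

/-- the inductive claim -/
def Cl (n : ℕ) : Prop := ∀ x ∈ Icc (0:ℝ) 1, ∀ y ∈ Icc (0:ℝ) 1, x ≤ y → EE n x y ⊆ closure (PP n x y)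

lemma Cl.zero : Cl 0 := by
  intro x _ y _ _ F _
  rw [Subsingleton.elim F 1]
  exact subset_closure (PP.one 0 x y)

lemma seg_sd (σ : DS) {s : ℝ} (hs : s ∈ Icc (0:ℝ) 1) :
    SmoothDiffeoI (fun t => t + s * (lft σ t - t)) := by
  have hd : ∀ t, HasDerivAt (fun t => t + s * (lft σ t - t)) (1 + s * (deriv (lft σ) t - 1)) t :=
    fun t => (hasDerivAt_id t).add
      (((sm_diff (lsm σ) t).hasDerivAt.sub (hasDerivAt_id t)).const_mul s)
  refine ⟨contDiff_id.add (contDiff_const.mul ((lsm σ).sub contDiff_id)), ?_, ?_, ?_, ?_⟩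
  · simp [(lft_gd σ).zero]
  · simp [(lft_gd σ).one]
  · intro t _
    rw [(hd t).deriv]
    have h1 := (lft_gd σ).pos t
    rcases eq_or_lt_of_le hs.2 with h | h
    · rw [h]; linarith
    · nlinarith [hs.1, mul_nonneg hs.1 h1.le]
  · intro t ht
    have h1 := lmaps σ ht
    constructor
    · nlinarith [hs.1, hs.2, ht.1, h1.1, mul_nonneg hs.1 h1.1, mul_nonneg (sub_nonneg.2 hs.2) ht.1]
    · nlinarith [hs.1, hs.2, ht.2, h1.2, mul_nonneg hs.1 (sub_nonneg.2 h1.2),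
        mul_nonneg (sub_nonneg.2 hs.2) (sub_nonneg.2 ht.2)]

/-- straight-line path -/
noncomputable def seg (σ : DS) (s : unitInterval) : DS := toDS (seg_sd σ s.2)

lemma seg_spec (σ : DS) (s : unitInterval) {t : ℝ} (ht : t ∈ Icc (0:ℝ) 1) :
    lft (seg σ s) t = t + s * (lft σ t - t) := toDS_spec (seg_sd σ s.2) ht

lemma seg_cont (σ : DS) : Continuous (seg σ) := by
  rw [continuous_iff_continuousAt]
  intro s0
  rw [ContinuousAt, DS.tendsto_iff]
  intro k ε hε
  obtain ⟨C, hC, hb⟩ := exists_Bd 0 1 ((lsm σ).sub contDiff_id) k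
  have hev : ∀ᶠ s : unitInterval in 𝓝 s0, |(s : ℝ) - s0| < ε / (C + 1) := by
    have : Tendsto (fun s : unitInterval => (s : ℝ)) (𝓝 s0) (𝓝 (s0 : ℝ)) :=
      continuous_subtype_val.continuousAt
    have := Metric.tendsto_nhds.1 this (ε / (C + 1)) (by positivity)
    simpa [Real.dist_eq] using this
  filter_upwards [hev] with s hs
  have h1 := (hb 1 le_rfl).smul ((s : ℝ) - s0)
  have h2 := h1.cg (v := fun t => lft (seg σ s) t - lft (seg σ s0) t)
    (contDiff_const.mul ((lsm σ).sub contDiff_id)) ((lsm _).sub (lsm _)) (by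
      intro t ht
      rw [seg_spec σ s ht, seg_spec σ s0 ht]
      simp only [id]
      ring)
  refine h2.monoC zero_le_one ?_
  calc |(s : ℝ) - s0| * C ≤ ε / (C + 1) * (C + 1) := by gcongr; linarith
    _ = ε := by field_simp

lemma Cl.one : Cl 1 := by
  intro x _ y _ _ F hF
  apply subset_closure
  refine ⟨⟨⟨fun s _ => seg (F 0) s, continuous_pi fun _ => seg_cont (F 0)⟩, ?_, ?_⟩, ?_⟩
  · funext i
    apply lft_inj
    intro t ht
    show lft (seg (F 0) 0) t = lft 1 t
    rw [seg_spec _ _ ht, lft_one]; simp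
  · funext i
    apply lft_inj
    intro t ht
    show lft (seg (F 0) 1) t = _
    rw [seg_spec _ _ ht, Subsingleton.elim i 0]; simp
  · intro s
    refine ⟨fun i j => Commute.refl _, fun i t ht ht' => ?_⟩
    show lft (seg (F 0) s) t = t
    rw [seg_spec _ _ ht, hF.2 0 t ht ht']; simp

open scoped IsMulCommutative in
theorem piece {n : ℕ} (ih : Cl (n + 1)) {x y : ℝ} (hx : x ∈ Icc (0:ℝ) 1) (hy : y ∈ Icc (0:ℝ) 1)
    (hxy : x < y) {F : Fin (n + 2) → DS} (hF : F ∈ EE (n + 2) x y)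
    (hnf : ∀ c ∈ Ioo x y, ¬ ∀ i, FlatAt (F i) c) : F ∈ closure (PP (n + 2) x y) := by
  have hcm : IsMulCommutative (Subgroup.closure (range F)) := by
    apply Subgroup.isMulCommutative_closure
    rintro _ ⟨i, rfl⟩ _ ⟨j, rfl⟩
    exact hF.1 i j
  have hle : Subgroup.closure (range F) ≤ Supp x y := by
    rw [Subgroup.closure_le]
    rintro _ ⟨i, rfl⟩
    exact hF.2 i
  set W : Additive (Subgroup.closure (range F)) → ℝ → ℝ := fun a => lft (a.toMul : DS) with hW
  have hA : Act x y W :=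
    { hpq := hxy
      smooth := fun a => lsm _
      pos := fun a => (lft_gd _).pos
      left := fun a => Supp.fix_left (hle a.toMul.2) hx ⟨hx.1, le_rfl⟩
      right := fun a => Supp.fix_right (hle a.toMul.2) hy ⟨le_rfl, hy.2⟩
      add := fun a b t ht => by
        simp only [hW]
        rw [toMul_add, Subgroup.coe_mul, lft_mul _ _ ⟨hx.1.trans ht.1, ht.2.trans hy.2⟩] }
  set e : Fin (n + 2) → Additive (Subgroup.closure (range F)) := fun i =>
    Additive.ofMul ⟨F i, Subgroup.subset_closure (mem_range_self i)⟩ with he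
  set φ : ℤ × ℤ →+ Additive (Subgroup.closure (range F)) :=
    (zmultiplesHom _ (e 0)).coprod (zmultiplesHom _ (e 1)) with hφ
  have hcore := hA.piece_core (fun c hc => by
    have := hnf c hc
    simp only [FlatAt] at this
    push Not at this
    obtain ⟨i, k, hik⟩ := this
    exact ⟨e i, k, hik⟩) φ
  refine mem_closure_of_bd hx hy hF fun k ε hε => ?_
  obtain ⟨a, N1, N2, hb1, hb2⟩ := hcore k ε hε
  set ψ : DS := ((φ a).toMul : DS) with hψ
  have hψH : ψ ∈ Subgroup.closure (range F) := (φ a).toMul.2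
  have hψc : ∀ i, Commute ψ (F i) := fun i => by
    have := mul_comm (φ a).toMul (e i).toMul
    exact congrArg Subtype.val this
  have hN : ∀ N : ℤ, W (φ (N • a)) = lft (ψ ^ N) := fun N => by
    simp only [hW]
    rw [map_zsmul, toMul_zsmul, Subgroup.coe_zpow]
  have h10 : W (φ (1, 0)) = lft (F 0) := by simp [hW, hφ, he]
  have h01 : W (φ (0, 1)) = lft (F 1) := by simp [hW, hφ, he]
  set Φ : (Fin (n + 1) → DS) → (Fin (n + 2) → DS) := fun g =>
    Fin.cons (g 0 ^ N1) (Fin.cons (g 0 ^ N2) (Fin.tail g)) with hΦ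
  have hΦc : Continuous Φ := by
    refine continuous_pi fun i => ?_
    refine Fin.cases ?_ (fun i => ?_) i
    · exact (continuous_apply 0).zpow N1
    · refine Fin.cases ?_ (fun i => ?_) i
      · exact (continuous_apply 0).zpow N2
      · exact continuous_apply _
  have hΦE : ∀ g ∈ EE (n + 1) x y, Φ g ∈ EE (n + 2) x y := by
    intro g hg
    refine ⟨fun i j => ?_, fun i => ?_⟩
    · have key : ∀ i, ∃ (i' : Fin (n + 1)) (N : ℤ), Φ g i = g i' ^ N := by
        intro i
        refine Fin.cases ⟨0, N1, rfl⟩ (fun i => ?_) i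
        refine Fin.cases ⟨0, N2, rfl⟩ (fun i => ⟨i.succ, 1, ?_⟩) i
        rw [zpow_one]; rfl
      obtain ⟨i', N, e1⟩ := key i
      obtain ⟨j', M, e2⟩ := key j
      rw [e1, e2]
      exact (hg.1 i' j').zpow_zpow N M
    · refine Fin.cases ?_ (fun i => ?_) i
      · exact zpow_mem (hg.2 0) N1
      · refine Fin.cases ?_ (fun i => ?_) i
        · exact zpow_mem (hg.2 0) N2
        · exact hg.2 i.succ
  have hΦ1 : Φ 1 = 1 := by
    funext i
    refine Fin.cases ?_ (fun i => ?_) i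
    · simp [hΦ]
    · refine Fin.cases ?_ (fun i => ?_) i
      · simp [hΦ]
      · simp [hΦ, Fin.tail]
  set Ψ : Fin (n + 1) → DS := Fin.cons ψ (Fin.tail (Fin.tail F)) with hΨ
  have hΨE : Ψ ∈ EE (n + 1) x y := by
    refine ⟨fun i j => ?_, fun i => ?_⟩
    · refine Fin.cases ?_ (fun i => ?_) i
      · refine Fin.cases (Commute.refl _) (fun j => ?_) j
        exact hψc _
      · refine Fin.cases ?_ (fun j => ?_) j
        · exact (hψc _).symm
        · exact hF.1 _ _
    · refine Fin.cases ?_ (fun i => ?_) i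
      · exact hle hψH
      · exact hF.2 _
  refine ⟨Φ Ψ, hΦE Ψ hΨE, ?_, fun i => ?_⟩
  · refine map_mem_closure hΦc (ih x hx y hy hxy.le hΨE) fun g hg => ?_
    have := JoinedIn.map hg hΦc
    rw [hΦ1] at this
    refine this.mono ?_
    rintro _ ⟨g, hg, rfl⟩
    exact hΦE g hg
  · refine Fin.cases ?_ (fun i => ?_) i
    · simp only [hN, h10] at hb1
      exact hb1
    · refine Fin.cases ?_ (fun i => ?_) i
      · simp only [hN, h01] at hb2
        exact hb2
      · have : Φ Ψ i.succ.succ = F i.succ.succ := rfl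
        rw [this]
        simp only [sub_self]
        exact Bd.const 0 zero_le_one (by simpa using hε.le)

end

section
open Set Filter Topology
open scoped ContDiff

/-- approximability of `F` on `[x,y]` -/
def Good {n : ℕ} (F : Fin n → DS) (k : ℕ) (ε x y : ℝ) : Prop :=
  ∃ G ∈ EE n x y, G ∈ closure (PP n x y) ∧
    ∀ i, Bd (Icc x y) k 1 ε (fun t => lft (G i) t - lft (F i) t)

lemma Good.join {n : ℕ} {F : Fin n → DS} {k : ℕ} {ε x y z : ℝ} (h1 : Good F k ε x y)
    (h2 : Good F k ε y z) (hx : x ∈ Icc (0:ℝ) 1) (hy : y ∈ Icc (0:ℝ) 1) (hz : z ∈ Icc (0:ℝ) 1)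
    (hxy : x ≤ y) (hyz : y ≤ z) : Good F k ε x z := by
  rcases eq_or_lt_of_le hxy with rfl | hxy'
  · exact h2
  rcases eq_or_lt_of_le hyz with rfl | hyz'
  · exact h1
  obtain ⟨G, hG, hGc, hGb⟩ := h1
  obtain ⟨H, hH, hHc, hHb⟩ := h2
  refine ⟨G * H, EE.mul hG hH hy hxy hyz, PP.closure_mul hGc hHc hy hxy hyz, fun i => ?_⟩
  have e1 : ∀ t ∈ Icc x y, lft ((G * H) i) t = lft (G i) t := fun t ht => by
    rw [Pi.mul_apply, lft_mul _ _ ⟨hx.1.trans ht.1, ht.2.trans hy.2⟩,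
      Supp.fix_left (hH.2 i) hy ⟨hx.1.trans ht.1, ht.2⟩]
  have e2 : ∀ t ∈ Icc y z, lft ((G * H) i) t = lft (H i) t := fun t ht => by
    have ht1 : t ∈ Icc (0:ℝ) 1 := ⟨hy.1.trans ht.1, ht.2.trans hz.2⟩
    rw [Pi.mul_apply, lft_mul _ _ ht1]
    refine Supp.fix_right (hG.2 i) hy ⟨lft_fix_ge ?_ ht.1, (lmaps _ ht1).2⟩
    exact Supp.fix_left (hH.2 i) hy ⟨hy.1, le_rfl⟩
  have b1 := (hGb i).congr hxy' ((lsm _).sub (lsm _)) (v := fun t => lft ((G * H) i) t - lft (F i) t)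
    ((lsm _).sub (lsm _)) (fun t ht => by simp only [e1 t ht])
  have b2 := (hHb i).congr hyz' ((lsm _).sub (lsm _)) (v := fun t => lft ((G * H) i) t - lft (F i) t)
    ((lsm _).sub (lsm _)) (fun t ht => by simp only [e2 t ht])
  intro j hj t ht
  rcases le_total t y with h | h
  · exact b1 j hj t ⟨ht.1, h⟩
  · exact b2 j hj t ⟨h, ht.2⟩

lemma Good.short {n : ℕ} (F : Fin n → DS) (k : ℕ) {ε : ℝ} (hε : 0 < ε) :
    ∃ η > 0, ∀ x ∈ Icc (0:ℝ) 1, ∀ y ∈ Icc (0:ℝ) 1, y - x ≤ η → (∀ i, FlatAt (F i) x) →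
      Good F k ε x y := by
  choose C hC hb using fun i => exists_Bd 0 1 ((lsm (F i)).sub contDiff_id) (k + 1)
  set M := ∑ i, C i with hM
  have hM0 : 0 ≤ M := Finset.sum_nonneg fun i _ => hC i
  have hCM : ∀ i, C i ≤ M := fun i => Finset.single_le_sum (fun i _ => hC i) (Finset.mem_univ i)
  refine ⟨ε / (M + 1), by positivity, fun x hx y hy hxy hfl => ?_⟩
  refine ⟨1, EE.one _ _ _, subset_closure (PP.one _ _ _), fun i => ?_⟩
  have : Bd (Icc x y) k 1 ε (fun t => lft (F i) t - t) := by
    intro j hj t ht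
    set u : ℝ → ℝ := iteratedDeriv j (fun t => lft (F i) t - t) with hu
    have hus : ContDiff ℝ ∞ u := sm_iter ((lsm (F i)).sub contDiff_id) j
    have hux : u x = 0 := hfl i j
    have h1 : ∀ s ∈ Icc x y, ‖deriv u s‖ ≤ M := fun s hs => by
      have := hb i 1 le_rfl (j + 1) (by omega) s ⟨hx.1.trans hs.1, hs.2.trans hy.2⟩
      rw [iteratedDeriv_succ] at this
      simp only [one_pow, mul_one] at this
      exact this.trans (hCM i)
    have h2 := (convex_Icc x y).norm_image_sub_le_of_norm_deriv_le (fun s _ => sm_diff hus s) h1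
      (left_mem_Icc.2 (ht.1.trans ht.2)) ht
    rw [hux, sub_zero, Real.norm_eq_abs, Real.norm_eq_abs, abs_of_nonneg (sub_nonneg.2 ht.1)] at h2
    rw [one_pow, mul_one]
    have h3 : t - x ≤ ε / (M + 1) := by linarith [ht.2]
    calc |u t| ≤ M * (t - x) := h2
      _ ≤ (M + 1) * (ε / (M + 1)) := by
        have := ht.1
        apply mul_le_mul (by linarith) h3 (by linarith) (by positivity)
      _ = ε := by field_simp
  have e : (fun t => lft ((1 : Fin n → DS) i) t - lft (F i) t) = fun t => -(lft (F i) t - t) := by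
    funext t
    rw [Pi.one_apply, lft_one]; simp
  rw [e]
  exact this.neg

lemma flat_congr {σ τ : DS} {a b c : ℝ} (hab : a < b) (hc : c ∈ Icc a b)
    (h : ∀ t ∈ Icc a b, lft σ t = lft τ t) (hf : FlatAt τ c) : FlatAt σ c := by
  intro k
  have h2 := eqOn_iter hab (u := fun t => lft σ t - t) (v := fun t => lft τ t - t)
    ((lsm σ).sub contDiff_id) ((lsm τ).sub contDiff_id) (fun t ht => by simp only [h t ht]) k hc
  rw [h2]
  exact hf k

lemma Good.gap {n : ℕ} (ih : Cl (n + 1)) {x0 y0 : ℝ} (hx0 : x0 ∈ Icc (0:ℝ) 1)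
    (hy0 : y0 ∈ Icc (0:ℝ) 1) {F : Fin (n + 2) → DS} (hF : F ∈ EE (n + 2) x0 y0) (k : ℕ) {ε : ℝ}
    (hε : 0 < ε) {c d : ℝ} (hxc : x0 ≤ c) (hcd : c ≤ d) (hdy : d ≤ y0)
    (hc : (∀ i, FlatAt (F i) c) ∨ c = x0) (hd : (∀ i, FlatAt (F i) d) ∨ d = y0)
    (heq : c = d → ∀ i, FlatAt (F i) c) (hnf : ∀ s ∈ Ioo c d, ¬ ∀ i, FlatAt (F i) s) :
    Good F k ε c d := by
  have hc1 : c ∈ Icc (0:ℝ) 1 := ⟨hx0.1.trans hxc, (hcd.trans hdy).trans hy0.2⟩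
  have hd1 : d ∈ Icc (0:ℝ) 1 := ⟨hc1.1.trans hcd, hdy.trans hy0.2⟩
  rcases eq_or_lt_of_le hcd with rfl | hlt
  · obtain ⟨η, hη, h⟩ := Good.short F k hε
    exact h c hc1 c hc1 (by simpa using hη.le) (heq rfl)
  have s1 : ∃ H ∈ EE (n + 2) c y0, ∀ i, ∀ t ∈ Icc c 1, lft (H i) t = lft (F i) t := by
    rcases hc with hc | rfl
    · obtain ⟨-, -, H, hH, -, h⟩ := split hF hc1 hc
      exact ⟨H, hH, h⟩
    · exact ⟨F, hF, fun _ _ _ => rfl⟩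
  obtain ⟨H, hH, hHF⟩ := s1
  have s2 : ∃ G ∈ EE (n + 2) c d, ∀ i, ∀ t ∈ Icc 0 d, lft (G i) t = lft (H i) t := by
    rcases hd with hd | rfl
    · obtain ⟨G, hG, -, -, h, -⟩ := split hH hd1 fun i =>
        flat_congr (hlt.trans_le hd1.2) ⟨hcd, hd1.2⟩ (hHF i) (hd i)
      exact ⟨G, hG, h⟩
    · exact ⟨H, hH, fun _ _ _ => rfl⟩
  obtain ⟨G, hG, hGH⟩ := s2
  have hGF : ∀ i, ∀ t ∈ Icc c d, lft (G i) t = lft (F i) t := fun i t ht => by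
    rw [hGH i t ⟨hc1.1.trans ht.1, ht.2⟩, hHF i t ⟨ht.1, ht.2.trans hd1.2⟩]
  refine ⟨G, hG, piece ih hc1 hd1 hlt hG fun s hs hfl => hnf s hs fun i => ?_, fun i => ?_⟩
  · exact flat_congr hlt ⟨hs.1.le, hs.2.le⟩ (fun t ht => (hGF i t ht).symm) (hfl i)
  · have : Bd (Icc c d) k 1 ε (fun _ => (0:ℝ)) := Bd.const 0 zero_le_one (by simpa using hε.le)
    refine this.congr hlt contDiff_const ((lsm _).sub (lsm _)) fun t ht => ?_
    simp only [hGF i t ht, sub_self]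

lemma Cl.succ {n : ℕ} (ih : Cl (n + 1)) : Cl (n + 2) := by
  intro x0 hx0 y0 hy0 hle F hF
  refine mem_closure_of_bd hx0 hy0 hF fun k ε hε => ?_
  show Good F k ε x0 y0
  set A : Set ℝ := {c | c ∈ Icc x0 y0 ∧ ∀ i, FlatAt (F i) c} with hA
  have hI : ∀ {c}, c ∈ A → c ∈ Icc (0:ℝ) 1 := fun {c} hc =>
    ⟨hx0.1.trans hc.1.1, hc.1.2.trans hy0.2⟩
  have hAc : IsClosed A := by
    have : A = Icc x0 y0 ∩ ⋂ i, ⋂ k, {c | iteratedDeriv k (fun t => lft (F i) t - t) c = 0} := by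
      ext c
      simp [hA, FlatAt]
    rw [this]
    refine isClosed_Icc.inter (isClosed_iInter fun i => isClosed_iInter fun k => ?_)
    exact isClosed_eq (sm_iter ((lsm _).sub contDiff_id) k).continuous continuous_const
  have hbb : ∀ B ⊆ A, BddAbove B ∧ BddBelow B := fun B hB =>
    ⟨⟨y0, fun c hc => (hB hc).1.2⟩, ⟨x0, fun c hc => (hB hc).1.1⟩⟩
  obtain ⟨η, hη, hshort⟩ := Good.short F k hε
  have dy : ∀ m : ℕ, ∀ x ∈ A, ∀ y ∈ A, x ≤ y → y - x ≤ η * 2 ^ m → Good F k ε x y := by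
    intro m
    induction m with
    | zero =>
      intro x hx y hy _ h
      exact hshort x (hI hx) y (hI hy) (by simpa using h) hx.2
    | succ m ihm =>
      intro x hx y hy hxy h
      set mid := (x + y) / 2 with hmid
      have hm1 : x ≤ mid := by rw [hmid]; linarith
      have hm2 : mid ≤ y := by rw [hmid]; linarith
      have hcl1 : IsClosed (A ∩ Icc x mid) := hAc.inter isClosed_Icc
      have hcl2 : IsClosed (A ∩ Icc mid y) := hAc.inter isClosed_Icc
      have hb1 := hbb _ (inter_subset_left (s := A) (t := Icc x mid))
      have hb2 := hbb _ (inter_subset_left (s := A) (t := Icc mid y))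
      have hc := hcl1.csSup_mem ⟨x, hx, le_rfl, hm1⟩ hb1.1
      have hd := hcl2.csInf_mem ⟨y, hy, hm2, le_rfl⟩ hb2.2
      set c := sSup (A ∩ Icc x mid) with hcdef
      set d := sInf (A ∩ Icc mid y) with hddef
      have hcd : c ≤ d := hc.2.2.trans hd.2.1
      have e2 : y - x ≤ 2 * (η * 2 ^ m) := by rw [pow_succ] at h; linarith
      have g1 : Good F k ε x c := ihm x hx c hc.1 hc.2.1 (by
        have := hc.2.2; rw [hmid] at this; linarith)
      have g3 : Good F k ε d y := ihm d hd.1 y hy hd.2.2 (by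
        have := hd.2.1; rw [hmid] at this; linarith)
      have g2 : Good F k ε c d := by
        refine Good.gap ih hx0 hy0 hF k hε hc.1.1.1 hcd hd.1.1.2 (Or.inl hc.1.2) (Or.inl hd.1.2)
          (fun _ => hc.1.2) fun s hs hfl => ?_
        have hsA : s ∈ A := ⟨⟨hc.1.1.1.trans hs.1.le, hs.2.le.trans hd.1.1.2⟩, hfl⟩
        rcases le_total s mid with h' | h'
        · have := le_csSup hb1.1 ⟨hsA, hc.2.1.trans hs.1.le, h'⟩
          exact absurd hs.1 (not_lt.2 this)
        · have := csInf_le hb2.2 ⟨hsA, h', hs.2.le.trans hd.2.2⟩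
          exact absurd hs.2 (not_lt.2 this)
      exact (g1.join g2 (hI hx) (hI hc.1) (hI hd.1) hc.2.1 hcd).join g3 (hI hx) (hI hd.1) (hI hy)
        (hc.2.1.trans hcd) hd.2.2
  have dy' : ∀ x ∈ A, ∀ y ∈ A, x ≤ y → Good F k ε x y := by
    intro x hx y hy hxy
    obtain ⟨m, hm⟩ := pow_unbounded_of_one_lt ((y - x) / η) (one_lt_two (α := ℝ))
    refine dy m x hx y hy hxy ?_
    rw [div_lt_iff₀ hη] at hm
    linarith
  rcases A.eq_empty_or_nonempty with hem | hne
  · rcases eq_or_lt_of_le hle with heq | hlt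
    · exfalso
      have h1 : ∀ i, F i = 1 := fun i => by
        apply lft_inj
        intro t ht
        rw [lft_one]
        rcases le_total t x0 with h | h
        · exact Supp.fix_left (hF.2 i) hx0 ⟨ht.1, h⟩
        · exact Supp.fix_right (hF.2 i) hy0 ⟨heq ▸ h, ht.2⟩
      have : x0 ∈ A := ⟨⟨le_rfl, hle⟩, fun i k => by
        rw [h1 i, lft_one]
        simp [iteratedDeriv_const]⟩
      rw [hem] at this
      exact this
    · refine Good.gap ih hx0 hy0 hF k hε le_rfl hle le_rfl (Or.inr rfl) (Or.inr rfl)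
        (fun h => absurd h hlt.ne) fun s hs hfl => ?_
      have : s ∈ A := ⟨⟨hs.1.le, hs.2.le⟩, hfl⟩
      rw [hem] at this
      exact this
  · have hb := hbb A Subset.rfl
    have ha := hAc.csInf_mem hne hb.2
    have hb' := hAc.csSup_mem hne hb.1
    set a := sInf A with hadef
    set b := sSup A with hbdef
    have hab : a ≤ b := csInf_le hb.2 hb'
    have g1 : Good F k ε x0 a := by
      refine Good.gap ih hx0 hy0 hF k hε le_rfl ha.1.1 ha.1.2 (Or.inr rfl) (Or.inl ha.2)
        (fun h => h ▸ ha.2) fun s hs hfl => ?_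
      have := csInf_le hb.2 (⟨⟨hs.1.le, hs.2.le.trans ha.1.2⟩, hfl⟩ : s ∈ A)
      exact absurd hs.2 (not_lt.2 this)
    have g3 : Good F k ε b y0 := by
      refine Good.gap ih hx0 hy0 hF k hε hb'.1.1 hb'.1.2 le_rfl (Or.inl hb'.2) (Or.inr rfl)
        (fun _ => hb'.2) fun s hs hfl => ?_
      have := le_csSup hb.1 (⟨⟨hb'.1.1.trans hs.1.le, hs.2.le⟩, hfl⟩ : s ∈ A)
      exact absurd hs.1 (not_lt.2 this)
    exact (g1.join (dy' a ha b hb' hab) hx0 (hI ha) (hI hb') ha.1.1 hab).join g3 hx0 (hI hb') hy0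
      (ha.1.1.trans hab) hb'.1.2

lemma Cl.all : ∀ n, Cl n
  | 0 => Cl.zero
  | 1 => Cl.one
  | n + 2 => Cl.succ (Cl.all (n + 1))

/-- the tuple in `DS` of a representation -/
noncomputable def toTuple {n : ℕ} (F : RepSpace n) : Fin n → DS := fun i => toDS (F.2.1 i)

lemma toTuple_spec {n : ℕ} (F : RepSpace n) (i : Fin n) : EqOn (lft (toTuple F i)) (F.1 i) (Icc 0 1) :=
  toDS_spec (F.2.1 i)

lemma toTuple_inducing (n : ℕ) : IsInducing (toTuple (n := n)) := by
  have h := Topology.IsInducing.piMap (fun _ : Fin n => DS.inducing)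
  constructor
  rw [h.eq_induced, induced_compose]
  show TopologicalSpace.induced _ _ = _
  congr 1
  funext F i k
  ext x
  simp only [Function.comp_apply, Pi.map_apply, jetC, ContinuousMap.coe_mk]
  exact (eqOn_iter zero_lt_one (lsm _) (F.2.1 i).1 (toTuple_spec F i) k x.2).symm

/-- the representation attached to a commuting tuple -/
noncomputable def ofTuple {n : ℕ} (G : EE n 0 1) : RepSpace n :=
  ⟨fun i => lft (G.1 i), fun i => (lft_gd _).sd, fun i j => commute_iff.1 (G.2.1 i j)⟩

lemma toTuple_ofTuple {n : ℕ} (G : EE n 0 1) : toTuple (ofTuple G) = G.1 := by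
  funext i
  exact lft_inj (toTuple_spec (ofTuple G) i)

lemma ofTuple_cont (n : ℕ) : Continuous (ofTuple (n := n)) := by
  rw [(toTuple_inducing n).continuous_iff]
  have : toTuple ∘ ofTuple (n := n) = Subtype.val := funext toTuple_ofTuple
  rw [this]
  exact continuous_subtype_val

lemma toTuple_mem {n : ℕ} (F : RepSpace n) : toTuple F ∈ EE n 0 1 := by
  refine ⟨fun i j => commute_iff.2 fun t ht => ?_, fun i t ht ht' => absurd ht ht'⟩
  have hm : ∀ i, F.1 i t ∈ Icc (0:ℝ) 1 := fun i => (F.2.1 i).2.2.2.2 ht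
  rw [toTuple_spec F i ht, toTuple_spec F j ht, toTuple_spec F i (hm j), toTuple_spec F j (hm i)]
  exact F.2.2 i j t ht

lemma ofTuple_one (n : ℕ) : ofTuple ⟨1, EE.one n 0 1⟩ = idRep n := by
  apply Subtype.ext
  funext i
  show lft 1 = id
  exact lft_one

theorem dense_connected_aux (n : ℕ) :
    Dense (pathComponent (idRep n)) ∧ ConnectedSpace (RepSpace n) := by
  have hdense : Dense (pathComponent (idRep n)) := by
    intro F
    rw [mem_closure_iff_nhds]
    intro U hU
    rw [(toTuple_inducing n).nhds_eq_comap, mem_comap] at hU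
    obtain ⟨V, hV, hVU⟩ := hU
    have h1 := Cl.all n 0 ⟨le_rfl, zero_le_one⟩ 1 ⟨zero_le_one, le_rfl⟩ zero_le_one (toTuple_mem F)
    obtain ⟨G, hGV, hG⟩ := mem_closure_iff_nhds.1 h1 V hV
    have hj := hG.joined_subtype
    have hj2 := hj.map (ofTuple_cont n)
    rw [ofTuple_one] at hj2
    refine ⟨_, hVU ?_, hj2⟩
    show toTuple (ofTuple _) ∈ V
    rw [toTuple_ofTuple]
    exact hGV
  refine ⟨hdense, ?_⟩
  rw [connectedSpace_iff_univ, ← hdense.closure_eq]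
  exact (isPathConnected_pathComponent.isConnected).closure

end

/-- **Theorem A.** For every `n ≥ 1`, in the space `R_n` of `C^∞` orientation-preserving
actions of `ℤⁿ` on `[0,1]` with the `C^∞` topology, the path-connected component of
`(id, …, id)` is dense; in particular `R_n` is connected. -/
theorem dense_pathComponent_id_and_connected_repSpace (n : ℕ) (hn : 1 ≤ n) :
    Dense (pathComponent (idRep n)) ∧ ConnectedSpace (RepSpace n) := by
  exact dense_connected_aux n
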